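/- arXiv:math/0509668 — 2 statements merged into one kernel-verified Lean document; each statement's English description precedes it below -/
import Mathlib

section
/- Let 1 ≤ p < 2 and γ > 0 with γ·p' ≤ 1, where p' = p/(p−1) is the Hölder conjugate exponent of p. Let V : ℝ → ℝ be measurable and locally integrable with ∫_ℝ |V(x)|^p·(1+|x|)^{γp} dx < ∞. Then the set of momenta k > 0 for which there do NOT exist solutions u₊, u₋ of −u'' + V u = k²u (in the integral sense) with u₊(x)·exp(−i(kx − (1/(2k))·∫₀ˣ V(y) dy)) → 1 as x → +∞ and u₋(x)·exp(−i(kx − (1/(2k))·∫₀ˣ V(y) dy)) → 1 as x → −∞ has Hausdorff dimension at most 1 − γ·p'. -/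
open Real Set MeasureTheory Filter


/-- `u : ℝ → ℂ` solves `-u'' + V u = E u` in the integral sense:
`u` is differentiable and `u'(x) = u'(0) + ∫₀ˣ (V(y) - E) u(y) dy`. -/
def SchrodingerSolution (V : ℝ → ℝ) (E : ℝ) (u : ℝ → ℂ) : Prop :=
  Differentiable ℝ u ∧
    ∀ x : ℝ, deriv u x = deriv u 0 + ∫ y in (0:ℝ)..x, ((V y : ℂ) - (E : ℂ)) * u y

/-- `u` has WKB asymptotics at the filter `l` (`atTop` or `atBot`) for momentum `k`:
`u(x) exp(-i(kx - (1/(2k)) ∫₀ˣ V)) → 1`. -/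
def HasWKBAsymptotics (V : ℝ → ℝ) (k : ℝ) (u : ℝ → ℂ) (l : Filter ℝ) : Prop :=
  Tendsto (fun x : ℝ =>
      u x * Complex.exp (-(Complex.I *
        ((k * x - (1 / (2 * k)) * ∫ y in (0:ℝ)..x, V y : ℝ) : ℂ)))) l (nhds 1)

def CKPrim (F f : ℝ → ℂ) : Prop :=
  LocallyIntegrable f ∧ ∀ x y, F y - F x = ∫ t in x..y, f t

theorem ck_ii {f : ℝ → ℂ} (hf : LocallyIntegrable f) (x y : ℝ) :
    IntervalIntegrable f volume x y :=
  intervalIntegrable_iff.mpr <|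
    (hf.integrableOn_isCompact isCompact_uIcc).mono_set uIoc_subset_uIcc

theorem ck_iiR {f : ℝ → ℝ} (hf : LocallyIntegrable f) (x y : ℝ) :
    IntervalIntegrable f volume x y :=
  intervalIntegrable_iff.mpr <|
    (hf.integrableOn_isCompact isCompact_uIcc).mono_set uIoc_subset_uIcc

theorem ck_ac_dom {F : ℝ → ℂ} {G : ℝ → ℝ} {x y : ℝ} (K : ℝ)
    (hG : AbsolutelyContinuousOnInterval G x y)
    (h : ∀ s ∈ uIcc x y, ∀ t ∈ uIcc x y, dist (F s) (F t) ≤ K * dist (G s) (G t)) :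
    AbsolutelyContinuousOnInterval F x y := by
  have hG2 := hG.const_mul K
  unfold AbsolutelyContinuousOnInterval at hG ⊢
  have h3 := Tendsto.const_mul K hG
  rw [mul_zero] at h3
  refine squeeze_zero' (Eventually.of_forall fun E => Finset.sum_nonneg fun i _ => dist_nonneg)
    ?_ h3
  have : ∀ᶠ E in (AbsolutelyContinuousOnInterval.totalLengthFilter ⊓
    𝓟 (AbsolutelyContinuousOnInterval.disjWithin x y)),
      E ∈ AbsolutelyContinuousOnInterval.disjWithin x y :=
    Filter.mem_inf_of_right (Filter.mem_principal_self _)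
  filter_upwards [this] with E hE
  rw [Finset.mul_sum]
  refine Finset.sum_le_sum fun i hi => ?_
  have := hE.1 i hi
  exact h _ this.1 _ this.2

theorem CKPrim.ac {F f : ℝ → ℂ} (h : CKPrim F f) (x y : ℝ) :
    AbsolutelyContinuousOnInterval F x y := by
  have hn : IntervalIntegrable (fun t => ‖f t‖) volume x y := (ck_ii h.1 x y).norm
  refine ck_ac_dom 1 (hn.absolutelyContinuousOnInterval_intervalIntegral (c := x) left_mem_uIcc) ?_
  intro s hs t ht
  have hns : ∀ s t, IntervalIntegrable (fun t => ‖f t‖) volume s t :=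
    fun s t => (ck_ii h.1 s t).norm
  rw [one_mul, dist_eq_norm, h.2 t s, Real.dist_eq,
    intervalIntegral.integral_interval_sub_left (hns _ _) (hns _ _)]
  refine (intervalIntegral.norm_integral_le_abs_integral_norm).trans (le_refl _)

theorem CKPrim.ae_deriv {F f : ℝ → ℂ} (h : CKPrim F f) : ∀ᵐ x, HasDerivAt F (f x) x := by
  filter_upwards [LocallyIntegrable.ae_hasDerivAt_integral h.1] with x hx
  have := (hx 0).const_add (F 0)
  refine this.congr_of_eventuallyEq (Eventually.of_forall fun y => ?_)
  simp only
  rw [← h.2 0 y]; ring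

theorem CKPrim.continuous {F f : ℝ → ℂ} (h : CKPrim F f) : Continuous F := by
  rw [continuous_iff_continuousAt]
  intro x
  have := (h.ac (x-1) (x+1)).continuousOn
  refine this.continuousAt ?_
  rw [uIcc_of_le (by linarith)]
  exact Icc_mem_nhds (by linarith) (by linarith)

theorem ck_prim_of {F f : ℝ → ℂ} (hf : LocallyIntegrable f)
    (hF : ∀ x y, AbsolutelyContinuousOnInterval F x y)
    (hd : ∀ᵐ x, HasDerivAt F (f x) x) : CKPrim F f := by
  refine ⟨hf, fun x y => ?_⟩
  set P : ℝ → ℂ := fun y => ∫ t in x..y, f t with hP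
  have hPp : CKPrim P f := by
    refine ⟨hf, fun s t => ?_⟩
    simp only [hP]
    rw [intervalIntegral.integral_interval_sub_left (ck_ii hf _ _) (ck_ii hf _ _)]
  have hac : AbsolutelyContinuousOnInterval (fun t => F t - P t) x y := (hF x y).sub (hPp.ac x y)
  obtain ⟨C, hC⟩ := hac.const_of_ae_hasDerivAt_zero (by
    filter_upwards [hd, hPp.ae_deriv] with t h1 h2 _
    have := h1.sub h2
    rwa [sub_self] at this)
  have e1 := hC x left_mem_uIcc
  have e2 := hC y right_mem_uIcc
  have e3 : P x = 0 := by simp [hP]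
  have : F y - F x = P y := by
    rw [e3] at e1
    linear_combination e2 - e1
  exact this

theorem ck_li_mul {f g : ℝ → ℂ} (hf : LocallyIntegrable f) (hg : Continuous g) :
    LocallyIntegrable (fun x => g x * f x) := by
  rw [← locallyIntegrableOn_univ] at hf ⊢
  exact hf.continuousOn_mul hg.continuousOn isOpen_univ.isLocallyClosed

theorem CKPrim.mul {F f G g : ℝ → ℂ} (hF : CKPrim F f) (hG : CKPrim G g) :
    CKPrim (fun x => F x * G x) (fun x => G x * f x + F x * g x) := by
  refine ck_prim_of ((ck_li_mul hF.1 hG.continuous).add (ck_li_mul hG.1 hF.continuous)) ?_ ?_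
  · intro x y
    exact (hF.ac x y).smul (hG.ac x y)
  · filter_upwards [hF.ae_deriv, hG.ae_deriv] with t h1 h2
    have := h1.mul h2
    rw [mul_comm (f t)] at this
    exact this

theorem CKPrim.exp {F f : ℝ → ℂ} (hF : CKPrim F f) :
    CKPrim (fun x => Complex.exp (F x)) (fun x => Complex.exp (F x) * f x) := by
  refine ck_prim_of (ck_li_mul hF.1 (Complex.continuous_exp.comp hF.continuous)) ?_ ?_
  · intro x y
    obtain ⟨R, hR⟩ := (isCompact_uIcc (a := x) (b := y)).exists_bound_of_continuousOn
      hF.continuous.continuousOn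
    have hn : IntervalIntegrable (fun t => ‖f t‖) volume x y := (ck_ii hF.1 x y).norm
    refine ck_ac_dom (Real.exp R)
      (hn.absolutelyContinuousOnInterval_intervalIntegral (c := x) left_mem_uIcc) ?_
    intro s hs t ht
    have hns : ∀ s t, IntervalIntegrable (fun t => ‖f t‖) volume s t :=
      fun s t => (ck_ii hF.1 s t).norm
    have h1 : dist (F s) (F t) ≤ dist (∫ t in x..s, ‖f t‖) (∫ t in x..t, ‖f t‖) := by
      rw [dist_eq_norm, hF.2 t s, Real.dist_eq,
        intervalIntegral.integral_interval_sub_left (hns _ _) (hns _ _)]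
      exact intervalIntegral.norm_integral_le_abs_integral_norm
    refine le_trans ?_ (mul_le_mul_of_nonneg_left h1 (Real.exp_pos R).le)
    rw [dist_eq_norm, dist_eq_norm]
    refine (convex_closedBall (0:ℂ) R).norm_image_sub_le_of_norm_deriv_le
      (f := Complex.exp) (fun z _ => Complex.differentiable_exp z) ?_ ?_ ?_
    · intro z hz
      rw [Complex.deriv_exp, Complex.norm_exp]
      exact Real.exp_le_exp.2 ((Complex.re_le_norm z).trans (by simpa using hz))
    · simpa using hR t ht
    · simpa using hR s hs
  · filter_upwards [hF.ae_deriv] with t h1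
    exact h1.cexp

theorem CKPrim.const_mul {F f : ℝ → ℂ} (c : ℂ) (h : CKPrim F f) :
    CKPrim (fun x => c * F x) (fun x => c * f x) :=
  ⟨ck_li_mul h.1 continuous_const, fun x y => by
    rw [intervalIntegral.integral_const_mul, ← h.2 x y]; ring⟩

theorem CKPrim.add {F f G g : ℝ → ℂ} (h : CKPrim F f) (h' : CKPrim G g) :
    CKPrim (fun x => F x + G x) (fun x => f x + g x) :=
  ⟨h.1.add h'.1, fun x y => by
    rw [intervalIntegral.integral_add (ck_ii h.1 _ _) (ck_ii h'.1 _ _), ← h.2 x y, ← h'.2 x y]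
    ring⟩

theorem CKPrim.conj {F f : ℝ → ℂ} (h : CKPrim F f) :
    CKPrim (fun x => (starRingEnd ℂ) (F x)) (fun x => (starRingEnd ℂ) (f x)) := by
  refine ⟨?_, fun x y => ?_⟩
  · have := h.1
    intro x
    obtain ⟨U, hU, hi⟩ := this x
    exact ⟨U, hU, (Complex.conjLIE.toContinuousLinearEquiv.toContinuousLinearMap).integrable_comp hi⟩
  · rw [← map_sub, h.2 x y, intervalIntegral.intervalIntegral_eq_integral_uIoc,
      intervalIntegral.intervalIntegral_eq_integral_uIoc, integral_conj, Complex.real_smul,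
      Complex.real_smul, map_mul, Complex.conj_ofReal]

theorem CKPrim.congr {F f G g : ℝ → ℂ} (h : CKPrim F f) (h1 : ∀ x, F x = G x)
    (h2 : ∀ x, f x = g x) : CKPrim G g := by
  have e1 : F = G := funext h1
  have e2 : f = g := funext h2
  rwa [← e1, ← e2]

theorem ck_prim_integral {f : ℝ → ℂ} (hf : LocallyIntegrable f) (c : ℝ) :
    CKPrim (fun x => ∫ t in c..x, f t) f :=
  ⟨hf, fun x y => by
    rw [intervalIntegral.integral_interval_sub_left (ck_ii hf _ _) (ck_ii hf _ _)]⟩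

theorem ck_weight {g : ℝ → ℝ} (hg : LocallyIntegrable g) (h0 : ∀ t, 0 ≤ g t) (x0 x : ℝ) :
    |∫ t in x0..x, g t * Real.exp (2 * |∫ r in x0..t, g r|)| ≤
      Real.exp (2 * |∫ r in x0..x, g r|) / 2 := by
  have hgc : LocallyIntegrable (fun t => (g t : ℂ)) := by
    intro x
    obtain ⟨U, hU, hi⟩ := hg x
    exact ⟨U, hU, hi.ofReal⟩
  have key : ∀ c : ℝ, c ≠ 0 → ∀ y, ∫ t in x0..y, g t * Real.exp (c * ∫ r in x0..t, g r) =
      (Real.exp (c * ∫ r in x0..y, g r) - 1) / c := by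
    intro c hc y
    have h1 := ((ck_prim_integral hgc x0).const_mul (c : ℂ)).exp.2 x0 y
    simp only [intervalIntegral.integral_same, mul_zero, Complex.exp_zero] at h1
    have h2 : ∀ t, Complex.exp ((c:ℂ) * ∫ r in x0..t, (g r : ℂ)) =
        ((Real.exp (c * ∫ r in x0..t, g r) : ℝ) : ℂ) := by
      intro t
      rw [intervalIntegral.integral_ofReal]
      push_cast
      rfl
    simp only [h2] at h1
    have h3 : ∀ t, ((Real.exp (c * ∫ r in x0..t, g r) : ℝ) : ℂ) * ((c:ℂ) * (g t : ℂ)) =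
       ((c * (g t * Real.exp (c * ∫ r in x0..t, g r)) : ℝ) : ℂ) := by
      intro t; push_cast; ring
    simp only [h3] at h1
    rw [intervalIntegral.integral_ofReal, intervalIntegral.integral_const_mul] at h1
    have h4 : Real.exp (c * ∫ r in x0..y, g r) - 1 =
        c * ∫ t in x0..y, g t * Real.exp (c * ∫ r in x0..t, g r) := by
      exact_mod_cast h1
    rw [h4]; field_simp
  rcases le_total x0 x with h | h
  · have e : ∫ t in x0..x, g t * Real.exp (2 * |∫ r in x0..t, g r|) =
        ∫ t in x0..x, g t * Real.exp (2 * ∫ r in x0..t, g r) := by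
      refine intervalIntegral.integral_congr fun t ht => ?_
      rw [uIcc_of_le h] at ht
      rw [abs_of_nonneg (intervalIntegral.integral_nonneg ht.1 fun u _ => h0 u)]
    rw [e, key 2 (by norm_num), abs_of_nonneg (a := ∫ r in x0..x, g r)
      (intervalIntegral.integral_nonneg h fun u _ => h0 u)]
    have : 1 ≤ Real.exp (2 * ∫ r in x0..x, g r) :=
      Real.one_le_exp (mul_nonneg (by norm_num)
        (intervalIntegral.integral_nonneg h fun u _ => h0 u))
    rw [abs_of_nonneg (by linarith)]
    linarith
  · have e0 : ∀ t, t ≤ x0 → |∫ r in x0..t, g r| = -∫ r in x0..t, g r := by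
      intro t ht
      rw [intervalIntegral.integral_symm, abs_neg, neg_neg,
        abs_of_nonneg (intervalIntegral.integral_nonneg ht fun u _ => h0 u)]
    have e : ∫ t in x0..x, g t * Real.exp (2 * |∫ r in x0..t, g r|) =
        ∫ t in x0..x, g t * Real.exp ((-2) * ∫ r in x0..t, g r) := by
      refine intervalIntegral.integral_congr fun t ht => ?_
      rw [uIcc_of_ge h] at ht
      rw [e0 t ht.2]; congr 2; ring
    rw [e, key (-2) (by norm_num), ← neg_mul_neg, ← e0 x h, neg_neg]
    have : 1 ≤ Real.exp (2 * |∫ r in x0..x, g r|) :=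
      Real.one_le_exp (mul_nonneg (by norm_num) (abs_nonneg _))
    rw [abs_of_nonpos (by linarith)]
    linarith

theorem ck_exists_sol {V : ℝ → ℝ} (hV : LocallyIntegrable V) (E x0 : ℝ) (u0 w0 : ℂ) :
    ∃ u w : ℝ → ℂ, u x0 = u0 ∧ w x0 = w0 ∧ CKPrim u w ∧
      CKPrim w (fun x => ((V x : ℂ) - (E : ℂ)) * u x) := by
  classical
  set q : ℝ → ℂ := fun x => (V x : ℂ) - (E : ℂ) with hq
  set g : ℝ → ℝ := fun x => 1 + ‖q x‖ with hgd
  have hqi : LocallyIntegrable q := by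
    refine LocallyIntegrable.sub (fun x => ?_) (continuous_const.locallyIntegrable)
    obtain ⟨U, hU, hi⟩ := hV x
    exact ⟨U, hU, hi.ofReal⟩
  have hg : LocallyIntegrable g := (continuous_const.locallyIntegrable).add fun x => by
    obtain ⟨U, hU, hi⟩ := hqi x
    exact ⟨U, hU, hi.norm⟩
  have h0 : ∀ t, 0 ≤ g t := fun t => by positivity
  set W : ℝ → ℝ := fun x => Real.exp (2 * |∫ r in x0..x, g r|) with hW
  have hWc : Continuous W := by
    have : Continuous fun x => ∫ r in x0..x, g r :=
      intervalIntegral.continuous_primitive (fun a b => ck_iiR hg a b) x0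
    fun_prop
  have hWp : ∀ x, 0 < W x := fun x => Real.exp_pos _
  have hgW : LocallyIntegrable (fun t => g t * W t) := by
    have := hg
    rw [← locallyIntegrableOn_univ] at this ⊢
    exact this.mul_continuousOn hWc.continuousOn isOpen_univ.isLocallyClosed
  have hw : ∀ x, |∫ t in x0..x, g t * W t| ≤ W x / 2 := fun x => ck_weight hg h0 x0 x
  have hWcc : Continuous (fun x => (W x : ℂ)) := Complex.continuous_ofReal.comp hWc
  -- the basic bound
  have bd : ∀ (m : ℝ → ℂ) (z : ℝ → ℂ) (K : ℝ), (∀ t, ‖m t‖ ≤ g t) → (∀ t, ‖z t‖ ≤ K) →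
      0 ≤ K → ∀ x, ‖∫ t in x0..x, m t * ((W t : ℂ) * z t)‖ ≤ W x / 2 * K := by
    intro m z K hm hz hK x
    have h1 : ‖∫ t in x0..x, m t * ((W t : ℂ) * z t)‖ ≤ |∫ t in x0..x, (g t * W t) * K| := by
      refine intervalIntegral.norm_integral_le_abs_of_norm_le (Eventually.of_forall fun t => ?_)
        ((ck_iiR hgW _ _).mul_const K)
      rw [norm_mul, norm_mul, Complex.norm_of_nonneg (hWp t).le, mul_assoc]
      exact mul_le_mul (hm t) (mul_le_mul_of_nonneg_left (hz t) (hWp t).le)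
        (mul_nonneg (hWp t).le (norm_nonneg _)) (h0 t)
    rw [intervalIntegral.integral_mul_const, abs_mul, abs_of_nonneg hK] at h1
    exact h1.trans (mul_le_mul_of_nonneg_right (hw x) hK)
  have hm1 : ∀ t, ‖(1:ℂ)‖ ≤ g t := fun t => by simp [hgd]
  have hm2 : ∀ t, ‖q t‖ ≤ g t := fun t => by simp [hgd]
  have li1 : LocallyIntegrable (fun _ : ℝ => (1:ℂ)) := continuous_const.locallyIntegrable
  have lim : ∀ (m z : ℝ → ℂ), LocallyIntegrable m → Continuous z →
      LocallyIntegrable (fun t => m t * ((W t : ℂ) * z t)) := by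
    intro m z hm hz
    have := ck_li_mul hm (hWcc.mul hz)
    refine this.congr (Eventually.of_forall fun t => ?_)
    simp only [Pi.mul_apply]; ring
  -- fixed-point map
  let φ : (m : ℝ → ℂ) → ℂ → (ℝ → ℂ) → ℝ → ℂ := fun m c z x =>
    ((W x)⁻¹ : ℝ) * (c + ∫ t in x0..x, m t * ((W t : ℂ) * z t))
  have φc : ∀ m c z, LocallyIntegrable m → Continuous z → Continuous (φ m c z) := by
    intro m c z hm hz
    have h1 : Continuous fun x => ((W x)⁻¹ : ℝ) := hWc.inv₀ fun x => (hWp x).ne'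
    have h2 := (ck_prim_integral (lim m z hm hz) x0).continuous
    exact (Complex.continuous_ofReal.comp h1).mul (continuous_const.add h2)
  have φd : ∀ (m : ℝ → ℂ) c z z' K, LocallyIntegrable m → Continuous z → Continuous z' →
      (∀ t, ‖m t‖ ≤ g t) → 0 ≤ K → (∀ t, ‖z t - z' t‖ ≤ K) →
      ∀ x, ‖φ m c z x - φ m c z' x‖ ≤ K / 2 := by
    intro m c z z' K hm hz hz' hmg hK hzz x
    have e : φ m c z x - φ m c z' x =
        ((W x)⁻¹ : ℝ) * ∫ t in x0..x, m t * ((W t : ℂ) * (z t - z' t)) := by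
      simp only [φ]
      rw [← mul_sub, add_sub_add_left_eq_sub, ← intervalIntegral.integral_sub
        (ck_ii (lim m z hm hz) _ _) (ck_ii (lim m z' hm hz') _ _)]
      congr 2
      ext t; ring
    rw [e, norm_mul, Complex.norm_of_nonneg (inv_nonneg.2 (hWp x).le)]
    have := bd m (fun t => z t - z' t) K hmg hzz hK x
    calc (W x)⁻¹ * ‖∫ t in x0..x, m t * ((W t : ℂ) * (z t - z' t))‖ ≤ (W x)⁻¹ * (W x / 2 * K) :=
          mul_le_mul_of_nonneg_left this (inv_nonneg.2 (hWp x).le)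
      _ = K / 2 := by have := (hWp x).ne'; field_simp
  have W1 : ∀ x, 1 ≤ W x := fun x => Real.one_le_exp (by positivity)
  have φ0 : ∀ (m : ℝ → ℂ) c x, ‖φ m c (fun _ => 0) x‖ ≤ ‖c‖ := by
    intro m c x
    simp only [φ, mul_zero, intervalIntegral.integral_zero, add_zero, norm_mul]
    rw [Complex.norm_of_nonneg (inv_nonneg.2 (hWp x).le)]
    exact mul_le_of_le_one_left (norm_nonneg _) (inv_le_one_of_one_le₀ (W1 x))
  have φb : ∀ (m : ℝ → ℂ) c z K, LocallyIntegrable m → Continuous z →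
      (∀ t, ‖m t‖ ≤ g t) → 0 ≤ K → (∀ t, ‖z t‖ ≤ K) → ∀ x, ‖φ m c z x‖ ≤ ‖c‖ + K / 2 := by
    intro m c z K hm hz hmg hK hzz x
    have h1 := φd m c z (fun _ => 0) K hm hz continuous_const hmg hK (by simpa using hzz) x
    have h2 := φ0 m c x
    calc ‖φ m c z x‖ = ‖φ m c (fun _ => 0) x + (φ m c z x - φ m c (fun _ => 0) x)‖ := by
          congr 1; ring
      _ ≤ _ := (norm_add_le _ _).trans (add_le_add h2 h1)
  let Φ : BoundedContinuousFunction ℝ (ℂ × ℂ) → BoundedContinuousFunction ℝ (ℂ × ℂ) := fun Z =>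
    BoundedContinuousFunction.ofNormedAddCommGroup
      (fun x => (φ (fun _ => 1) u0 (fun t => (Z t).2) x, φ q w0 (fun t => (Z t).1) x))
      ((φc _ _ _ li1 (by fun_prop)).prodMk (φc _ _ _ hqi (by fun_prop)))
      (max (‖u0‖ + ‖Z‖ / 2) (‖w0‖ + ‖Z‖ / 2))
      (by
        intro x
        rw [Prod.norm_mk]
        refine max_le_max ?_ ?_
        · exact φb _ _ _ _ li1 (by fun_prop) hm1 (norm_nonneg _)
            (fun t => (norm_snd_le _).trans (Z.norm_coe_le_norm t)) x
        · exact φb _ _ _ _ hqi (by fun_prop) hm2 (norm_nonneg _)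
            (fun t => (norm_fst_le _).trans (Z.norm_coe_le_norm t)) x)
  have hΦ : ContractingWith (1/2 : NNReal) Φ := by
    refine ⟨by rw [← NNReal.coe_lt_coe]; norm_num, LipschitzWith.of_dist_le_mul fun Z Z' => ?_⟩
    rw [BoundedContinuousFunction.dist_le (by positivity)]
    intro x
    have hd : ∀ t, ‖Z t - Z' t‖ ≤ dist Z Z' := fun t => by
      rw [← dist_eq_norm]; exact BoundedContinuousFunction.dist_coe_le_dist t
    have k1 := φd (fun _ => 1) u0 (fun t => (Z t).2) (fun t => (Z' t).2) (dist Z Z') li1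
      (by fun_prop) (by fun_prop) hm1 dist_nonneg
      (fun t => (norm_snd_le (Z t - Z' t)).trans (hd t)) x
    have k2 := φd q w0 (fun t => (Z t).1) (fun t => (Z' t).1) (dist Z Z') hqi
      (by fun_prop) (by fun_prop) hm2 dist_nonneg
      (fun t => (norm_fst_le (Z t - Z' t)).trans (hd t)) x
    rw [dist_eq_norm]
    have : Φ Z x - Φ Z' x = (φ (fun _ => 1) u0 (fun t => (Z t).2) x -
      φ (fun _ => 1) u0 (fun t => (Z' t).2) x, φ q w0 (fun t => (Z t).1) x -
      φ q w0 (fun t => (Z' t).1) x) := rfl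
    rw [this, Prod.norm_mk]
    refine max_le ?_ ?_
    · push_cast; linarith
    · push_cast; linarith
  let Z := hΦ.fixedPoint
  have hZ : Φ Z = Z := hΦ.fixedPoint_isFixedPt
  have f1 : ∀ x, φ (fun _ => 1) u0 (fun t => (Z t).2) x = (Z x).1 := fun x =>
    congrArg (fun F : BoundedContinuousFunction ℝ (ℂ × ℂ) => (F x).1) hZ
  have f2 : ∀ x, φ q w0 (fun t => (Z t).1) x = (Z x).2 := fun x =>
    congrArg (fun F : BoundedContinuousFunction ℝ (ℂ × ℂ) => (F x).2) hZ
  have hWne : ∀ x, (W x : ℂ) ≠ 0 := fun x => Complex.ofReal_ne_zero.2 (hWp x).ne'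
  have g1 : ∀ x, (W x : ℂ) * (Z x).1 = u0 + ∫ t in x0..x, 1 * ((W t : ℂ) * (Z t).2) := by
    intro x
    rw [← f1 x]
    simp only [φ]
    rw [Complex.ofReal_inv, mul_inv_cancel_left₀ (hWne x)]
  have g2 : ∀ x, (W x : ℂ) * (Z x).2 = w0 + ∫ t in x0..x, q t * ((W t : ℂ) * (Z t).1) := by
    intro x
    rw [← f2 x]
    simp only [φ]
    rw [Complex.ofReal_inv, mul_inv_cancel_left₀ (hWne x)]
  refine ⟨fun x => (W x : ℂ) * (Z x).1, fun x => (W x : ℂ) * (Z x).2, ?_, ?_, ?_, ?_⟩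
  · simp only; rw [g1]; simp
  · simp only; rw [g2]; simp
  · have := ck_prim_integral (lim (fun _ => 1) (fun t => (Z t).2) li1 (by fun_prop)) x0
    refine ⟨by simpa using this.1, fun x y => ?_⟩
    have h := this.2 x y
    simp only [one_mul] at h g1
    beta_reduce at h ⊢
    rw [g1, g1, ← h]; ring
  · have := ck_prim_integral (lim q (fun t => (Z t).1) hqi (by fun_prop)) x0
    refine ⟨this.1, fun x y => ?_⟩
    have h := this.2 x y
    beta_reduce at h ⊢
    rw [g2, g2]
    change _ = ∫ (t : ℝ) in x..y, q t * (↑(W t) * (Z t).1)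
    rw [← h]; ring

noncomputable def ckPh (V : ℝ → ℝ) (k x : ℝ) : ℝ := k * x - (1 / (2 * k)) * ∫ y in (0:ℝ)..x, V y

noncomputable def ckE (V : ℝ → ℝ) (k x : ℝ) : ℂ := Complex.exp (2 * (Complex.I * (ckPh V k x : ℂ)))

theorem ck_ph_prim {V : ℝ → ℝ} (hV : LocallyIntegrable V) (k : ℝ) :
    CKPrim (fun x => (ckPh V k x : ℂ)) (fun x => (k : ℂ) - (1 / (2 * k) : ℂ) * V x) := by
  have hVc : LocallyIntegrable (fun t => (V t : ℂ)) := by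
    intro x
    obtain ⟨U, hU, hi⟩ := hV x
    exact ⟨U, hU, hi.ofReal⟩
  have h1 : CKPrim (fun x => (x:ℂ)) (fun _ => (1:ℂ)) :=
    ⟨continuous_const.locallyIntegrable, fun x y => by simp⟩
  refine ((h1.const_mul (k:ℂ)).add
    ((ck_prim_integral hVc 0).const_mul (-(1 / (2 * k) : ℂ)))).congr ?_ ?_
  · intro x
    simp only [ckPh]
    rw [intervalIntegral.integral_ofReal]
    push_cast; ring
  · intro x; ring

theorem ck_norm_ckE (V : ℝ → ℝ) (k x : ℝ) : ‖ckE V k x‖ = 1 := by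
  rw [ckE, Complex.norm_exp]; simp

theorem ck_ab {V : ℝ → ℝ} (hV : LocallyIntegrable V) {k : ℝ} (hk : 0 < k) {u w : ℝ → ℂ}
    (hu : CKPrim u w) (hw : CKPrim w (fun x => ((V x : ℂ) - ((k^2 : ℝ) : ℂ)) * u x)) :
    CKPrim (fun x => Complex.exp (-(Complex.I * ckPh V k x)) * (u x / 2 - Complex.I * w x / (2 * k)))
      (fun x => -(Complex.I / (2 * k)) * (V x * (starRingEnd ℂ) (ckE V k x)) *
        (Complex.exp (Complex.I * ckPh V k x) * (u x / 2 + Complex.I * w x / (2 * k)))) ∧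
    CKPrim (fun x => Complex.exp (Complex.I * ckPh V k x) * (u x / 2 + Complex.I * w x / (2 * k)))
      (fun x => (Complex.I / (2 * k)) * (V x * ckE V k x) *
        (Complex.exp (-(Complex.I * ckPh V k x)) * (u x / 2 - Complex.I * w x / (2 * k)))) := by
  have hk' : (k : ℂ) ≠ 0 := Complex.ofReal_ne_zero.2 hk.ne'
  have hI := Complex.I_mul_I
  have hconj : ∀ x, (starRingEnd ℂ) (ckE V k x) =
      Complex.exp (-(Complex.I * ckPh V k x)) * Complex.exp (-(Complex.I * ckPh V k x)) := by
    intro x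
    rw [ckE, ← Complex.exp_conj, ← Complex.exp_add]
    congr 1
    simp only [map_mul, Complex.conj_I, Complex.conj_ofReal, map_ofNat]
    ring
  have hE : ∀ x, ckE V k x =
      Complex.exp (Complex.I * ckPh V k x) * Complex.exp (Complex.I * ckPh V k x) := by
    intro x
    rw [ckE, ← Complex.exp_add]
    congr 1
    ring
  have hinv : ∀ x, Complex.exp (-(Complex.I * ckPh V k x)) *
      Complex.exp (Complex.I * ckPh V k x) = 1 := by
    intro x
    rw [← Complex.exp_add]; simp
  have e1 := ((ck_ph_prim hV k).const_mul (-Complex.I)).exp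
  simp only [neg_mul] at e1
  have e2 := ((ck_ph_prim hV k).const_mul (Complex.I)).exp
  constructor
  · refine (e1.mul ((hu.const_mul (1/2)).add (hw.const_mul (-(Complex.I / (2 * k)))))).congr ?_ ?_
    · intro x
      ring
    · intro x
      rw [hconj]
      have := hinv x
      generalize Complex.exp (-(Complex.I * ckPh V k x)) = e at *
      generalize Complex.exp ((Complex.I * ckPh V k x)) = f at *
      push_cast
      have h3 : -(Complex.I / (2 * (k:ℂ))) * ((V x:ℂ) * (e * e)) * (f * (u x / 2 + Complex.I * w x / (2 * k)))
        = -(Complex.I / (2 * (k:ℂ))) * ((V x:ℂ) * e) * (u x / 2 + Complex.I * w x / (2 * k)) := by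
        linear_combination (-(Complex.I / (2 * (k:ℂ))) * ((V x:ℂ) * e) * (u x / 2 + Complex.I * w x / (2 * k))) * this
      rw [h3]
      field_simp
      ring_nf
      simp only [Complex.I_sq]
      ring
  · refine (e2.mul ((hu.const_mul (1/2)).add (hw.const_mul ((Complex.I / (2 * k)))))).congr ?_ ?_
    · intro x
      ring
    · intro x
      rw [hE]
      have := hinv x
      generalize Complex.exp (-(Complex.I * ckPh V k x)) = e at *
      generalize Complex.exp ((Complex.I * ckPh V k x)) = f at *
      push_cast
      have h3 : (Complex.I / (2 * (k:ℂ))) * ((V x:ℂ) * (f * f)) * (e * (u x / 2 - Complex.I * w x / (2 * k)))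
        = (Complex.I / (2 * (k:ℂ))) * ((V x:ℂ) * f) * (u x / 2 - Complex.I * w x / (2 * k)) := by
        linear_combination ((Complex.I / (2 * (k:ℂ))) * ((V x:ℂ) * f) * (u x / 2 - Complex.I * w x / (2 * k))) * this
      rw [h3]
      field_simp
      ring_nf
      simp only [Complex.I_sq]
      ring

theorem ck_sol_of_prim {V : ℝ → ℝ} {E : ℝ} {u w : ℝ → ℂ} (hu : CKPrim u w)
    (hw : CKPrim w (fun x => ((V x : ℂ) - (E : ℂ)) * u x)) : SchrodingerSolution V E u := by
  have hd : ∀ x, HasDerivAt u (w x) x := by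
    intro x
    have h1 : HasDerivAt (fun y => ∫ t in (0:ℝ)..y, w t) (w x) x :=
      intervalIntegral.integral_hasDerivAt_right (ck_ii hu.1 _ _)
        hw.continuous.aestronglyMeasurable.stronglyMeasurableAtFilter hw.continuous.continuousAt
    refine (h1.const_add (u 0)).congr_of_eventuallyEq (Eventually.of_forall fun y => ?_)
    beta_reduce
    rw [← hu.2 0 y]; ring
  refine ⟨fun x => (hd x).differentiableAt, fun x => ?_⟩
  rw [(hd x).deriv, (hd 0).deriv, ← hw.2 0 x]; ring

theorem ck_wkb_of_conv {V : ℝ → ℝ} (hV : LocallyIntegrable V) {k : ℝ} (hk : 0 < k) (x0 : ℝ)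
    (H : ∀ a b : ℝ → ℂ, a x0 = 1 → b x0 = 0 →
      CKPrim a (fun x => -(Complex.I / (2 * k)) * (V x * (starRingEnd ℂ) (ckE V k x)) * b x) →
      CKPrim b (fun x => (Complex.I / (2 * k)) * (V x * ckE V k x) * a x) →
      ∃ a' b' : ℂ, Tendsto a atTop (nhds a') ∧ Tendsto b atTop (nhds b') ∧ ‖b'‖ < ‖a'‖) :
    ∃ u, SchrodingerSolution V (k^2) u ∧ HasWKBAsymptotics V k u atTop := by
  have hk' : (k : ℂ) ≠ 0 := Complex.ofReal_ne_zero.2 hk.ne'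
  set e := Complex.exp (Complex.I * ckPh V k x0) with he
  obtain ⟨u, w, hu0, hw0, hu, hw⟩ := ck_exists_sol hV (k^2) x0 e (Complex.I * k * e)
  obtain ⟨ha, hb⟩ := ck_ab hV hk hu hw
  have hinv : ∀ x, Complex.exp (-(Complex.I * ckPh V k x)) *
      Complex.exp (Complex.I * ckPh V k x) = 1 := by
    intro x
    rw [← Complex.exp_add]; simp
  obtain ⟨a', b', hta, htb, hlt⟩ := H _ _ (by
    beta_reduce
    rw [hu0, hw0]
    have h2 : e / 2 - Complex.I * (Complex.I * k * e) / (2 * k) = e := by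
      field_simp; ring_nf; simp only [Complex.I_sq]; ring
    rw [h2, he, hinv]) (by
    beta_reduce
    rw [hu0, hw0]
    have h2 : e / 2 + Complex.I * (Complex.I * k * e) / (2 * k) = 0 := by
      field_simp; ring_nf; simp only [Complex.I_sq]; ring
    rw [h2, mul_zero]) ha hb
  set D : ℂ := a' * (starRingEnd ℂ) a' - b' * (starRingEnd ℂ) b' with hD
  have hD0 : D ≠ 0 := by
    rw [hD, Complex.mul_conj, Complex.mul_conj, ← Complex.ofReal_sub, Complex.ofReal_ne_zero,
      Complex.normSq_eq_norm_sq, Complex.normSq_eq_norm_sq]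
    have := norm_nonneg b'
    nlinarith
  set α : ℂ := (starRingEnd ℂ) a' / D with hα
  set β : ℂ := - b' / D with hβ
  have hu2 := hu.conj
  have hw2 := hw.conj
  have hU := (hu.const_mul α).add (hu2.const_mul β)
  have hW := (hw.const_mul α).add (hw2.const_mul β)
  refine ⟨_, ck_sol_of_prim hU (hW.congr (fun _ => rfl) ?_), ?_⟩
  · intro x
    simp only [map_mul, map_sub, Complex.conj_ofReal]
    ring
  · set a : ℝ → ℂ := fun x => Complex.exp (-(Complex.I * ckPh V k x)) * (u x / 2 - Complex.I * w x / (2 * k)) with ha_def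
    set b : ℝ → ℂ := fun x => Complex.exp (Complex.I * ckPh V k x) * (u x / 2 + Complex.I * w x / (2 * k)) with hb_def
    have hue : ∀ x, u x * Complex.exp (-(Complex.I * ckPh V k x)) = a x + b x * (starRingEnd ℂ) (ckE V k x) := by
      intro x
      have hconj : (starRingEnd ℂ) (ckE V k x) =
          Complex.exp (-(Complex.I * ckPh V k x)) * Complex.exp (-(Complex.I * ckPh V k x)) := by
        rw [ckE, ← Complex.exp_conj, ← Complex.exp_add]
        congr 1
        simp only [map_mul, Complex.conj_I, Complex.conj_ofReal, map_ofNat]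
        ring
      simp only [ha_def, hb_def]
      rw [hconj]
      have := hinv x
      linear_combination (-(Complex.exp (-(Complex.I * ckPh V k x)) * (u x / 2 + Complex.I * w x / (2 * k)))) * this
    have hue2 : ∀ x, (starRingEnd ℂ) (u x) * Complex.exp (-(Complex.I * ckPh V k x)) =
        (starRingEnd ℂ) (b x) + (starRingEnd ℂ) (a x) * (starRingEnd ℂ) (ckE V k x) := by
      intro x
      have hec : (starRingEnd ℂ) (Complex.exp (-(Complex.I * ckPh V k x))) = Complex.exp (Complex.I * ckPh V k x) := by
        rw [← Complex.exp_conj]; congr 1; simp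
      have h1 := congrArg (starRingEnd ℂ) (hue x)
      rw [map_mul, hec, map_add, map_mul (starRingEnd ℂ) (b x), Complex.conj_conj] at h1
      have hconj : (starRingEnd ℂ) (ckE V k x) =
          Complex.exp (-(Complex.I * ckPh V k x)) * Complex.exp (-(Complex.I * ckPh V k x)) := by
        rw [ckE, ← Complex.exp_conj, ← Complex.exp_add]
        congr 1
        simp only [map_mul, Complex.conj_I, Complex.conj_ofReal, map_ofNat]
        ring
      have hE : ckE V k x =
          Complex.exp (Complex.I * ckPh V k x) * Complex.exp (Complex.I * ckPh V k x) := by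
        rw [ckE, ← Complex.exp_add]
        congr 1
        ring
      rw [hconj]
      rw [hE] at h1
      have := hinv x
      generalize Complex.exp (-(Complex.I * ckPh V k x)) = e at *
      generalize Complex.exp ((Complex.I * ckPh V k x)) = f at *
      linear_combination (e^2) * h1 + ((starRingEnd ℂ) (b x) * (e*f+1) - (starRingEnd ℂ) (u x) * e) * this
    have hfin : Tendsto (fun x => (α * a x + β * (starRingEnd ℂ) (b x)) +
        (α * b x + β * (starRingEnd ℂ) (a x)) * (starRingEnd ℂ) (ckE V k x)) atTop (nhds 1) := by
      have c1 : Tendsto (fun x => α * a x + β * (starRingEnd ℂ) (b x)) atTop (nhds 1) := by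
        have := (hta.const_mul α).add (((Complex.continuous_conj.tendsto b').comp htb).const_mul β)
        have e1 : α * a' + β * (starRingEnd ℂ) b' = 1 := by
          rw [hα, hβ]; field_simp; rw [hD]; ring
        rw [e1] at this
        exact this
      have c2 : Tendsto (fun x => α * b x + β * (starRingEnd ℂ) (a x)) atTop (nhds 0) := by
        have := (htb.const_mul α).add (((Complex.continuous_conj.tendsto a').comp hta).const_mul β)
        have e1 : α * b' + β * (starRingEnd ℂ) a' = 0 := by
          rw [hα, hβ]; field_simp; ring
        rw [e1] at this
        exact this
      have c3 : Tendsto (fun x => (α * b x + β * (starRingEnd ℂ) (a x)) * (starRingEnd ℂ) (ckE V k x)) atTop (nhds 0) := by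
        refine squeeze_zero_norm (fun x => ?_) (by simpa using c2.norm)
        rw [norm_mul, RCLike.norm_conj, ck_norm_ckE, mul_one]
      simpa using c1.add c3
    refine hfin.congr fun x => ?_
    have h1 := hue x
    have h2 := hue2 x
    change _ = (α * u x + β * (starRingEnd ℂ) (u x)) * Complex.exp (-(Complex.I * ckPh V k x))
    linear_combination -α * h1 - β * h2

noncomputable def ckX (k : ℝ) (σ : ℂ) (v : ℂ × ℂ) : ℂ × ℂ :=
  (-(Complex.I / (2 * k)) * (starRingEnd ℂ) σ * v.2, (Complex.I / (2 * k)) * σ * v.1)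

theorem ckX_norm {k : ℝ} (hk : 0 < k) (σ : ℂ) (v : ℂ × ℂ) :
    ‖ckX k σ v‖ ≤ ‖σ‖ / (2 * k) * ‖v‖ := by
  have h1 : ‖Complex.I / (2 * (k:ℂ))‖ = 1 / (2 * k) := by
    rw [norm_div, Complex.norm_I, norm_mul, Complex.norm_of_nonneg hk.le]; simp
  rw [ckX, Prod.norm_mk]
  refine max_le ?_ ?_
  · rw [norm_mul, norm_mul, norm_neg, h1, RCLike.norm_conj, one_div_mul_eq_div]
    exact mul_le_mul_of_nonneg_left (norm_snd_le v) (by positivity)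
  · rw [norm_mul, norm_mul, h1, one_div_mul_eq_div]
    exact mul_le_mul_of_nonneg_left (norm_fst_le v) (by positivity)

theorem ckX_add (k : ℝ) (σ τ : ℂ) (v : ℂ × ℂ) : ckX k (σ + τ) v = ckX k σ v + ckX k τ v := by
  simp only [ckX, Prod.mk_add_mk, map_add]
  congr 1 <;> ring

theorem ckX_sub (k : ℝ) (σ : ℂ) (v w : ℂ × ℂ) : ckX k σ (v - w) = ckX k σ v - ckX k σ w := by
  simp only [ckX, Prod.mk_sub_mk, Prod.fst_sub, Prod.snd_sub]
  congr 1 <;> ring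

theorem ck_combine {k : ℝ} (hk : 0 < k) {σ₁ σ₂ : ℂ} {y₀ y₁ y₂ : ℂ × ℂ} {ρ₁ ρ₂ : ℝ}
    (h20 : 0 ≤ ρ₂)
    (h1 : ‖y₁ - y₀ - ckX k σ₁ y₀‖ ≤ ρ₁ * ‖y₀‖) (h2 : ‖y₂ - y₁ - ckX k σ₂ y₁‖ ≤ ρ₂ * ‖y₁‖) :
    ‖y₂ - y₀ - ckX k (σ₁ + σ₂) y₀‖ ≤
      (ρ₂ * (1 + ‖σ₁‖ / (2 * k) + ρ₁) + ρ₁ + ‖σ₂‖ / (2 * k) * (‖σ₁‖ / (2 * k) + ρ₁)) * ‖y₀‖ := by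
  have hd : ‖y₁ - y₀‖ ≤ (‖σ₁‖ / (2 * k) + ρ₁) * ‖y₀‖ := by
    have e : y₁ - y₀ = (y₁ - y₀ - ckX k σ₁ y₀) + ckX k σ₁ y₀ := by abel
    rw [e]
    refine (norm_add_le _ _).trans ?_
    have := ckX_norm hk σ₁ y₀
    linarith
  have hy : ‖y₁‖ ≤ (1 + ‖σ₁‖ / (2 * k) + ρ₁) * ‖y₀‖ := by
    have : ‖y₁‖ ≤ ‖y₀‖ + ‖y₁ - y₀‖ := by
      have e : y₁ = y₀ + (y₁ - y₀) := by abel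
      calc ‖y₁‖ = ‖y₀ + (y₁ - y₀)‖ := by rw [← e]
        _ ≤ _ := norm_add_le _ _
    linarith
  have e : y₂ - y₀ - ckX k (σ₁ + σ₂) y₀ = (y₂ - y₁ - ckX k σ₂ y₁) + (y₁ - y₀ - ckX k σ₁ y₀)
      + ckX k σ₂ (y₁ - y₀) := by
    rw [ckX_add, ckX_sub]; abel
  rw [e]
  refine (norm_add_le _ _).trans ?_
  have t1 := norm_add_le (y₂ - y₁ - ckX k σ₂ y₁) (y₁ - y₀ - ckX k σ₁ y₀)
  have t2 := ckX_norm hk σ₂ (y₁ - y₀)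
  have t3 := mul_le_mul_of_nonneg_left hd (show 0 ≤ ‖σ₂‖ / (2 * k) by positivity)
  have t4 := mul_le_mul_of_nonneg_left hy h20
  nlinarith

theorem ck_sum_pairs (f : ℕ → ℝ) (n : ℕ) :
    ∑ i ∈ Finset.range n, (f (2 * i) + f (2 * i + 1)) = ∑ i ∈ Finset.range (2 * n), f i := by
  induction n with
  | zero => simp
  | succ n ih =>
    rw [Finset.sum_range_succ, ih, show 2 * (n + 1) = 2 * n + 1 + 1 by ring,
      Finset.sum_range_succ, Finset.sum_range_succ]
    ring

theorem ck_dyadic {k : ℝ} (hk : 0 < k) (S : ℝ → ℝ → ℂ) (hS : ∀ s m t, S s m + S m t = S s t)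
    (Y : ℝ → ℂ × ℂ) (c : ℝ) (M : ℕ) (q x : ℝ) (hx0 : 0 ≤ x) (hxq : x ^ 2 = q)
    (hsm : 2 * (M + 1) * (2 * x + 2 * (M + 1) * q) ≤ 1)
    (hq : ∀ j ≤ M, ∑ i ∈ Finset.range (2 ^ (M - j)),
      (‖S (c + i * 2 ^ j) (c + (i + 1) * 2 ^ j)‖ / (2 * k)) ^ 2 ≤ q)
    (v : ℕ → ℝ) (hv0 : ∀ i, 0 ≤ v i) (hv : ∑ i ∈ Finset.range (2 ^ M), v i ^ 2 ≤ q)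
    (hb : ∀ i : ℕ, i < 2 ^ M → ‖Y (c + (i + 1)) - Y (c + i) - ckX k (S (c + i) (c + (i + 1))) (Y (c + i))‖
      ≤ 2 * v i ^ 2 * ‖Y (c + i)‖) (j : ℕ) (hj : j ≤ M) :
    ∃ ρ : ℕ → ℝ, (∀ i, 0 ≤ ρ i) ∧ ∑ i ∈ Finset.range (2 ^ (M - j)), ρ i ≤ 2 * (j + 1) * q ∧
      ∀ i : ℕ, i < 2 ^ (M - j) → ‖Y (c + (i + 1) * 2 ^ j) - Y (c + i * 2 ^ j) -
        ckX k (S (c + i * 2 ^ j) (c + (i + 1) * 2 ^ j)) (Y (c + i * 2 ^ j))‖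
        ≤ ρ i * ‖Y (c + i * 2 ^ j)‖ := by
  have hq0 : 0 ≤ q := by rw [← hxq]; positivity
  induction j with
  | zero =>
    refine ⟨fun i => 2 * v i ^ 2, fun i => by positivity, ?_, ?_⟩
    · rw [← Finset.mul_sum]; simp only [Nat.sub_zero]; push_cast; linarith
    · intro i hi
      simpa using hb i (by simpa using hi)
  | succ j ih =>
    obtain ⟨ρ, hρ0, hρs, hρ⟩ := ih (by omega)
    have hMj : M - j = (M - (j + 1)) + 1 := by omega
    set n := 2 ^ (M - (j + 1)) with hn
    have h2n : 2 ^ (M - j) = 2 * n := by rw [hMj, pow_succ, mul_comm]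
    rw [h2n] at hρs hρ
    have hqj := hq j (by omega)
    rw [h2n] at hqj
    set σ : ℕ → ℝ := fun i => ‖S (c + i * 2 ^ j) (c + (i + 1) * 2 ^ j)‖ / (2 * k) with hσ
    have hσ0 : ∀ i, 0 ≤ σ i := fun i => by positivity
    have hσx : ∀ i < 2 * n, σ i ≤ x := by
      intro i hi
      have : σ i ^ 2 ≤ q := le_trans
        (Finset.single_le_sum (f := fun i => σ i ^ 2) (fun i _ => sq_nonneg _)
          (Finset.mem_range.2 hi)) hqj
      rw [← hxq] at this
      exact (pow_le_pow_iff_left₀ (hσ0 i) hx0 (by norm_num)).1 this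
    have hρr : ∀ i < 2 * n, ρ i ≤ 2 * (j + 1) * q := by
      intro i hi
      exact le_trans (Finset.single_le_sum (f := ρ) (fun i _ => hρ0 i)
          (Finset.mem_range.2 hi)) hρs
    refine ⟨fun i => ρ (2 * i + 1) * (1 + σ (2 * i) + ρ (2 * i)) + ρ (2 * i) +
      σ (2 * i + 1) * (σ (2 * i) + ρ (2 * i)), fun i => ?_, ?_, ?_⟩
    · have := hρ0 (2 * i); have := hρ0 (2 * i + 1)
      have := hσ0 (2 * i); have := hσ0 (2 * i + 1)
      positivity
    · set r : ℝ := 2 * (j + 1) * q with hr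
      have hr0 : 0 ≤ r := by positivity
      have step : ∀ i ∈ Finset.range n, ρ (2 * i + 1) * (1 + σ (2 * i) + ρ (2 * i)) + ρ (2 * i) +
          σ (2 * i + 1) * (σ (2 * i) + ρ (2 * i)) ≤
          (1 + x + r) * (ρ (2 * i) + ρ (2 * i + 1)) + (σ (2 * i) ^ 2 + σ (2 * i + 1) ^ 2) / 2 := by
        intro i hi
        have hi := Finset.mem_range.1 hi
        have a1 := hρ0 (2 * i); have a2 := hρ0 (2 * i + 1)
        have a3 := hσx (2 * i) (by omega); have a4 := hσx (2 * i + 1) (by omega)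
        have a5 := hρr (2 * i) (by omega)
        have b1 := mul_le_mul_of_nonneg_left (add_le_add a3 a5) a2
        have b2 := mul_le_mul_of_nonneg_right a4 a1
        have b3 := mul_nonneg hr0 a1
        nlinarith [sq_nonneg (σ (2 * i) - σ (2 * i + 1))]
      refine (Finset.sum_le_sum step).trans ?_
      rw [Finset.sum_add_distrib, ← Finset.mul_sum, ← Finset.sum_div, ck_sum_pairs ρ,
        ck_sum_pairs (fun i => σ i ^ 2)]
      have hρs' : ∑ i ∈ Finset.range (2 * n), ρ i ≤ r := hρs
      have c1 := mul_le_mul_of_nonneg_left hρs' (show 0 ≤ 1 + x + r by positivity)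
      have hjM : (j : ℝ) + 1 ≤ M + 1 := by
        have : (j:ℝ) ≤ M := by exact_mod_cast (by omega : j ≤ M)
        linarith
      have c2 : x + r ≤ 2 * x + 2 * (M + 1) * q := by
        have := mul_le_mul_of_nonneg_right hjM hq0
        linarith
      have c3 : 2 * ((j:ℝ) + 1) * (x + r) ≤ 1 := by
        refine le_trans ?_ hsm
        have : 0 ≤ x + r := by positivity
        have h2 := mul_le_mul hjM c2 this (by positivity)
        linarith
      have c4 : (x + r) * r ≤ q := by
        have := mul_le_mul_of_nonneg_right c3 hq0
        rw [hr] at this ⊢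
        linarith
      push_cast
      have c5 : (1 + x + r) * r = r + (x + r) * r := by ring
      have c6 : 2 * ((j:ℝ) + 1 + 1) * q = r + 2 * q := by rw [hr]; ring
      rw [c6]
      linarith
    · intro i hi
      have h1 := hρ (2 * i) (by omega)
      have h2 := hρ (2 * i + 1) (by omega)
      have p0 : c + ((2 * i : ℕ) : ℝ) * 2 ^ j = c + i * 2 ^ (j + 1) := by push_cast; ring
      have p1 : c + (((2 * i : ℕ) : ℝ) + 1) * 2 ^ j = c + ((2 * i + 1 : ℕ) : ℝ) * 2 ^ j := by
        push_cast; ring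
      have p2 : c + (((2 * i + 1 : ℕ) : ℝ) + 1) * 2 ^ j = c + (i + 1) * 2 ^ (j + 1) := by
        push_cast; ring
      have h := ck_combine hk (hρ0 (2 * i + 1)) h1 (by rw [p1]; exact h2)
      rw [p1, hS, p0, p2] at h
      have e1 : σ (2 * i) = ‖S (c + i * 2 ^ (j + 1)) (c + ((2 * i + 1 : ℕ) : ℝ) * 2 ^ j)‖ / (2 * k) := by
        simp only [hσ]; rw [p0, p1]
      have e2 : σ (2 * i + 1) = ‖S (c + ((2 * i + 1 : ℕ) : ℝ) * 2 ^ j) (c + (i + 1) * 2 ^ (j + 1))‖ / (2 * k) := by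
        simp only [hσ]; rw [p2]
      rw [← e1, ← e2] at h
      exact h

theorem ck_dyadic_sup {k : ℝ} (hk : 0 < k) (S : ℝ → ℝ → ℂ) (hS : ∀ s m t, S s m + S m t = S s t)
    (Y : ℝ → ℂ × ℂ) (c : ℝ) (M : ℕ) (q x : ℝ) (hx0 : 0 ≤ x) (hxq : x ^ 2 = q)
    (hsm : 2 * (M + 1) * (2 * x + 2 * (M + 1) * q) ≤ 1)
    (hq : ∀ j ≤ M, ∑ i ∈ Finset.range (2 ^ (M - j)),
      (‖S (c + i * 2 ^ j) (c + (i + 1) * 2 ^ j)‖ / (2 * k)) ^ 2 ≤ q)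
    (v : ℕ → ℝ) (hv0 : ∀ i, 0 ≤ v i) (hv : ∑ i ∈ Finset.range (2 ^ M), v i ^ 2 ≤ q)
    (hb : ∀ i : ℕ, i < 2 ^ M → ∀ t ∈ Icc (c + i) (c + (i + 1)), v i ≤ 1 / 2 →
      ‖Y t - Y (c + i)‖ ≤ 2 * v i * ‖Y (c + i)‖ ∧
      ‖Y t - Y (c + i) - ckX k (S (c + i) t) (Y (c + i))‖
      ≤ 2 * v i ^ 2 * ‖Y (c + i)‖) (t : ℝ) (ht : t ∈ Icc c (c + 2 ^ M)) :
    ‖Y t - Y c‖ ≤ 2 * (M + 1) * (2 * x + 2 * (M + 1) * q) * ‖Y c‖ := by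
  have hq0 : 0 ≤ q := by rw [← hxq]; positivity
  set y : ℝ := 2 * x + 2 * (M + 1) * q with hy
  have hy0 : 0 ≤ y := by positivity
  have hvx : ∀ i : ℕ, i < 2 ^ M → v i ≤ x := by
    intro i hi
    have : v i ^ 2 ≤ q := le_trans
      (Finset.single_le_sum (f := fun i => v i ^ 2) (fun i _ => sq_nonneg _)
        (Finset.mem_range.2 hi)) hv
    rw [← hxq] at this
    exact (pow_le_pow_iff_left₀ (hv0 i) hx0 (by norm_num)).1 this
  have hM1 : (1:ℝ) ≤ M + 1 := by
    have : (0:ℝ) ≤ M := Nat.cast_nonneg M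
    linarith
  have hy12 : (M + 1) * y ≤ 1 / 2 := by linarith
  have hyh : y ≤ 1 / 2 := by nlinarith
  have hx2 : x ≤ 1 / 2 := by
    have : 0 ≤ 2 * ((M:ℝ) + 1) * q := by positivity
    linarith
  have hv2 : ∀ i : ℕ, i < 2 ^ M → v i ≤ 1 / 2 := fun i hi => (hvx i hi).trans hx2
  have hdy := ck_dyadic hk S hS Y c M q x hx0 hxq hsm hq v hv0 hv
    (fun i hi => (hb i hi _ ⟨by linarith, le_refl _⟩ (hv2 i hi)).2)
  have key : ∀ j ≤ M, ∀ i : ℕ, i < 2 ^ (M - j) → ∀ t ∈ Icc (c + i * 2 ^ j) (c + (i + 1) * 2 ^ j),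
      ‖Y t - Y (c + i * 2 ^ j)‖ ≤ ((1 + y) ^ (j + 1) - 1) * ‖Y (c + i * 2 ^ j)‖ := by
    intro j
    induction j with
    | zero =>
      intro _ i hi t ht
      simp only [pow_zero, mul_one, Nat.sub_zero, zero_add, pow_one] at *
      have h1 := (hb i hi t ht (hv2 i hi)).1
      refine h1.trans (mul_le_mul_of_nonneg_right ?_ (norm_nonneg _))
      have := hvx i hi
      have : 0 ≤ 2 * ((M:ℝ) + 1) * q := by positivity
      linarith
    | succ j ih =>
      intro hj i hi t ht
      have ih := ih (by omega)
      have h2n : 2 ^ (M - j) = 2 * 2 ^ (M - (j + 1)) := by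
        rw [show M - j = (M - (j + 1)) + 1 by omega, pow_succ, mul_comm]
      rw [h2n] at ih
      obtain ⟨ρ, hρ0, hρs, hρ⟩ := hdy j (by omega)
      have hqj := hq j (by omega)
      rw [h2n] at hρs hρ hqj
      have i1 := ih (2 * i) (by omega)
      have i2 := ih (2 * i + 1) (by omega)
      have hr := hρ (2 * i) (by omega)
      have p0 : c + ((2 * i : ℕ) : ℝ) * 2 ^ j = c + i * 2 ^ (j + 1) := by push_cast; ring
      have p1 : c + (((2 * i : ℕ) : ℝ) + 1) * 2 ^ j = c + ((2 * i + 1 : ℕ) : ℝ) * 2 ^ j := by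
        push_cast; ring
      have p2 : c + (((2 * i + 1 : ℕ) : ℝ) + 1) * 2 ^ j = c + (i + 1) * 2 ^ (j + 1) := by
        push_cast; ring
      have hρi : ρ (2 * i) ≤ 2 * (j + 1) * q := le_trans (Finset.single_le_sum (f := ρ)
        (fun i _ => hρ0 i) (Finset.mem_range.2 (by omega))) hρs
      have hσi : ‖S (c + ((2 * i : ℕ) : ℝ) * 2 ^ j) (c + (((2 * i : ℕ) : ℝ) + 1) * 2 ^ j)‖ / (2 * k) ≤ x := by
        have : (‖S (c + ((2 * i : ℕ) : ℝ) * 2 ^ j) (c + (((2 * i : ℕ) : ℝ) + 1) * 2 ^ j)‖ / (2 * k)) ^ 2 ≤ q :=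
          le_trans (Finset.single_le_sum
            (f := fun i : ℕ => (‖S (c + i * 2 ^ j) (c + (i + 1) * 2 ^ j)‖ / (2 * k)) ^ 2)
            (fun i _ => sq_nonneg _) (Finset.mem_range.2 (by omega))) hqj
        rw [← hxq] at this
        exact (pow_le_pow_iff_left₀ (by positivity) hx0 (by norm_num)).1 this
      have hjM : (j : ℝ) + 1 ≤ M + 1 := by
        have : (j:ℝ) ≤ M := by exact_mod_cast (by omega : j ≤ M)
        linarith
      have hρy : ρ (2 * i) + x ≤ y := by
        have := mul_le_mul_of_nonneg_right hjM hq0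
        linarith
      have hX := ckX_norm hk (S (c + ((2 * i : ℕ) : ℝ) * 2 ^ j) (c + (((2 * i : ℕ) : ℝ) + 1) * 2 ^ j))
        (Y (c + ((2 * i : ℕ) : ℝ) * 2 ^ j))
      have hmid : ‖Y (c + (((2 * i : ℕ) : ℝ) + 1) * 2 ^ j) - Y (c + ((2 * i : ℕ) : ℝ) * 2 ^ j)‖ ≤
          y * ‖Y (c + ((2 * i : ℕ) : ℝ) * 2 ^ j)‖ := by
        have e : ∀ z z' w : ℂ × ℂ, z - z' = (z - z' - w) + w := fun z z' w => by abel
        rw [e _ _ (ckX k (S (c + ((2 * i : ℕ) : ℝ) * 2 ^ j) (c + (((2 * i : ℕ) : ℝ) + 1) * 2 ^ j))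
          (Y (c + ((2 * i : ℕ) : ℝ) * 2 ^ j)))]
        refine (norm_add_le _ _).trans ?_
        have n0 := norm_nonneg (Y (c + ((2 * i : ℕ) : ℝ) * 2 ^ j))
        have := mul_le_mul_of_nonneg_right hσi n0
        have := mul_le_mul_of_nonneg_right hρy n0
        linarith
      rw [p1, p0] at hmid
      rw [p0, p1] at i1
      rw [p2] at i2
      set s := c + i * 2 ^ (j + 1) with hs
      set m := c + ((2 * i + 1 : ℕ) : ℝ) * 2 ^ j with hm
      have n0 := norm_nonneg (Y s)
      have hpow : 1 ≤ (1 + y) ^ (j + 1) := one_le_pow₀ (by linarith)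
      rcases le_total t m with htm | htm
      · refine (i1 t ⟨ht.1, htm⟩).trans (mul_le_mul_of_nonneg_right ?_ n0)
        have : (1 + y) ^ (j + 1) ≤ (1 + y) ^ (j + 1 + 1) :=
          pow_le_pow_right₀ (by linarith) (by omega)
        linarith
      · have h3 := i2 t ⟨htm, ht.2⟩
        have e : Y t - Y s = (Y t - Y m) + (Y m - Y s) := by abel
        rw [e]
        refine (norm_add_le _ _).trans ?_
        have h4 : ‖Y m‖ ≤ (1 + y) * ‖Y s‖ := by
          have e : Y m = Y s + (Y m - Y s) := by abel
          have := norm_add_le (Y s) (Y m - Y s)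
          rw [← e] at this
          linarith
        have h5 := mul_le_mul_of_nonneg_left h4 (show 0 ≤ (1 + y) ^ (j + 1) - 1 by linarith)
        have h6 : ((1 + y) ^ (j + 1 + 1) - 1) * ‖Y s‖ =
          ((1 + y) ^ (j + 1) - 1) * ((1 + y) * ‖Y s‖) + y * ‖Y s‖ := by ring
        rw [h6]
        linarith
  have h := key M le_rfl 0 (by simp) t (by simpa using ht)
  simp only [Nat.cast_zero, zero_mul, add_zero] at h
  refine h.trans (mul_le_mul_of_nonneg_right ?_ (norm_nonneg _))
  have e1 : (1 + y) ^ (M + 1) ≤ Real.exp ((M + 1) * y) := by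
    have := pow_le_pow_left₀ (by linarith) (show 1 + y ≤ Real.exp y by
      linarith [Real.add_one_le_exp y]) (M + 1)
    rw [← Real.exp_nat_mul] at this
    push_cast at this
    exact this
  have e2 : Real.exp ((M + 1) * y) ≤ 1 + 2 * ((M + 1) * y) := by
    set z := ((M:ℝ) + 1) * y with hz
    have hz0 : 0 ≤ z := by positivity
    have := Real.abs_exp_sub_one_le (x := z) (by rw [abs_of_nonneg hz0]; linarith)
    rw [abs_of_nonneg hz0] at this
    linarith [le_abs_self (Real.exp z - 1)]
  linarith

theorem ck_bnd {a b g : ℝ → ℂ} {c β : ℂ} (hg : LocallyIntegrable g) 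
    (ha : CKPrim a (fun x => c * g x * b x)) {s s' K : ℝ} 
    (hK : ∀ x ∈ Icc s s', ‖b x - β‖ ≤ K) {t : ℝ} (ht : t ∈ Icc s s') :
    ‖a t - a s - c * (∫ x in s..t, g x) * β‖ ≤ ‖c‖ * (∫ x in s..s', ‖g x‖) * K := by
  have hK0 : 0 ≤ K := (norm_nonneg _).trans (hK t ht)
  have hgn : LocallyIntegrable (fun x => ‖g x‖) := fun x => (hg x).norm
  rw [ha.2 s t, mul_assoc, mul_comm (∫ x in s..t, g x), ← mul_assoc,
    ← intervalIntegral.integral_const_mul]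
  rw [← intervalIntegral.integral_sub (ck_ii ha.1 s t) ((ck_ii hg s t).const_mul _)]
  have h1 : ‖∫ x in s..t, c * g x * b x - c * β * g x‖ ≤ ∫ x in s..t, ‖c‖ * K * ‖g x‖ := by
    refine intervalIntegral.norm_integral_le_of_norm_le ht.1 (Eventually.of_forall fun x hx => ?_)
      ((ck_iiR hgn s t).const_mul _)
    rw [show c * g x * b x - c * β * g x = c * (b x - β) * g x by ring, norm_mul, norm_mul]
    have := hK x ⟨hx.1.le, hx.2.trans ht.2⟩
    gcongr
  refine h1.trans ?_
  rw [intervalIntegral.integral_const_mul]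
  have h2 : ∫ x in s..t, ‖g x‖ ≤ ∫ x in s..s', ‖g x‖ :=
    intervalIntegral.integral_mono_interval le_rfl ht.1 ht.2
      (Eventually.of_forall fun x => norm_nonneg _) (ck_iiR hgn s s')
  have := mul_le_mul_of_nonneg_left h2 (show 0 ≤ ‖c‖ * K by positivity)
  linarith

theorem ck_unit {k : ℝ} (hk : 0 < k) {a b g : ℝ → ℂ} (hg : LocallyIntegrable g)
    (ha : CKPrim a (fun x => -(Complex.I / (2 * k)) * (starRingEnd ℂ) (g x) * b x))
    (hb : CKPrim b (fun x => (Complex.I / (2 * k)) * g x * a x)) {s s' : ℝ} 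
    {v : ℝ} (hv : v = (∫ x in s..s', ‖g x‖) / (2 * k)) (hv2 : v ≤ 1 / 2)
    {t : ℝ} (ht : t ∈ Icc s s') :
    ‖((a t, b t) : ℂ × ℂ) - (a s, b s)‖ ≤ 2 * v * ‖((a s, b s) : ℂ × ℂ)‖ ∧
    ‖((a t, b t) : ℂ × ℂ) - (a s, b s) - ckX k (∫ x in s..t, g x) (a s, b s)‖ ≤
      2 * v ^ 2 * ‖((a s, b s) : ℂ × ℂ)‖ := by
  have hss : s ≤ s' := ht.1.trans ht.2
  have hgc : LocallyIntegrable (fun x => (starRingEnd ℂ) (g x)) := by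
    intro x
    obtain ⟨U, hU, h⟩ := hg x
    exact ⟨U, hU, (h.norm.mono' (Complex.continuous_conj.comp_aestronglyMeasurable h.1)
      (Eventually.of_forall fun x => by simp [RCLike.norm_conj]))⟩
  have hcn : ‖Complex.I / (2 * (k:ℂ))‖ = 1 / (2 * k) := by
    rw [norm_div, Complex.norm_I, norm_mul, Complex.norm_of_nonneg hk.le]; simp
  have hv0 : 0 ≤ v := by
    rw [hv]
    exact div_nonneg (intervalIntegral.integral_nonneg hss fun x _ => norm_nonneg _) (by positivity)
  set Y : ℝ → ℂ × ℂ := fun x => (a x, b x) with hY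
  have hcont : ContinuousOn (fun x => ‖Y x‖) (Icc s s') :=
    (ha.continuous.prodMk hb.continuous).norm.continuousOn
  obtain ⟨m, hm, hmax⟩ := isCompact_Icc.exists_isMaxOn (nonempty_Icc.2 hss) hcont
  set K := ‖Y m‖ with hK
  have hK' : ∀ x ∈ Icc s s', ‖Y x‖ ≤ K := fun x hx => hmax hx
  have hK0 : 0 ≤ K := norm_nonneg _
  have est : ∀ (β : ℂ × ℂ) (L : ℝ), (∀ x ∈ Icc s s', ‖Y x - β‖ ≤ L) → ∀ t ∈ Icc s s',
      ‖Y t - Y s - ckX k (∫ x in s..t, g x) β‖ ≤ v * L := by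
    intro β L hL t ht
    have h1 := ck_bnd (β := β.2) (K := L) hgc ha (s := s) (s' := s')
      (fun x hx => (norm_snd_le (Y x - β)).trans (hL x hx)) ht
    have h2 := ck_bnd (β := β.1) (K := L) hg hb (s := s) (s' := s')
      (fun x hx => (norm_fst_le (Y x - β)).trans (hL x hx)) ht
    have e : Y t - Y s - ckX k (∫ x in s..t, g x) β =
      (a t - a s - -(Complex.I / (2 * k)) * (∫ x in s..t, (starRingEnd ℂ) (g x)) * β.2,
       b t - b s - (Complex.I / (2 * k)) * (∫ x in s..t, g x) * β.1) := by
      simp only [hY, ckX, Prod.mk_sub_mk]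
      rw [intervalIntegral.integral_of_le ht.1, intervalIntegral.integral_of_le ht.1, integral_conj]
    rw [e, Prod.norm_mk]
    refine max_le (h1.trans (le_of_eq ?_)) (h2.trans (le_of_eq ?_))
    · rw [norm_neg, hcn, hv]; simp only [RCLike.norm_conj]; ring
    · rw [hcn, hv]; ring
  have est0 : ∀ t ∈ Icc s s', ‖Y t - Y s‖ ≤ v * K := by
    intro t ht
    have := est 0 K (fun x hx => by simpa using hK' x hx) t ht
    have e : ckX k (∫ x in s..t, g x) 0 = 0 := by simp [ckX]
    rwa [e, sub_zero] at this
  have hKs : K ≤ 2 * ‖Y s‖ := by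
    have h1 := est0 m hm
    have h2 : ‖Y m‖ ≤ ‖Y m - Y s‖ + ‖Y s‖ := by
      have := norm_add_le (Y m - Y s) (Y s)
      simpa using this
    have := mul_le_mul_of_nonneg_right hv2 hK0
    linarith
  have h3 : v * K ≤ 2 * v * ‖Y s‖ := by
    have := mul_le_mul_of_nonneg_left hKs hv0
    linarith
  refine ⟨(est0 t ht).trans h3, ?_⟩
  refine (est (Y s) (v * K) est0 t ht).trans ?_
  have := mul_le_mul_of_nonneg_left h3 hv0
  change v * (v * K) ≤ 2 * v ^ 2 * ‖Y s‖
  linarith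

theorem ck_conv (Y : ℝ → ℂ × ℂ) (M0 : ℕ) (δ : ℕ → ℝ) (hδ0 : ∀ n, 0 ≤ δ n) (hδ : Summable δ)
    (hδs : ∑' n, δ n ≤ 1 / 8)
    (h : ∀ n : ℕ, ∀ t ∈ Icc ((2:ℝ) ^ (M0 + n)) (2 ^ (M0 + n) + 2 ^ (M0 + n)),
      ‖Y t - Y (2 ^ (M0 + n))‖ ≤ δ n * ‖Y (2 ^ (M0 + n))‖) :
    ∃ L : ℂ × ℂ, Tendsto Y atTop (nhds L) ∧ ‖L - Y (2 ^ M0)‖ ≤ 1 / 4 * ‖Y (2 ^ M0)‖ := by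
  set N := ‖Y (2 ^ M0)‖ with hN
  have hN0 : 0 ≤ N := norm_nonneg _
  have hps : ∀ n, ∑ i ∈ Finset.range n, δ i ≤ 1 / 8 := fun n =>
    (hδ.sum_le_tsum _ (fun i _ => hδ0 i)).trans hδs
  set Z : ℕ → ℂ × ℂ := fun n => Y (2 ^ (M0 + n)) with hZ
  have hstep : ∀ n, ‖Z (n + 1) - Z n‖ ≤ δ n * ‖Z n‖ := by
    intro n
    refine h n _ ⟨?_, ?_⟩
    · exact pow_le_pow_right₀ (by norm_num) (by omega)
    · rw [← add_assoc, pow_succ]; linarith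
  have hind : ∀ n, ‖Z n - Z 0‖ ≤ 2 * N * ∑ i ∈ Finset.range n, δ i := by
    intro n
    induction n with
    | zero => simp
    | succ n ih =>
      have h1 := hstep n
      have h2 : ‖Z n‖ ≤ ‖Z n - Z 0‖ + ‖Z 0‖ := by
        have := norm_add_le (Z n - Z 0) (Z 0)
        simpa using this
      have h0 : ‖Z 0‖ = N := by simp [hZ, hN]
      have h3 : ‖Z n‖ ≤ 2 * N := by
        have := mul_le_mul_of_nonneg_left (hps n) (show 0 ≤ 2 * N by positivity)
        linarith
      have h4 := mul_le_mul_of_nonneg_left h3 (hδ0 n)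
      have e : Z (n + 1) - Z 0 = (Z (n + 1) - Z n) + (Z n - Z 0) := by abel
      rw [e, Finset.sum_range_succ]
      refine (norm_add_le _ _).trans ?_
      linarith
  have hZ2 : ∀ n, ‖Z n‖ ≤ 2 * N := by
    intro n
    have h1 := hind n
    have h2 : ‖Z n‖ ≤ ‖Z n - Z 0‖ + ‖Z 0‖ := by
      have := norm_add_le (Z n - Z 0) (Z 0)
      simpa using this
    have h0 : ‖Z 0‖ = N := by simp [hZ, hN]
    have := mul_le_mul_of_nonneg_left (hps n) (show 0 ≤ 2 * N by positivity)
    linarith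
  have hstep2 : ∀ n, dist (Z n) (Z (n + 1)) ≤ δ n * (2 * N) := by
    intro n
    rw [dist_comm, dist_eq_norm]
    exact (hstep n).trans (mul_le_mul_of_nonneg_left (hZ2 n) (hδ0 n))
  have hc := cauchySeq_of_dist_le_of_summable _ hstep2 (hδ.mul_right _)
  obtain ⟨L, hL⟩ := cauchySeq_tendsto_of_complete hc
  refine ⟨L, ?_, ?_⟩
  · rw [Metric.tendsto_atTop]
    intro ε hε
    rw [Metric.tendsto_atTop] at hL
    obtain ⟨n1, hn1⟩ := hL (ε / 2) (by positivity)
    have hd := (hδ.mul_right (2 * N)).tendsto_atTop_zero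
    rw [Metric.tendsto_atTop] at hd
    obtain ⟨n2, hn2⟩ := hd (ε / 2) (by positivity)
    refine ⟨2 ^ (M0 + (max n1 n2)), fun t ht => ?_⟩
    have ht1 : 1 ≤ t := le_trans (one_le_pow₀ (by norm_num)) ht
    obtain ⟨m, hm1, hm2⟩ := exists_nat_pow_near ht1 (show (1:ℝ) < 2 by norm_num)
    have hm : M0 + max n1 n2 ≤ m := by
      have : (2:ℝ) ^ (M0 + max n1 n2) < 2 ^ (m + 1) := lt_of_le_of_lt ht hm2
      have := (pow_lt_pow_iff_right₀ (show (1:ℝ) < 2 by norm_num)).1 this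
      omega
    obtain ⟨n, rfl⟩ : ∃ n, m = M0 + n := ⟨m - M0, by omega⟩
    have hn : max n1 n2 ≤ n := by omega
    have h1 := h n t ⟨hm1, by rw [pow_succ] at hm2; linarith⟩
    have h2 := hn1 n (le_trans (le_max_left _ _) hn)
    have h3 := hn2 n (le_trans (le_max_right _ _) hn)
    rw [Real.dist_eq, sub_zero] at h3
    have h4 := lt_of_le_of_lt (le_abs_self _) h3
    have h5 := mul_le_mul_of_nonneg_left (hZ2 n) (hδ0 n)
    have h6 : dist (Y t) (Z n) < ε / 2 := by
      rw [dist_eq_norm]; exact lt_of_le_of_lt (h1.trans h5) h4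
    linarith [dist_triangle (Y t) (Z n) L]
  · have : Tendsto (fun n => ‖Z n - Z 0‖) atTop (nhds ‖L - Z 0‖) :=
      (hL.sub_const _).norm
    have h0 : Z 0 = Y (2 ^ M0) := by simp [hZ]
    rw [← h0]
    refine le_of_tendsto this (Eventually.of_forall fun n => (hind n).trans ?_)
    have := mul_le_mul_of_nonneg_left (hps n) (show 0 ≤ 2 * N by positivity)
    linarith

theorem ck_delta_summable (A r : ℝ) (hA : 0 ≤ A) (hr0 : 0 < r) (hr1 : r < 1) :
    Summable (fun M : ℕ => 2 * ((M:ℝ) + 1) * (2 * (Real.sqrt (A * r ^ M)) + 2 * (M + 1) * (A * r ^ M))) := by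
  have hs1 : ‖Real.sqrt r‖ < 1 := by
    rw [Real.norm_of_nonneg (Real.sqrt_nonneg _)]
    exact (Real.sqrt_lt' one_pos).2 (by simpa using hr1)
  have hr1' : ‖r‖ < 1 := by rwa [Real.norm_of_nonneg hr0.le]
  have a0 := summable_pow_mul_geometric_of_norm_lt_one 0 hs1
  have a1 := summable_pow_mul_geometric_of_norm_lt_one 1 hs1
  have b0 := summable_pow_mul_geometric_of_norm_lt_one 0 hr1'
  have b1 := summable_pow_mul_geometric_of_norm_lt_one 1 hr1'
  have b2 := summable_pow_mul_geometric_of_norm_lt_one 2 hr1'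
  have := ((a0.add a1).mul_left (4 * Real.sqrt A)).add (((b0.add (b1.mul_left 2)).add b2).mul_left (4 * A))
  refine this.congr fun M => ?_
  have e : Real.sqrt (A * r ^ M) = Real.sqrt A * Real.sqrt r ^ M := by
    have h := Real.sqrt_eq_iff_mul_self_eq (x := A * r ^ M) (y := Real.sqrt A * Real.sqrt r ^ M)
      (by positivity) (by positivity)
    rw [h, mul_mul_mul_comm, Real.mul_self_sqrt hA, ← mul_pow, Real.mul_self_sqrt hr0.le]
  rw [e]
  ring

theorem ck_ode {V : ℝ → ℝ} (hV : LocallyIntegrable V) {k : ℝ} (hk : 0 < k) (C θ : ℝ) (hC : 0 ≤ C)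
    (hθ0 : 0 < θ) (hθ1 : θ < 1) (M1 : ℕ)
    (h1 : ∀ M : ℕ, M1 ≤ M → ∀ j ≤ M, ∑ i ∈ Finset.range (2 ^ (M - j)),
      ‖∫ x in (2 ^ M + i * 2 ^ j : ℝ)..(2 ^ M + (i + 1) * 2 ^ j : ℝ), (V x : ℂ) * ckE V k x‖ ^ 2
        ≤ C * θ ^ M)
    (h2 : ∀ M : ℕ, M1 ≤ M → ∑ i ∈ Finset.range (2 ^ M),
      (∫ x in (2 ^ M + i : ℝ)..(2 ^ M + (i + 1) : ℝ), |V x|) ^ 2 ≤ C * θ ^ M) :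
    ∃ u, SchrodingerSolution V (k^2) u ∧ HasWKBAsymptotics V k u atTop := by
  set A := C / (2 * k) ^ 2 with hA
  have hA0 : 0 ≤ A := by positivity
  set d : ℕ → ℝ := fun M : ℕ =>
    2 * ((M:ℝ) + 1) * (2 * (Real.sqrt (A * θ ^ M)) + 2 * (M + 1) * (A * θ ^ M)) with hd
  have hd0 : ∀ M, 0 ≤ d M := fun M => by simp only [hd]; positivity
  have hds : Summable d := ck_delta_summable A θ hA0 hθ0 hθ1
  obtain ⟨M0, hM01, hM0⟩ : ∃ M0, M1 ≤ M0 ∧ ∑' n, d (n + M0) ≤ 1 / 8 := by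
    have := (tendsto_sum_nat_add d).eventually (ge_mem_nhds (show (0:ℝ) < 1 / 8 by norm_num))
    obtain ⟨M0, h, h'⟩ := (this.and (eventually_ge_atTop M1)).exists
    exact ⟨M0, h', h⟩
  have hds' : Summable (fun n => d (n + M0)) := (summable_nat_add_iff M0).2 hds
  refine ck_wkb_of_conv hV hk (2 ^ M0) fun a b ha0 hb0 ha hb => ?_
  set g : ℝ → ℂ := fun x => (V x : ℂ) * ckE V k x with hgdef
  have hgn : ∀ x, ‖g x‖ = |V x| := fun x => by
    rw [hgdef]; simp only [norm_mul, ck_norm_ckE, mul_one, Complex.norm_real, Real.norm_eq_abs]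
  have hg : LocallyIntegrable g := by
    have hVc : LocallyIntegrable (fun x => (V x : ℂ)) := fun x => by
      obtain ⟨U, hU, h⟩ := hV x
      exact ⟨U, hU, Integrable.ofReal h⟩
    have hEc : Continuous (ckE V k) := by
      have := (ck_ph_prim hV k).continuous
      unfold ckE
      fun_prop
    refine (ck_li_mul hVc hEc).congr (Eventually.of_forall fun x => mul_comm _ _)
  have ha' : CKPrim a (fun x => -(Complex.I / (2 * k)) * (starRingEnd ℂ) (g x) * b x) :=
    ha.congr (fun x => rfl) (fun x => by simp [hgdef])
  have hb' : CKPrim b (fun x => (Complex.I / (2 * k)) * g x * a x) := hb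
  obtain ⟨L, hL, hL2⟩ := ck_conv (fun x => (a x, b x)) M0 (fun n => d (n + M0))
    (fun n => hd0 _) hds' hM0 (by
      intro n t ht
      set M := M0 + n with hM
      rw [add_comm n M0, ← hM]
      have hdM : d M ≤ 1 := by
        have := hds'.le_tsum n (fun i _ => hd0 _)
        rw [add_comm n M0, ← hM] at this
        linarith
      have hq0 : 0 ≤ A * θ ^ M := by positivity
      refine ck_dyadic_sup hk (fun s t => ∫ x in s..t, g x)
        (fun s m t => intervalIntegral.integral_add_adjacent_intervals (ck_ii hg s m) (ck_ii hg m t))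
        (fun x => (a x, b x)) (2 ^ M) M (A * θ ^ M) (Real.sqrt (A * θ ^ M)) (Real.sqrt_nonneg _)
        (Real.sq_sqrt hq0) hdM ?_ 
        (fun i => (∫ x in (2 ^ M + i : ℝ)..(2 ^ M + (i + 1) : ℝ), |V x|) / (2 * k)) ?_ ?_ ?_ t ht
      · intro j hj
        have := h1 M (by omega) j hj
        simp only [div_pow]
        rw [← Finset.sum_div, hA, div_mul_eq_mul_div]
        exact div_le_div_of_nonneg_right this (by positivity)
      · intro i
        refine div_nonneg (intervalIntegral.integral_nonneg (by linarith) fun x _ => abs_nonneg _)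
          (by positivity)
      · have := h2 M (by omega)
        simp only [div_pow]
        rw [← Finset.sum_div, hA, div_mul_eq_mul_div]
        exact div_le_div_of_nonneg_right this (by positivity)
      · intro i hi t ht hv
        exact ck_unit hk hg ha' hb' (s := 2 ^ M + i) (s' := 2 ^ M + (i + 1))
          (by simp only [hgn]) hv ht)
  refine ⟨L.1, L.2, (continuous_fst.tendsto _).comp hL, (continuous_snd.tendsto _).comp hL, ?_⟩
  simp only [ha0, hb0] at hL2
  have e0 : ‖((1, 0) : ℂ × ℂ)‖ = 1 := by simp [Prod.norm_mk]
  rw [e0, mul_one] at hL2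
  have f1 := (norm_fst_le (L - (1, 0))).trans hL2
  have f2 := (norm_snd_le (L - (1, 0))).trans hL2
  simp only [Prod.fst_sub, Prod.snd_sub, sub_zero] at f1 f2
  have f3 : 1 ≤ ‖L.1‖ + ‖L.1 - 1‖ := by
    have := norm_sub_le L.1 (L.1 - 1)
    simpa using this
  linarith

theorem ck_vdc {a b u w : ℝ} (ha : 0 < a) (hab : a ≤ b) (hu : u ≠ 0) (hw : |w| ≤ a ^ 2 * |u|) :
    ‖∫ k in a..b, Complex.exp (Complex.I * ((2 * k * u - w / k : ℝ) : ℂ))‖ ≤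
      (2 + 2 * (b - a) / a) / |u| := by
  set θ : ℝ → ℝ := fun k => 2 * k * u - w / k with hθ
  set θ1 : ℝ → ℝ := fun k => 2 * u + w / k ^ 2 with hθ1
  set θ2 : ℝ → ℝ := fun k => - 2 * w / k ^ 3 with hθ2
  have hu0 : 0 < |u| := abs_pos.2 hu
  have hpos : ∀ k ∈ uIcc a b, 0 < k := fun k hk => by
    rw [uIcc_of_le hab] at hk; exact lt_of_lt_of_le ha hk.1
  have hge : ∀ k ∈ uIcc a b, a ≤ k := fun k hk => by
    rw [uIcc_of_le hab] at hk; exact hk.1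
  have hlow : ∀ k ∈ uIcc a b, |u| ≤ |θ1 k| := by
    intro k hk
    have h1 : |w / k ^ 2| ≤ |u| := by
      rw [abs_div, abs_of_pos (pow_pos (hpos k hk) 2), div_le_iff₀ (pow_pos (hpos k hk) 2)]
      have := pow_le_pow_left₀ ha.le (hge k hk) 2
      nlinarith
    have h2 : |2 * u| ≤ |θ1 k| + |w / k ^ 2| := by
      have := abs_sub (θ1 k) (w / k ^ 2)
      simp only [hθ1] at this ⊢
      simpa using this
    rw [abs_mul, abs_two] at h2
    linarith
  have hne : ∀ k ∈ uIcc a b, (θ1 k : ℂ) ≠ 0 := by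
    intro k hk
    have := hlow k hk
    have : 0 < |θ1 k| := by linarith
    exact_mod_cast abs_pos.1 this
  have hup : ∀ k ∈ uIcc a b, |θ2 k| ≤ 2 * |u| / a := by
    intro k hk
    have hk0 := hpos k hk
    simp only [hθ2]
    rw [abs_div, abs_mul, abs_neg, abs_two, abs_of_pos (pow_pos hk0 3), div_le_div_iff₀ (pow_pos hk0 3) ha]
    have h1 := pow_le_pow_left₀ ha.le (hge k hk) 3
    have h2 : 2 * |w| * a ≤ 2 * (a ^ 2 * |u|) * a := by
      have := mul_le_mul_of_nonneg_right hw ha.le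
      linarith
    have h3 := mul_le_mul_of_nonneg_left h1 hu0.le
    nlinarith
  have d0 : ∀ k ∈ uIcc a b, HasDerivAt θ (θ1 k) k := by
    intro k hk
    have hk0 := (hpos k hk).ne'
    have h1 : HasDerivAt (fun k : ℝ => 2 * k * u) (2 * u) k := by
      simpa using ((hasDerivAt_id k).const_mul 2).mul_const u
    have h2 : HasDerivAt (fun k : ℝ => w / k) (w * (-(k ^ 2)⁻¹)) k := by
      simpa [div_eq_mul_inv] using (hasDerivAt_inv hk0).const_mul w
    refine (h1.sub h2).congr_deriv ?_
    simp only [hθ1]; field_simp; ring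
  have d1 : ∀ k ∈ uIcc a b, HasDerivAt θ1 (θ2 k) k := by
    intro k hk
    have hk0 := (hpos k hk).ne'
    have h2 : HasDerivAt (fun k : ℝ => w / k ^ 2) ((0 * k ^ 2 - w * (2 * k)) / (k ^ 2) ^ 2) k := by
      have := (hasDerivAt_const k w).div ((hasDerivAt_pow 2 k)) (pow_ne_zero 2 hk0)
      refine this.congr_deriv ?_
      simp
    refine (h2.const_add (2 * u)).congr_deriv ?_
    simp only [hθ2]; field_simp; ring
  set e : ℝ → ℂ := fun k => Complex.exp (Complex.I * (θ k : ℂ)) with he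
  have hen : ∀ k, ‖e k‖ = 1 := fun k => by
    simp only [he]; rw [mul_comm]; exact Complex.norm_exp_ofReal_mul_I _
  have de : ∀ k ∈ uIcc a b, HasDerivAt e (e k * (Complex.I * θ1 k)) k := fun k hk =>
    ((d0 k hk).ofReal_comp.const_mul Complex.I).cexp
  set G : ℝ → ℂ := fun k => e k / (Complex.I * θ1 k) with hG
  set r : ℝ → ℂ := fun k => e k * θ2 k / (Complex.I * θ1 k ^ 2) with hr
  have dG : ∀ k ∈ uIcc a b, HasDerivAt G (e k - r k) k := by
    intro k hk
    have hn := hne k hk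
    have := (de k hk).div ((d1 k hk).ofReal_comp.const_mul Complex.I) (mul_ne_zero Complex.I_ne_zero hn)
    refine this.congr_deriv ?_
    simp only [hr]
    have := Complex.I_ne_zero
    field_simp
  have ce : ContinuousOn e (uIcc a b) := fun k hk => (de k hk).continuousAt.continuousWithinAt
  have c1 : ContinuousOn (fun k => (θ1 k : ℂ)) (uIcc a b) := fun k hk =>
    (d1 k hk).ofReal_comp.continuousAt.continuousWithinAt
  have c2 : ContinuousOn (fun k => (θ2 k : ℂ)) (uIcc a b) := by
    refine Complex.continuous_ofReal.comp_continuousOn ?_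
    refine ContinuousOn.div (by fun_prop) (by fun_prop) fun k hk => ?_
    exact pow_ne_zero 3 (hpos k hk).ne'
  have cr : ContinuousOn r (uIcc a b) := by
    refine (ce.mul c2).div (continuousOn_const.mul (c1.pow 2)) fun k hk => ?_
    exact mul_ne_zero Complex.I_ne_zero (pow_ne_zero 2 (hne k hk))
  have ie := ce.intervalIntegrable (μ := volume)
  have ir := cr.intervalIntegrable (μ := volume)
  have hI := intervalIntegral.integral_eq_sub_of_hasDerivAt dG (ie.sub ir)
  rw [intervalIntegral.integral_sub ie ir] at hI
  have hI2 : ∫ k in a..b, e k = G b - G a + ∫ k in a..b, r k := by rw [← hI]; ring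
  change ‖∫ k in a..b, e k‖ ≤ _
  rw [hI2]
  have hGn : ∀ k ∈ uIcc a b, ‖G k‖ ≤ 1 / |u| := by
    intro k hk
    simp only [hG]
    rw [norm_div, hen, norm_mul, Complex.norm_I, one_mul, Complex.norm_real, Real.norm_eq_abs]
    exact one_div_le_one_div_of_le hu0 (hlow k hk)
  have hrn : ∀ k ∈ uIoc a b, ‖r k‖ ≤ 2 / (a * |u|) := by
    intro k hk
    have hk := uIoc_subset_uIcc hk
    simp only [hr]
    rw [norm_div, norm_mul, hen, norm_mul, Complex.norm_I, one_mul, one_mul, norm_pow,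
      Complex.norm_real, Real.norm_eq_abs, Complex.norm_real, Real.norm_eq_abs]
    calc |θ2 k| / |θ1 k| ^ 2 ≤ (2 * |u| / a) / |u| ^ 2 := by
          have := hup k hk
          have := hlow k hk
          gcongr
      _ = 2 / (a * |u|) := by field_simp
  have n1 := hGn a left_mem_uIcc
  have n2 := hGn b right_mem_uIcc
  have n3 := intervalIntegral.norm_integral_le_of_norm_le_const hrn
  rw [abs_of_nonneg (sub_nonneg.2 hab)] at n3
  refine (norm_add_le _ _).trans ((add_le_add (norm_sub_le _ _) le_rfl).trans ?_)
  have : (2 + 2 * (b - a) / a) / |u| = 1 / |u| + 1 / |u| + 2 / (a * |u|) * (b - a) := by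
    field_simp; ring
  rw [this]
  linarith

theorem ck_EE (V : ℝ → ℝ) {k : ℝ} (hk : k ≠ 0) (x y : ℝ) :
    ckE V k x * (starRingEnd ℂ) (ckE V k y) = Complex.exp (Complex.I *
      ((2 * k * (x - y) - ((∫ t in (0:ℝ)..x, V t) - ∫ t in (0:ℝ)..y, V t) / k : ℝ) : ℂ)) := by
  unfold ckE ckPh
  rw [← Complex.exp_conj, ← Complex.exp_add]
  congr 1
  simp only [map_mul, Complex.conj_I, Complex.conj_ofReal, map_ofNat]
  have : (k:ℂ) ≠ 0 := by exact_mod_cast hk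
  push_cast
  field_simp
  ring

theorem ck_kernel {V : ℝ → ℝ} {a b C0 : ℝ} (ha : 0 < a) (hab : a ≤ b)
    (hW : ∀ x y, |(∫ t in (0:ℝ)..x, V t) - ∫ t in (0:ℝ)..y, V t| ≤ a ^ 2 / 2 * |x - y| + C0) :
    ∃ C : ℝ, 0 ≤ C ∧ ∀ x y, ‖∫ k in a..b, ckE V k x * (starRingEnd ℂ) (ckE V k y)‖ ≤
      C / (1 + |x - y|) := by
  have hC0 : 0 ≤ C0 := by have := hW 0 0; simpa using this
  set U := 2 * C0 / a ^ 2 + 1 with hU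
  have hU1 : 1 ≤ U := by have : 0 ≤ 2 * C0 / a ^ 2 := by positivity
                         linarith
  set C1 := 2 + 2 * (b - a) / a with hC1
  have hba : 0 ≤ b - a := sub_nonneg.2 hab
  have hC10 : 0 ≤ C1 := by positivity
  refine ⟨2 * C1 + (b - a) * (1 + U), by positivity, fun x y => ?_⟩
  have h0 : 0 < 1 + |x - y| := by positivity
  rcases le_or_gt U |x - y| with h | h
  · have hu0 : 0 < |x - y| := by linarith
    have e : ∫ k in a..b, ckE V k x * (starRingEnd ℂ) (ckE V k y) =
      ∫ k in a..b, Complex.exp (Complex.I *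
      ((2 * k * (x - y) - ((∫ t in (0:ℝ)..x, V t) - ∫ t in (0:ℝ)..y, V t) / k : ℝ) : ℂ)) := by
      refine intervalIntegral.integral_congr fun k hk => ?_
      rw [uIcc_of_le hab] at hk
      exact ck_EE V (lt_of_lt_of_le ha hk.1).ne' x y
    rw [e]
    refine (ck_vdc ha hab (abs_pos.1 hu0) ?_).trans ?_
    · refine (hW x y).trans ?_
      have : 2 * C0 / a ^ 2 ≤ |x - y| := by linarith
      rw [div_le_iff₀ (by positivity)] at this
      linarith
    · rw [← hC1, div_le_div_iff₀ hu0 h0]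
      have : 0 ≤ (b - a) * (1 + U) * |x - y| := by positivity
      nlinarith
  · have h1 : ‖∫ k in a..b, ckE V k x * (starRingEnd ℂ) (ckE V k y)‖ ≤ 1 * |b - a| := by
      refine intervalIntegral.norm_integral_le_of_norm_le_const fun k _ => ?_
      rw [norm_mul, RCLike.norm_conj, ck_norm_ckE, ck_norm_ckE, one_mul]
    rw [abs_of_nonneg hba, one_mul] at h1
    refine h1.trans ?_
    rw [le_div_iff₀ h0]
    have : (b - a) * (1 + |x - y|) ≤ (b - a) * (1 + U) := by gcongr
    linarith

noncomputable def ckS (V f : ℝ → ℝ) (k : ℝ) : ℂ := ∫ x, (f x : ℂ) * ckE V k x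

theorem ck_W_cont {V : ℝ → ℝ} (hV : LocallyIntegrable V) :
    Continuous (fun x => ∫ t in (0:ℝ)..x, V t) :=
  intervalIntegral.continuous_primitive (fun a b => ck_iiR hV a b) 0

theorem ck_E_meas {V : ℝ → ℝ} (hV : LocallyIntegrable V) {α : Type*} [MeasurableSpace α]
    {κ ξ : α → ℝ} (hκ : Measurable κ) (hξ : Measurable ξ) :
    Measurable (fun z : α => ckE V (κ z) (ξ z)) := by
  have hW := (ck_W_cont hV).measurable
  have : Measurable (fun z : α => ckPh V (κ z) (ξ z)) := by
    unfold ckPh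
    have h2 : Measurable (fun z : α => ∫ t in (0:ℝ)..(ξ z), V t) := hW.comp hξ
    have h1 : Measurable (fun z : α => 1 / (2 * κ z)) := by fun_prop
    exact (hκ.mul hξ).sub (h1.mul h2)
  unfold ckE
  fun_prop

def CKAdm (f : ℝ → ℝ) (R : ℝ) : Prop :=
  Measurable f ∧ (∃ B, ∀ x, |f x| ≤ B) ∧ ∀ x, x ∉ Icc R (2 * R) → f x = 0

theorem ckS_restrict {V f : ℝ → ℝ} {R : ℝ} (hf : CKAdm f R) (k : ℝ) :
    ckS V f k = ∫ x, (f x : ℂ) * ckE V k x ∂(volume.restrict (Icc R (2 * R))) := by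
  unfold ckS
  rw [setIntegral_eq_integral_of_forall_compl_eq_zero]
  intro x hx
  rw [hf.2.2 x hx]; simp

theorem CKAdm.sq_int {f : ℝ → ℝ} {R : ℝ} (hf : CKAdm f R) :
    ∫ x, f x ^ 2 = ∫ x, f x ^ 2 ∂(volume.restrict (Icc R (2 * R))) := by
  rw [setIntegral_eq_integral_of_forall_compl_eq_zero]
  intro x hx
  rw [hf.2.2 x hx]; simp

theorem ck_bdd_int {α : Type*} {E : Type*} [NormedAddCommGroup E] [MeasurableSpace α] {μ : Measure α} [IsFiniteMeasure μ]
    {f : α → E} (hf : AEStronglyMeasurable f μ) (B : ℝ) (h : ∀ x, ‖f x‖ ≤ B) : Integrable f μ :=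
  Integrable.of_bound hf B (Eventually.of_forall h)

theorem ck_normsq {V f : ℝ → ℝ} {R : ℝ} (hf : CKAdm f R) (k : ℝ) :
    ((‖ckS V f k‖ ^ 2 : ℝ) : ℂ) = ∫ z, (f z.1 * f z.2 : ℂ) * (ckE V k z.1 * (starRingEnd ℂ) (ckE V k z.2))
      ∂((volume.restrict (Icc R (2 * R))).prod (volume.restrict (Icc R (2 * R)))) := by
  have h1 : ((‖ckS V f k‖ ^ 2 : ℝ) : ℂ) = ckS V f k * (starRingEnd ℂ) (ckS V f k) := by
    rw [Complex.mul_conj, Complex.normSq_eq_norm_sq]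
  rw [h1, ckS_restrict hf, ← integral_conj, ← integral_prod_mul]
  refine integral_congr_ae (Eventually.of_forall fun z => ?_)
  simp only [map_mul, Complex.conj_ofReal]
  ring

theorem ck_schur {μ : Measure ℝ} [IsFiniteMeasure μ] (hμ : μ ≤ volume) {f h : ℝ → ℝ} (hf : Measurable f)
    {B : ℝ} (hB : ∀ x, |f x| ≤ B) (hh : Integrable h) (hhm : Measurable h) (hh0 : ∀ x, 0 ≤ h x) {B' : ℝ}
    (hB' : ∀ x, h x ≤ B') :
    Integrable (fun z : ℝ × ℝ => |f z.1| * |f z.2| * h (z.1 - z.2)) (μ.prod μ) ∧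
    ∫ z, |f z.1| * |f z.2| * h (z.1 - z.2) ∂(μ.prod μ) ≤ (∫ u, h u) * ∫ x, f x ^ 2 ∂μ := by
  have hB0 : 0 ≤ B := (abs_nonneg _).trans (hB 0)
  have hB0' : 0 ≤ B' := (hh0 0).trans (hB' 0)
  have hf2 : ∀ x, f x ^ 2 ≤ B ^ 2 := fun x => by
    rw [← sq_abs]; exact pow_le_pow_left₀ (abs_nonneg _) (hB x) 2
  have m1 : Measurable (fun z : ℝ × ℝ => f z.1) := hf.comp measurable_fst
  have m2 : Measurable (fun z : ℝ × ℝ => f z.2) := hf.comp measurable_snd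
  have m3 : Measurable (fun z : ℝ × ℝ => h (z.1 - z.2)) :=
    hhm.comp (measurable_fst.sub measurable_snd)
  have i0 : Integrable (fun z : ℝ × ℝ => |f z.1| * |f z.2| * h (z.1 - z.2)) (μ.prod μ) := by
    refine ck_bdd_int ((m1.abs.mul m2.abs).mul m3).aestronglyMeasurable (B * B * B') fun z => ?_
    rw [norm_mul, norm_mul, Real.norm_eq_abs, Real.norm_eq_abs, Real.norm_eq_abs, abs_abs, abs_abs,
      abs_of_nonneg (hh0 _)]
    have := hB z.1; have := hB z.2; have := hB' (z.1 - z.2); have := hh0 (z.1 - z.2)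
    gcongr
  have i1 : Integrable (fun z : ℝ × ℝ => f z.1 ^ 2 * h (z.1 - z.2)) (μ.prod μ) := by
    refine ck_bdd_int ((m1.pow_const 2).mul m3).aestronglyMeasurable (B ^ 2 * B') fun z => ?_
    rw [norm_mul, Real.norm_eq_abs, Real.norm_eq_abs, abs_of_nonneg (sq_nonneg _),
      abs_of_nonneg (hh0 _)]
    have := hf2 z.1; have := hB' (z.1 - z.2); have := hh0 (z.1 - z.2)
    gcongr
  have i2 : Integrable (fun z : ℝ × ℝ => f z.2 ^ 2 * h (z.1 - z.2)) (μ.prod μ) := by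
    refine ck_bdd_int ((m2.pow_const 2).mul m3).aestronglyMeasurable (B ^ 2 * B') fun z => ?_
    rw [norm_mul, Real.norm_eq_abs, Real.norm_eq_abs, abs_of_nonneg (sq_nonneg _),
      abs_of_nonneg (hh0 _)]
    have := hf2 z.2; have := hB' (z.1 - z.2); have := hh0 (z.1 - z.2)
    gcongr
  have if2 : Integrable (fun x => f x ^ 2) μ :=
    ck_bdd_int (hf.pow_const 2).aestronglyMeasurable (B ^ 2) fun x => by
      rw [Real.norm_eq_abs, abs_of_nonneg (sq_nonneg _)]; exact hf2 x
  refine ⟨i0, ?_⟩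
  have hp : ∀ z : ℝ × ℝ, |f z.1| * |f z.2| * h (z.1 - z.2) ≤
      (1 / 2) * (f z.1 ^ 2 * h (z.1 - z.2)) + (1 / 2) * (f z.2 ^ 2 * h (z.1 - z.2)) := by
    intro z
    have h1 : |f z.1| * |f z.2| ≤ 1 / 2 * f z.1 ^ 2 + 1 / 2 * f z.2 ^ 2 := by
      rw [← sq_abs (f z.1), ← sq_abs (f z.2)]
      nlinarith [sq_nonneg (|f z.1| - |f z.2|)]
    have := mul_le_mul_of_nonneg_right h1 (hh0 (z.1 - z.2))
    linarith
  refine (integral_mono i0 ((i1.const_mul _).add (i2.const_mul _)) hp).trans ?_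
  have e := integral_add (i1.const_mul (1 / 2)) (i2.const_mul (1 / 2))
  simp only [Pi.add_apply] at e ⊢
  rw [e, integral_const_mul, integral_const_mul]
  have j1 : ∫ z, f z.1 ^ 2 * h (z.1 - z.2) ∂(μ.prod μ) ≤ (∫ u, h u) * ∫ x, f x ^ 2 ∂μ := by
    rw [integral_prod _ i1, ← integral_const_mul]
    refine integral_mono i1.integral_prod_left (if2.const_mul _) fun x => ?_
    dsimp only
    rw [integral_const_mul, mul_comm]
    refine mul_le_mul_of_nonneg_right ?_ (sq_nonneg _)
    rw [← integral_sub_left_eq_self h volume x]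
    exact integral_mono_measure hμ (Eventually.of_forall fun y => hh0 _) (hh.comp_sub_left x)
  have j2 : ∫ z, f z.2 ^ 2 * h (z.1 - z.2) ∂(μ.prod μ) ≤ (∫ u, h u) * ∫ x, f x ^ 2 ∂μ := by
    rw [integral_prod_symm _ i2, ← integral_const_mul]
    refine integral_mono i2.integral_prod_right (if2.const_mul _) fun x => ?_
    dsimp only
    rw [integral_const_mul, mul_comm]
    refine mul_le_mul_of_nonneg_right ?_ (sq_nonneg _)
    rw [← integral_sub_right_eq_self h x]
    exact integral_mono_measure hμ (Eventually.of_forall fun y => hh0 _) (hh.comp_sub_right x)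
  linarith

theorem ck_L2 {V : ℝ → ℝ} (hV : LocallyIntegrable V) {a b C0 ε : ℝ} (ha : 0 < a) (hab : a ≤ b)
    (hW : ∀ x y, |(∫ t in (0:ℝ)..x, V t) - ∫ t in (0:ℝ)..y, V t| ≤ a ^ 2 / 2 * |x - y| + C0)
    (hε : 0 < ε) :
    ∃ C : ℝ, 0 ≤ C ∧ ∀ (R : ℝ) (f : ℝ → ℝ), 1 ≤ R → CKAdm f R →
      ∫ k in a..b, ‖ckS V f k‖ ^ 2 ≤ C * R ^ ε * ∫ x, f x ^ 2 := by
  obtain ⟨C, hC0, hC⟩ := ck_kernel ha hab hW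
  set h : ℝ → ℝ := fun u => (1 + ‖u‖) ^ (-(1 + ε)) with hh
  have hhi : Integrable h := integrable_one_add_norm (by simp; exact hε)
  have hhm : Measurable h := by simp only [hh]; fun_prop
  have hh0 : ∀ x, 0 ≤ h x := fun x => by simp only [hh]; positivity
  have hh1 : ∀ x, h x ≤ 1 := fun x => by
    simp only [hh]
    exact Real.rpow_le_one_of_one_le_of_nonpos (by linarith [norm_nonneg x]) (by linarith)
  have hH0 : 0 ≤ ∫ u, h u := integral_nonneg hh0
  refine ⟨C * 2 ^ ε * ∫ u, h u, by positivity, fun R f hR hf => ?_⟩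
  set μ := volume.restrict (Icc R (2 * R)) with hμ
  obtain ⟨hfm, ⟨B, hB⟩, hfs⟩ := id hf
  have hB0 : 0 ≤ B := (abs_nonneg _).trans (hB 0)
  set H : ℝ → ℝ × ℝ → ℂ := fun k z => (f z.1 * f z.2 : ℂ) * (ckE V k z.1 * (starRingEnd ℂ) (ckE V k z.2)) with hH
  have hHi : Integrable (Function.uncurry H) ((volume.restrict (Ioc a b)).prod (μ.prod μ)) := by
    refine ck_bdd_int ?_ (B * B) fun z => ?_
    · have m1 : Measurable (fun z : ℝ × ℝ × ℝ => ckE V z.1 z.2.1) :=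
        ck_E_meas hV measurable_fst (measurable_fst.comp measurable_snd)
      have m2 : Measurable (fun z : ℝ × ℝ × ℝ => ckE V z.1 z.2.2) :=
        ck_E_meas hV measurable_fst (measurable_snd.comp measurable_snd)
      have m2' : Measurable (fun z : ℝ × ℝ × ℝ => (starRingEnd ℂ) (ckE V z.1 z.2.2)) :=
        Complex.continuous_conj.measurable.comp m2
      have m3 : Measurable (fun z : ℝ × ℝ × ℝ => (f z.2.1 : ℂ)) :=
        Complex.measurable_ofReal.comp (hfm.comp (measurable_fst.comp measurable_snd))
      have m4 : Measurable (fun z : ℝ × ℝ × ℝ => (f z.2.2 : ℂ)) :=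
        Complex.measurable_ofReal.comp (hfm.comp (measurable_snd.comp measurable_snd))
      exact ((m3.mul m4).mul (m1.mul m2')).aestronglyMeasurable
    · simp only [Function.uncurry, hH]
      rw [norm_mul, norm_mul, norm_mul, RCLike.norm_conj, ck_norm_ckE, ck_norm_ckE, one_mul, mul_one,
        Complex.norm_real, Complex.norm_real]
      have := hB z.2.1; have := hB z.2.2
      rw [Real.norm_eq_abs, Real.norm_eq_abs]
      gcongr
  have e1 : ((∫ k in a..b, ‖ckS V f k‖ ^ 2 : ℝ) : ℂ) = ∫ z, (∫ k in a..b, H k z) ∂(μ.prod μ) := by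
    rw [intervalIntegral.integral_of_le hab, ← integral_complex_ofReal]
    simp only [intervalIntegral.integral_of_le hab]
    rw [← integral_integral_swap hHi]
    refine integral_congr_ae (Eventually.of_forall fun k => ?_)
    exact ck_normsq hf k
  have hs := ck_schur (μ := μ) Measure.restrict_le_self hfm hB hhi hhm hh0 hh1
  have e2 : ‖∫ z, (∫ k in a..b, H k z) ∂(μ.prod μ)‖ ≤
      ∫ z, C * (2 * R) ^ ε * (|f z.1| * |f z.2| * h (z.1 - z.2)) ∂(μ.prod μ) := by
    refine norm_integral_le_of_norm_le (hs.1.const_mul _) (Eventually.of_forall fun z => ?_)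
    simp only [hH]
    rw [intervalIntegral.integral_const_mul, norm_mul, norm_mul, Complex.norm_real, Complex.norm_real,
      Real.norm_eq_abs, Real.norm_eq_abs]
    by_cases h1 : z.1 ∈ Icc R (2 * R)
    swap
    · simp [hfs _ h1]
    by_cases h2 : z.2 ∈ Icc R (2 * R)
    swap
    · simp [hfs _ h2]
    have h3 : 1 + |z.1 - z.2| ≤ 2 * R := by
      have : |z.1 - z.2| ≤ R := by rw [abs_le]; constructor <;> linarith [h1.1, h1.2, h2.1, h2.2]
      linarith
    have h4 : C / (1 + |z.1 - z.2|) ≤ C * (2 * R) ^ ε * h (z.1 - z.2) := by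
      simp only [hh]
      have hp : 0 < 1 + |z.1 - z.2| := by positivity
      rw [Real.norm_eq_abs, neg_add, Real.rpow_add hp, Real.rpow_neg_one, Real.rpow_neg hp.le, div_eq_mul_inv]
      have h5 : (1 + |z.1 - z.2|) ^ ε ≤ (2 * R) ^ ε := Real.rpow_le_rpow hp.le h3 hε.le
      have h6 : 1 ≤ (2 * R) ^ ε * ((1 + |z.1 - z.2|) ^ ε)⁻¹ := by
        rw [← div_eq_mul_inv, one_le_div (by positivity)]; exact h5
      calc C * (1 + |z.1 - z.2|)⁻¹ = C * (1 + |z.1 - z.2|)⁻¹ * 1 := by ring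
        _ ≤ C * (1 + |z.1 - z.2|)⁻¹ * ((2 * R) ^ ε * ((1 + |z.1 - z.2|) ^ ε)⁻¹) := by gcongr
        _ = _ := by ring
    have h5 := mul_le_mul_of_nonneg_left ((hC z.1 z.2).trans h4) (show 0 ≤ |f z.1| * |f z.2| by positivity)
    linarith
  have e3 : ∫ k in a..b, ‖ckS V f k‖ ^ 2 = ‖∫ z, (∫ k in a..b, H k z) ∂(μ.prod μ)‖ := by
    rw [← e1, Complex.norm_real, Real.norm_of_nonneg]
    exact intervalIntegral.integral_nonneg hab fun k _ => by positivity
  rw [e3]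
  refine e2.trans ?_
  rw [integral_const_mul, hf.sq_int, Real.mul_rpow (by norm_num) (by linarith)]
  have := mul_le_mul_of_nonneg_left hs.2 (show 0 ≤ C * (2 ^ ε * R ^ ε) by positivity)
  linarith

theorem CKAdm.integrable {f : ℝ → ℝ} {R : ℝ} (hf : CKAdm f R) : Integrable f := by
  obtain ⟨hm, ⟨B, hB⟩, hs⟩ := hf
  have h1 : IntegrableOn f (Icc R (2 * R)) := ck_bdd_int hm.aestronglyMeasurable B hB
  exact (integrableOn_iff_integrable_of_support_subset (fun x hx => by
    by_contra h; exact hx (hs x h))).1 h1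

theorem CKAdm.sq_integrable {f : ℝ → ℝ} {R : ℝ} (hf : CKAdm f R) : Integrable (fun x => f x ^ 2) := by
  obtain ⟨hm, ⟨B, hB⟩, hs⟩ := hf
  have h1 : IntegrableOn (fun x => f x ^ 2) (Icc R (2 * R)) :=
    ck_bdd_int (hm.pow_const 2).aestronglyMeasurable (B ^ 2) fun x => by
      rw [norm_pow, Real.norm_eq_abs]; exact pow_le_pow_left₀ (abs_nonneg _) (hB x) 2
  exact (integrableOn_iff_integrable_of_support_subset (fun x hx => by
    by_contra h; apply hx; simp [hs x h])).1 h1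

theorem CKAdm.mul {f g : ℝ → ℝ} {R G : ℝ} (hf : CKAdm f R) (hg : Measurable g)
    (hG : ∀ x ∈ Icc R (2 * R), |g x| ≤ G) :
    CKAdm (fun x => g x * f x) R ∧ ∫ x, (g x * f x) ^ 2 ≤ G ^ 2 * ∫ x, f x ^ 2 := by
  have hA : CKAdm (fun x => g x * f x) R := by
    obtain ⟨hm, ⟨B, hB⟩, hs⟩ := hf
    refine ⟨hg.mul hm, ⟨|G| * B, fun x => ?_⟩, fun x hx => by simp [hs x hx]⟩
    have hB0 : 0 ≤ B := (abs_nonneg _).trans (hB 0)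
    by_cases hx : x ∈ Icc R (2 * R)
    · rw [abs_mul]
      exact mul_le_mul ((hG x hx).trans (le_abs_self _)) (hB x) (abs_nonneg _) (abs_nonneg _)
    · beta_reduce; rw [hs x hx]; simp; positivity
  refine ⟨hA, ?_⟩
  rw [← integral_const_mul]
  refine integral_mono hA.sq_integrable (hf.sq_integrable.const_mul _) fun x => ?_
  beta_reduce
  by_cases hx : x ∈ Icc R (2 * R)
  · rw [mul_pow]
    refine mul_le_mul_of_nonneg_right ?_ (sq_nonneg _)
    rw [← sq_abs]
    exact pow_le_pow_left₀ (abs_nonneg _) (hG x hx) 2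
  · rw [hf.2.2 x hx]; simp

theorem ckS_meas {V f : ℝ → ℝ} (hV : LocallyIntegrable V) (hf : Measurable f) :
    Measurable (ckS V f) := by
  have h : Measurable (fun z : ℝ × ℝ => (f z.2 : ℂ) * ckE V z.1 z.2) :=
    (Complex.measurable_ofReal.comp (hf.comp measurable_snd)).mul
      (ck_E_meas hV measurable_fst measurable_snd)
  exact (h.stronglyMeasurable.integral_prod_right' (ν := volume)).measurable

theorem ckS_bdd (V f : ℝ → ℝ) (k : ℝ) : ‖ckS V f k‖ ≤ ∫ x, |f x| := by
  unfold ckS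
  refine (norm_integral_le_integral_norm _).trans (le_of_eq ?_)
  refine integral_congr_ae (Eventually.of_forall fun x => ?_)
  simp [ck_norm_ckE]

theorem ck_bdd_ii {E : Type*} [NormedAddCommGroup E] {f : ℝ → E} (hf : AEStronglyMeasurable f volume)
    (B : ℝ) (h : ∀ x, ‖f x‖ ≤ B) (a b : ℝ) : IntervalIntegrable f volume a b :=
  intervalIntegrable_iff.2 (by
    have : IsFiniteMeasure (volume.restrict (uIoc a b)) := ⟨by simp [uIoc]⟩
    exact ck_bdd_int hf.restrict B h)

theorem ck_cs {h : ℝ → ℝ} {c d : ℝ} (hcd : c ≤ d) (h1 : IntervalIntegrable h volume c d)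
    (h2 : IntervalIntegrable (fun x => h x ^ 2) volume c d) :
    (∫ x in c..d, h x) ^ 2 ≤ (d - c) * ∫ x in c..d, h x ^ 2 := by
  rcases hcd.eq_or_lt with rfl | hlt
  · simp
  set D := ∫ x in c..d, h x with hD
  set L := d - c with hL
  have hL0 : 0 < L := sub_pos.2 hlt
  have hn : 0 ≤ ∫ x in c..d, (L * h x - D) ^ 2 :=
    intervalIntegral.integral_nonneg hcd fun x _ => sq_nonneg _
  have e : ∫ x in c..d, (L * h x - D) ^ 2 = L ^ 2 * (∫ x in c..d, h x ^ 2) - 2 * L * D * D + L * D ^ 2 := by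
    have : ∀ x, (L * h x - D) ^ 2 = L ^ 2 * h x ^ 2 - 2 * L * D * h x + D ^ 2 := fun x => by ring
    simp only [this]
    rw [intervalIntegral.integral_add ((h2.const_mul _).sub (h1.const_mul _)) (by simp),
      intervalIntegral.integral_sub (h2.const_mul _) (h1.const_mul _),
      intervalIntegral.integral_const_mul, intervalIntegral.integral_const_mul,
      intervalIntegral.integral_const, smul_eq_mul]
  rw [e] at hn
  have : 0 ≤ L * (L * (∫ x in c..d, h x ^ 2) - D ^ 2) := by linarith
  have := nonneg_of_mul_nonneg_right this hL0
  linarith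

noncomputable def ckT (V f : ℝ → ℝ) (k : ℝ) : ℂ :=
  Complex.I * (2 * ckS V (fun x => x * f x) k +
    ((k ^ 2)⁻¹ : ℝ) * ckS V (fun x => (∫ t in (0:ℝ)..x, V t) * f x) k)

theorem ck_E_diff (V : ℝ → ℝ) {k k' : ℝ} (hk' : 0 < k') (hkk : k' ≤ k) (x : ℝ) :
    IntervalIntegrable (fun κ : ℝ => Complex.I * (2 * x + ((κ ^ 2)⁻¹ : ℝ) * (∫ t in (0:ℝ)..x, V t : ℝ)) * ckE V κ x) volume k' k ∧
    ckE V k x - ckE V k' x = ∫ κ in k'..k,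
      Complex.I * (2 * x + ((κ ^ 2)⁻¹ : ℝ) * (∫ t in (0:ℝ)..x, V t : ℝ)) * ckE V κ x := by
  set W := ∫ t in (0:ℝ)..x, V t with hW
  have hd : ∀ κ ∈ uIcc k' k, HasDerivAt (fun κ => ckE V κ x)
      (Complex.I * (2 * x + ((κ ^ 2)⁻¹ : ℝ) * (W : ℝ)) * ckE V κ x) κ := by
    intro κ hκ
    rw [uIcc_of_le hkk] at hκ
    have hκ0 : 0 < κ := lt_of_lt_of_le hk' hκ.1
    have h1 : HasDerivAt (fun κ => ckPh V κ x) (x + (2 * κ ^ 2)⁻¹ * W) κ := by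
      unfold ckPh
      have h2 : HasDerivAt (fun κ : ℝ => 1 / (2 * κ)) (1 / 2 * (-(κ ^ 2)⁻¹)) κ := by
        have := (hasDerivAt_inv hκ0.ne').const_mul (1 / 2)
        refine this.congr_of_eventuallyEq (Eventually.of_forall fun y => ?_)
        simp [mul_comm]
      have h3 : HasDerivAt (fun κ : ℝ => κ * x) (1 * x) κ := (hasDerivAt_id κ).mul_const x
      refine (h3.sub (h2.mul_const W)).congr_deriv ?_
      field_simp; ring
    have h4 := ((h1.ofReal_comp.const_mul Complex.I).const_mul 2).cexp
    unfold ckE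
    refine h4.congr_deriv ?_
    push_cast
    have : (κ:ℂ) ≠ 0 := by exact_mod_cast hκ0.ne'
    field_simp
  have hc : ContinuousOn (fun κ : ℝ => Complex.I * (2 * x + ((κ ^ 2)⁻¹ : ℝ) * (W : ℝ)) * ckE V κ x)
      (uIcc k' k) := by
    have c1 : ContinuousOn (fun κ => ckE V κ x) (uIcc k' k) := fun κ hκ =>
      (hd κ hκ).continuousAt.continuousWithinAt
    have c2 : ContinuousOn (fun κ : ℝ => ((κ ^ 2)⁻¹ : ℝ)) (uIcc k' k) := by
      refine ContinuousOn.inv₀ (by fun_prop) fun κ hκ => ?_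
      rw [uIcc_of_le hkk] at hκ
      exact pow_ne_zero 2 (lt_of_lt_of_le hk' hκ.1).ne'
    have c3 := Complex.continuous_ofReal.comp_continuousOn c2
    exact (continuousOn_const.mul (continuousOn_const.add (c3.mul continuousOn_const))).mul c1
  refine ⟨hc.intervalIntegrable, ?_⟩
  rw [intervalIntegral.integral_eq_sub_of_hasDerivAt hd hc.intervalIntegrable]

theorem ck_S_diff {V : ℝ → ℝ} (hV : LocallyIntegrable V) {f : ℝ → ℝ} {R G : ℝ} (hf : CKAdm f R)
    (hG : ∀ x ∈ Icc R (2 * R), |x| ≤ G ∧ |∫ t in (0:ℝ)..x, V t| ≤ G)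
    {k k' : ℝ} (hk' : 0 < k') (hkk : k' ≤ k) :
    ckS V f k - ckS V f k' = ∫ κ in k'..k, ckT V f κ := by
  have hWc := ck_W_cont hV
  have hadm1 := (hf.mul (g := fun x => x) measurable_id (fun x hx => (hG x hx).1)).1
  have hadm2 := (hf.mul hWc.measurable (fun x hx => (hG x hx).2)).1
  have i0 : ∀ (g : ℝ → ℝ), CKAdm g R → ∀ k, Integrable (fun x => (g x : ℂ) * ckE V k x) := by
    intro g hg k
    refine (hg.integrable.abs).mono' ((Complex.measurable_ofReal.comp hg.1).mul
      (ck_E_meas hV measurable_const measurable_id)).aestronglyMeasurable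
      (Eventually.of_forall fun x => ?_)
    rw [norm_mul, ck_norm_ckE, mul_one, Complex.norm_real, Real.norm_eq_abs]
  have e1 : ckS V f k - ckS V f k' = ∫ x, (f x : ℂ) * (ckE V k x - ckE V k' x) := by
    unfold ckS
    rw [← integral_sub (i0 f hf k) (i0 f hf k')]
    simp only [mul_sub]
  set F : ℝ → ℝ → ℂ := fun κ x => (f x : ℂ) *
    (Complex.I * (2 * x + ((κ ^ 2)⁻¹ : ℝ) * (∫ t in (0:ℝ)..x, V t : ℝ)) * ckE V κ x) with hF
  have e2 : ∀ κ, ckT V f κ = ∫ x, F κ x := by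
    intro κ
    unfold ckT ckS
    rw [← integral_const_mul, ← integral_const_mul, ← integral_add ((i0 _ hadm1 κ).const_mul _)
      ((i0 _ hadm2 κ).const_mul _), ← integral_const_mul]
    refine integral_congr_ae (Eventually.of_forall fun x => ?_)
    simp only [hF]
    push_cast
    ring
  have e3 : ckS V f k - ckS V f k' = ∫ x, (∫ κ in k'..k, F κ x) := by
    rw [e1]
    refine integral_congr_ae (Eventually.of_forall fun x => ?_)
    simp only [hF]
    rw [intervalIntegral.integral_const_mul, ← (ck_E_diff V hk' hkk x).2]
  rw [e3]
  simp only [e2, intervalIntegral.integral_of_le hkk]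
  symm
  apply integral_integral_swap
  -- joint integrability
  have hdom : Integrable (fun z : ℝ × ℝ => (1:ℝ) * ((2 * G + (k' ^ 2)⁻¹ * G) * |f z.2|))
      ((volume.restrict (Ioc k' k)).prod volume) :=
    Integrable.mul_prod (integrable_const (1:ℝ)) (hf.integrable.abs.const_mul _)
  refine hdom.mono' ?_ ?_
  · have m1 : Measurable (fun z : ℝ × ℝ => (f z.2 : ℂ)) :=
      Complex.measurable_ofReal.comp (hf.1.comp measurable_snd)
    have m2 : Measurable (fun z : ℝ × ℝ => ckE V z.1 z.2) :=
      ck_E_meas hV measurable_fst measurable_snd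
    have m3 : Measurable (fun z : ℝ × ℝ => ((∫ t in (0:ℝ)..z.2, V t : ℝ) : ℂ)) :=
      Complex.measurable_ofReal.comp (hWc.measurable.comp measurable_snd)
    have m4 : Measurable (fun z : ℝ × ℝ => (((z.1 ^ 2)⁻¹ : ℝ) : ℂ)) :=
      Complex.measurable_ofReal.comp (by fun_prop)
    have m5 : Measurable (fun z : ℝ × ℝ => ((z.2 : ℝ) : ℂ)) :=
      Complex.measurable_ofReal.comp measurable_snd
    exact (m1.mul ((measurable_const.mul ((measurable_const.mul m5).add (m4.mul m3))).mul m2)).aestronglyMeasurable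
  · have hae : ∀ᵐ z : ℝ × ℝ ∂((volume.restrict (Ioc k' k)).prod volume), z.1 ∈ Ioc k' k := by
      have := ae_restrict_mem (μ := (volume : Measure ℝ)) (measurableSet_Ioc (a := k') (b := k))
      exact Measure.quasiMeasurePreserving_fst.ae this
    filter_upwards [hae] with z hz
    simp only [Function.uncurry, hF]
    rw [norm_mul, norm_mul, norm_mul, ck_norm_ckE, Complex.norm_I, Complex.norm_real, Real.norm_eq_abs]
    by_cases hx : z.2 ∈ Icc R (2 * R)
    swap
    · simp [hf.2.2 _ hx]
    have hz0 : 0 < z.1 := hk'.trans hz.1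
    have h1 : ‖(2 * (z.2:ℂ) + ((z.1 ^ 2)⁻¹ : ℝ) * ((∫ t in (0:ℝ)..z.2, V t : ℝ) : ℂ))‖ ≤ 2 * G + (k' ^ 2)⁻¹ * G := by
      refine (norm_add_le _ _).trans ?_
      rw [norm_mul, norm_mul, Complex.norm_real, Complex.norm_real, Complex.norm_real, Real.norm_eq_abs,
        Real.norm_eq_abs, Real.norm_eq_abs, Complex.norm_ofNat, abs_of_nonneg (show 0 ≤ (z.1 ^ 2)⁻¹ by positivity)]
      have h1 := (hG _ hx).1
      have h2 := (hG _ hx).2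
      have h3 : (z.1 ^ 2)⁻¹ ≤ (k' ^ 2)⁻¹ := by
        apply inv_anti₀ (by positivity)
        exact pow_le_pow_left₀ hk'.le hz.1.le 2
      gcongr
    have := mul_le_mul_of_nonneg_left h1 (abs_nonneg (f z.2))
    linarith

theorem ckT_meas {V f : ℝ → ℝ} (hV : LocallyIntegrable V) (hf : Measurable f) :
    Measurable (ckT V f) := by
  have h1 := ckS_meas hV (measurable_id.mul hf : Measurable (fun x => x * f x))
  have h2 := ckS_meas hV ((ck_W_cont hV).measurable.mul hf : Measurable (fun x => (∫ t in (0:ℝ)..x, V t) * f x))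
  have m4 : Measurable (fun z : ℝ => (((z ^ 2)⁻¹ : ℝ) : ℂ)) :=
      Complex.measurable_ofReal.comp (by fun_prop)
  exact measurable_const.mul ((measurable_const.mul h1).add (m4.mul h2))

theorem ckT_le {V f : ℝ → ℝ} {a k : ℝ} (ha : 0 < a) (hk : a ≤ k) :
    ‖ckT V f k‖ ^ 2 ≤ 8 * ‖ckS V (fun x => x * f x) k‖ ^ 2 +
      2 * (a ^ 4)⁻¹ * ‖ckS V (fun x => (∫ t in (0:ℝ)..x, V t) * f x) k‖ ^ 2 := by
  unfold ckT
  set s := ckS V (fun x => x * f x) k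
  set w := ckS V (fun x => (∫ t in (0:ℝ)..x, V t) * f x) k
  rw [norm_mul, Complex.norm_I, one_mul]
  have h1 := norm_add_le (2 * s) (((k ^ 2)⁻¹ : ℝ) * w)
  have hk0 : 0 < k := lt_of_lt_of_le ha hk
  rw [norm_mul, norm_mul, Complex.norm_real, Real.norm_of_nonneg (show 0 ≤ (k ^ 2)⁻¹ by positivity),
    Complex.norm_ofNat] at h1
  have h3 : (k ^ 2)⁻¹ ≤ (a ^ 2)⁻¹ := by
    apply inv_anti₀ (by positivity)
    exact pow_le_pow_left₀ ha.le hk 2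
  have h4 : ‖2 * s + ((k ^ 2)⁻¹ : ℝ) * w‖ ≤ 2 * ‖s‖ + (a ^ 2)⁻¹ * ‖w‖ := by
    have := mul_le_mul_of_nonneg_right h3 (norm_nonneg w)
    linarith
  have h5 := pow_le_pow_left₀ (norm_nonneg _) h4 2
  refine h5.trans ?_
  have : (a ^ 4)⁻¹ = (a ^ 2)⁻¹ ^ 2 := by field_simp
  rw [this]
  nlinarith [sq_nonneg (2 * ‖s‖ - (a ^ 2)⁻¹ * ‖w‖)]

theorem ck_point {V : ℝ → ℝ} (hV : LocallyIntegrable V) {f : ℝ → ℝ} {R G : ℝ} (hf : CKAdm f R)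
    (hG : ∀ x ∈ Icc R (2 * R), |x| ≤ G ∧ |∫ t in (0:ℝ)..x, V t| ≤ G)
    {c d k : ℝ} (hc : 0 < c) (hcd : c < d) (hk : k ∈ Icc c d)
    (iT : IntervalIntegrable (ckT V f) volume c d)
    (iT2 : IntervalIntegrable (fun κ => ‖ckT V f κ‖ ^ 2) volume c d)
    (iS2 : IntervalIntegrable (fun κ => ‖ckS V f κ‖ ^ 2) volume c d) :
    ‖ckS V f k‖ ^ 2 ≤ 2 / (d - c) * (∫ κ in c..d, ‖ckS V f κ‖ ^ 2) +
      2 * (d - c) * ∫ κ in c..d, ‖ckT V f κ‖ ^ 2 := by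
  set A := ∫ κ in c..d, ‖ckT V f κ‖ ^ 2 with hA
  set L := d - c with hL
  have hL0 : 0 < L := sub_pos.2 hcd
  have hD := ck_cs hcd.le iT.norm iT2
  have hle : ∀ s ∈ Icc c d, ∀ t ∈ Icc c d, s ≤ t →
      ‖ckS V f t - ckS V f s‖ ≤ ∫ κ in c..d, ‖ckT V f κ‖ := by
    intro s hs t ht hst
    rw [ck_S_diff hV hf hG (hc.trans_le hs.1) hst]
    refine (intervalIntegral.norm_integral_le_integral_norm hst).trans ?_
    exact intervalIntegral.integral_mono_interval hs.1 hst ht.2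
      (Eventually.of_forall fun x => norm_nonneg _) iT.norm
  have hle2 : ∀ s ∈ Icc c d, ‖ckS V f k‖ ^ 2 ≤ 2 * ‖ckS V f s‖ ^ 2 + 2 * (L * A) := by
    intro s hs
    have h1 : ‖ckS V f k - ckS V f s‖ ≤ ∫ κ in c..d, ‖ckT V f κ‖ := by
      rcases le_total s k with h | h
      · exact hle s hs k hk h
      · rw [norm_sub_rev]; exact hle k hk s hs h
    have h2 := pow_le_pow_left₀ (norm_nonneg _) h1 2
    have h3 : ‖ckS V f k‖ ≤ ‖ckS V f k - ckS V f s‖ + ‖ckS V f s‖ := by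
      have := norm_add_le (ckS V f k - ckS V f s) (ckS V f s)
      simpa using this
    have h4 := pow_le_pow_left₀ (norm_nonneg _) h3 2
    nlinarith [sq_nonneg (‖ckS V f k - ckS V f s‖ - ‖ckS V f s‖)]
  have h5 : ∫ s in c..d, ‖ckS V f k‖ ^ 2 ≤ ∫ s in c..d, (2 * ‖ckS V f s‖ ^ 2 + 2 * (L * A)) :=
    intervalIntegral.integral_mono_on hcd.le (by simp) ((iS2.const_mul 2).add (by simp)) hle2
  rw [intervalIntegral.integral_add (iS2.const_mul 2) (by simp), intervalIntegral.integral_const,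
    intervalIntegral.integral_const, intervalIntegral.integral_const_mul, smul_eq_mul, smul_eq_mul,
    ← hL] at h5
  have h6 : ‖ckS V f k‖ ^ 2 ≤ (2 * (∫ κ in c..d, ‖ckS V f κ‖ ^ 2) + L * (2 * (L * A))) / L := by
    rw [le_div_iff₀ hL0]; linarith
  refine h6.trans (le_of_eq ?_)
  field_simp

theorem ck_sample {V : ℝ → ℝ} (hV : LocallyIntegrable V) {a b C0 ε : ℝ} (ha : 0 < a) (hab : a < b)
    (hW : ∀ x y, |(∫ t in (0:ℝ)..x, V t) - ∫ t in (0:ℝ)..y, V t| ≤ a ^ 2 / 2 * |x - y| + C0)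
    (hε : 0 < ε) :
    ∃ C : ℝ, 0 ≤ C ∧ ∀ (M : ℕ) (f : ℝ → ℝ), CKAdm f (2 ^ M) → ∀ kk : ℕ → ℝ,
      (∀ i : ℕ, i < 2 ^ M → kk i ∈ Icc (a + i * ((b - a) / 2 ^ M)) (a + (i + 1) * ((b - a) / 2 ^ M))) →
      ∑ i ∈ Finset.range (2 ^ M), ‖ckS V f (kk i)‖ ^ 2 ≤
        C * 2 ^ M * ((2:ℝ) ^ M) ^ ε * ∫ x, f x ^ 2 := by
  obtain ⟨C, hC0, hC⟩ := ck_L2 hV ha hab.le hW hε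
  have hC00 : 0 ≤ C0 := by have := hW 0 0; simpa using this
  set G0 := a ^ 2 + C0 + 2 with hG0
  have hG00 : 0 ≤ G0 := by positivity
  set D := 2 / (b - a) * C + 2 * (b - a) * (C * (8 + 2 * (a ^ 4)⁻¹) * G0 ^ 2) with hD
  have hba : 0 < b - a := sub_pos.2 hab
  refine ⟨D, by positivity, fun M f hf kk hkk => ?_⟩
  set R : ℝ := 2 ^ M with hR
  have hR1 : 1 ≤ R := one_le_pow₀ (by norm_num)
  have hR0 : 0 < R := by linarith
  set ℓ := (b - a) / R with hℓ
  have hℓ0 : 0 < ℓ := by positivity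
  have hG : ∀ x ∈ Icc R (2 * R), |x| ≤ G0 * R ∧ |∫ t in (0:ℝ)..x, V t| ≤ G0 * R := by
    intro x hx
    have hx0 : 0 ≤ x := by linarith [hx.1]
    have h1 : |x| ≤ 2 * R := by rw [abs_of_nonneg hx0]; exact hx.2
    have h2 := hW x 0
    simp only [intervalIntegral.integral_same, sub_zero] at h2
    have h3 : 0 ≤ (a ^ 2 + C0) * R := by positivity
    have h4 := mul_le_mul_of_nonneg_left h1 (show 0 ≤ a ^ 2 / 2 by positivity)
    have h5 := mul_le_mul_of_nonneg_left hR1 hC00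
    simp only [hG0]
    constructor
    · linarith
    · linarith
  have A1 := hf.mul (g := fun x => x) measurable_id (fun x hx => (hG x hx).1)
  have A2 := hf.mul (ck_W_cont hV).measurable (fun x hx => (hG x hx).2)
  set f1 : ℝ → ℝ := fun x => x * f x with hf1
  set f2 : ℝ → ℝ := fun x => (∫ t in (0:ℝ)..x, V t) * f x with hf2
  have iS : ∀ g : ℝ → ℝ, Measurable g → ∀ c d, IntervalIntegrable (fun κ => ‖ckS V g κ‖ ^ 2) volume c d := by
    intro g hg c d
    refine ck_bdd_ii ((ckS_meas hV hg).norm.pow_const 2).aestronglyMeasurable ((∫ x, |g x|) ^ 2) (fun κ => ?_) c d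
    rw [norm_pow, norm_norm]
    exact pow_le_pow_left₀ (norm_nonneg _) (ckS_bdd V g κ) 2
  -- integrability of T
  have iTT : ∀ c d, a ≤ c → c ≤ d → IntervalIntegrable (fun κ => ‖ckT V f κ‖ ^ 2) volume c d := by
    intro c d hac hcd
    refine IntervalIntegrable.mono_fun' (((iS f1 A1.1.1 c d).const_mul 8).add
      ((iS f2 A2.1.1 c d).const_mul (2 * (a ^ 4)⁻¹))) 
      ((ckT_meas hV hf.1).norm.pow_const 2).aestronglyMeasurable ?_
    refine (ae_restrict_iff' measurableSet_uIoc).2 (Eventually.of_forall fun κ hκ => ?_)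
    rw [uIoc_of_le hcd] at hκ
    beta_reduce
    rw [norm_pow, norm_norm]
    exact ckT_le ha (hac.trans hκ.1.le)
  have iT : ∀ c d, a ≤ c → c ≤ d → IntervalIntegrable (ckT V f) volume c d := by
    intro c d hac hcd
    refine IntervalIntegrable.mono_fun' ((iTT c d hac hcd).add (intervalIntegrable_const (c := (1:ℝ))))
      (ckT_meas hV hf.1).aestronglyMeasurable ?_
    refine (Eventually.of_forall fun κ => ?_)
    beta_reduce
    nlinarith [sq_nonneg (‖ckT V f κ‖ - 1), norm_nonneg (ckT V f κ)]
  have hac : ∀ i : ℕ, a ≤ a + i * ℓ := fun i => by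
    have : 0 ≤ (i:ℝ) * ℓ := by positivity
    linarith
  have hpt : ∀ i ∈ Finset.range (2 ^ M), ‖ckS V f (kk i)‖ ^ 2 ≤
      2 / ℓ * (∫ κ in (a + i * ℓ)..(a + (i + 1 : ℕ) * ℓ), ‖ckS V f κ‖ ^ 2) +
      2 * ℓ * ∫ κ in (a + i * ℓ)..(a + (i + 1 : ℕ) * ℓ), ‖ckT V f κ‖ ^ 2 := by
    intro i hi
    have h1 := hkk i (Finset.mem_range.1 hi)
    have hlt : a + i * ℓ < a + (i + 1 : ℕ) * ℓ := by push_cast; linarith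
    have e : a + (i + 1 : ℕ) * ℓ - (a + i * ℓ) = ℓ := by push_cast; ring
    have := ck_point hV hf hG (lt_of_lt_of_le ha (hac i)) hlt (by push_cast; exact h1)
      (iT _ _ (hac i) hlt.le) (iTT _ _ (hac i) hlt.le) (iS f hf.1 _ _)
    rwa [e] at this
  refine (Finset.sum_le_sum hpt).trans ?_
  rw [Finset.sum_add_distrib, ← Finset.mul_sum, ← Finset.mul_sum]
  have hend : a + ((2 ^ M : ℕ) : ℝ) * ℓ = b := by
    push_cast; rw [← hR, hℓ]; field_simp; ring
  have s1 := intervalIntegral.sum_integral_adjacent_intervals (μ := volume)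
    (f := fun κ => ‖ckS V f κ‖ ^ 2) (a := fun i : ℕ => a + i * ℓ) (n := 2 ^ M) (fun i _ => iS f hf.1 _ _)
  have s2 := intervalIntegral.sum_integral_adjacent_intervals (μ := volume)
    (f := fun κ => ‖ckT V f κ‖ ^ 2) (a := fun i : ℕ => a + i * ℓ) (n := 2 ^ M)
    (fun i _ => iTT _ _ (hac i) (by push_cast; linarith))
  rw [s1, s2, hend]
  simp only [Nat.cast_zero, zero_mul, add_zero]
  have b0 := hC R f hR1 hf
  have b1 := hC R f1 hR1 A1.1
  have b2 := hC R f2 hR1 A2.1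
  have hRε : 0 ≤ R ^ ε := by positivity
  have bT : ∫ κ in a..b, ‖ckT V f κ‖ ^ 2 ≤ C * (8 + 2 * (a ^ 4)⁻¹) * G0 ^ 2 * R ^ 2 * R ^ ε * ∫ x, f x ^ 2 := by
    have h1 : ∫ κ in a..b, ‖ckT V f κ‖ ^ 2 ≤ ∫ κ in a..b, (8 * ‖ckS V f1 κ‖ ^ 2 +
      2 * (a ^ 4)⁻¹ * ‖ckS V f2 κ‖ ^ 2) :=
      intervalIntegral.integral_mono_on hab.le (iTT a b le_rfl hab.le)
        (((iS f1 A1.1.1 a b).const_mul 8).add ((iS f2 A2.1.1 a b).const_mul (2 * (a ^ 4)⁻¹)))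
        fun κ hκ => ckT_le ha hκ.1
    rw [intervalIntegral.integral_add ((iS f1 A1.1.1 a b).const_mul 8)
      ((iS f2 A2.1.1 a b).const_mul (2 * (a ^ 4)⁻¹)), intervalIntegral.integral_const_mul,
      intervalIntegral.integral_const_mul] at h1
    have c1 := mul_le_mul_of_nonneg_left A1.2 (show 0 ≤ C * R ^ ε by positivity)
    have c2 := mul_le_mul_of_nonneg_left A2.2 (show 0 ≤ C * R ^ ε by positivity)
    have c3 := mul_le_mul_of_nonneg_left (b2.trans c2) (show 0 ≤ 2 * (a ^ 4)⁻¹ by positivity)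
    have c4 := mul_le_mul_of_nonneg_left (b1.trans c1) (show (0:ℝ) ≤ 8 by norm_num)
    refine h1.trans ((add_le_add c4 c3).trans (le_of_eq ?_))
    ring
  have t1 := mul_le_mul_of_nonneg_left b0 (show 0 ≤ 2 / ℓ by positivity)
  have t2 := mul_le_mul_of_nonneg_left bT (show 0 ≤ 2 * ℓ by positivity)
  refine (add_le_add t1 t2).trans (le_of_eq ?_)
  rw [hD, hℓ]
  field_simp

theorem ck_young {p h x : ℝ} (hp : 1 ≤ p) (hh : 0 < h) (hx : h ≤ |x|) : |x| ≤ h ^ (1 - p) * |x| ^ p := by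
  have hx0 : 0 < |x| := lt_of_lt_of_le hh hx
  have h1 : |x| ^ (1 - p) ≤ h ^ (1 - p) := Real.rpow_le_rpow_of_nonpos hh hx (by linarith)
  calc |x| = |x| ^ (1 - p) * |x| ^ p := by rw [← Real.rpow_add hx0]; simp
    _ ≤ _ := by gcongr

theorem ck_young2 {p h x : ℝ} (hp : p ≤ 2) (hp1 : 1 ≤ p) (hx : |x| ≤ h) : x ^ 2 ≤ h ^ (2 - p) * |x| ^ p := by
  rcases (abs_nonneg x).eq_or_lt with h0 | hx0
  · have : x = 0 := abs_eq_zero.1 h0.symm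
    subst this
    have : 0 ≤ h := by simpa using hx
    simp; positivity
  have h1 : |x| ^ (2 - p) ≤ h ^ (2 - p) := Real.rpow_le_rpow hx0.le hx (by linarith)
  calc x ^ 2 = |x| ^ (2 - p) * |x| ^ p := by
        rw [← Real.rpow_add hx0, ← sq_abs]; simp
    _ ≤ _ := by gcongr

theorem ck_Vp_int {V : ℝ → ℝ} {p γ : ℝ} (hp : 1 ≤ p) (hγ : 0 < γ) (hm : Measurable V)
    (hLp : Integrable (fun x => |V x| ^ p * (1 + |x|) ^ (γ * p))) :
    Integrable (fun x => |V x| ^ p) := by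
  refine hLp.mono' (hm.abs.pow_const p).aestronglyMeasurable (Eventually.of_forall fun x => ?_)
  rw [Real.norm_of_nonneg (by positivity)]
  have : 1 ≤ (1 + |x|) ^ (γ * p) :=
    Real.one_le_rpow (by linarith [abs_nonneg x]) (by positivity)
  exact le_mul_of_one_le_right (by positivity) this

theorem ck_W_bd {V : ℝ → ℝ} {p : ℝ} (hp : 1 ≤ p) (hV : LocallyIntegrable V)
    (hLp : Integrable (fun x => |V x| ^ p)) {h : ℝ} (hh : 0 < h) :
    ∃ C0 : ℝ, ∀ x y, |(∫ t in (0:ℝ)..x, V t) - ∫ t in (0:ℝ)..y, V t| ≤ h * |x - y| + C0 := by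
  refine ⟨h ^ (1 - p) * ∫ x, |V x| ^ p, fun x y => ?_⟩
  rw [intervalIntegral.integral_interval_sub_left (ck_iiR hV _ _) (ck_iiR hV _ _)]
  have hpt : ∀ t, ‖V t‖ ≤ h + h ^ (1 - p) * |V t| ^ p := by
    intro t
    rw [Real.norm_eq_abs]
    rcases le_total (|V t|) h with h1 | h1
    · have : 0 ≤ h ^ (1 - p) * |V t| ^ p := by positivity
      linarith
    · have := ck_young hp hh h1
      linarith
  rw [← Real.norm_eq_abs, intervalIntegral.norm_integral_eq_norm_integral_uIoc]
  have hi : IntegrableOn (fun t => h + h ^ (1 - p) * |V t| ^ p) (uIoc y x) := by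
    refine Integrable.add ?_ (hLp.integrableOn.const_mul _)
    have : IsFiniteMeasure (volume.restrict (uIoc y x)) := ⟨by simp [uIoc]⟩
    exact integrable_const _
  refine (norm_integral_le_of_norm_le hi (Eventually.of_forall hpt)).trans ?_
  have hfin : IsFiniteMeasure (volume.restrict (uIoc y x)) := ⟨by simp [uIoc]⟩
  rw [integral_add (integrable_const _) (hLp.integrableOn.const_mul _), integral_const_mul, integral_const]
  have h3 : ∫ t in uIoc y x, |V t| ^ p ≤ ∫ t, |V t| ^ p :=
    setIntegral_le_integral hLp (Eventually.of_forall fun t => by positivity)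
  have h4 : (volume.restrict (uIoc y x)).real univ = |x - y| := by
    rw [measureReal_restrict_apply_univ, uIoc, Measure.real, Real.volume_Ioc, ENNReal.toReal_ofReal
      (by simp), max_sub_min_eq_abs]
  rw [h4, smul_eq_mul]
  have := mul_le_mul_of_nonneg_left h3 (show 0 ≤ h ^ (1 - p) by positivity)
  linarith

theorem ck_D {V : ℝ → ℝ} {p γ : ℝ} (hp : 1 ≤ p) (hγ : 0 < γ) (hm : Measurable V)
    (hLp : Integrable (fun x => |V x| ^ p * (1 + |x|) ^ (γ * p))) {R : ℝ} (hR : 1 ≤ R) :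
    ∫ x in Icc R (2 * R), |V x| ^ p ≤ (∫ x, |V x| ^ p * (1 + |x|) ^ (γ * p)) * R ^ (-(γ * p)) := by
  have hR0 : 0 < R := by linarith
  have h1 : ∫ x in Icc R (2 * R), |V x| ^ p ≤ ∫ x in Icc R (2 * R), (|V x| ^ p * (1 + |x|) ^ (γ * p)) * R ^ (-(γ * p)) := by
    refine setIntegral_mono_on (ck_Vp_int hp hγ hm hLp).integrableOn (hLp.integrableOn.mul_const _)
      measurableSet_Icc fun x hx => ?_
    have h2 : R ^ (γ * p) ≤ (1 + |x|) ^ (γ * p) := by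
      refine Real.rpow_le_rpow hR0.le ?_ (by positivity)
      have := le_abs_self x
      linarith [hx.1]
    have h3 : 1 ≤ (1 + |x|) ^ (γ * p) * R ^ (-(γ * p)) := by
      rw [Real.rpow_neg hR0.le, ← div_eq_mul_inv, one_le_div (by positivity)]; exact h2
    rw [mul_assoc]
    exact le_mul_of_one_le_right (by positivity) h3
  refine h1.trans ?_
  rw [integral_mul_const]
  refine mul_le_mul_of_nonneg_right ?_ (by positivity)
  exact setIntegral_le_integral hLp (Eventually.of_forall fun t => by positivity)

noncomputable def ckLow (V : ℝ → ℝ) (β R : ℝ) : ℝ → ℝ :=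
  (Icc R (2 * R) ∩ {x | |V x| ≤ R ^ (-β)}).indicator V
noncomputable def ckHigh (V : ℝ → ℝ) (β R : ℝ) : ℝ → ℝ :=
  (Icc R (2 * R) ∩ {x | R ^ (-β) < |V x|}).indicator V

theorem ck_low_high {V : ℝ → ℝ} {β R x : ℝ} (hx : x ∈ Icc R (2 * R)) :
    V x = ckLow V β R x + ckHigh V β R x := by
  unfold ckLow ckHigh
  by_cases h : |V x| ≤ R ^ (-β)
  · rw [indicator_of_mem (s := Icc R (2 * R) ∩ {x | |V x| ≤ R ^ (-β)}) ⟨hx, h⟩, indicator_of_notMem (fun h' => not_lt.2 h h'.2), add_zero]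
  · rw [indicator_of_mem (s := Icc R (2 * R) ∩ {x | R ^ (-β) < |V x|}) ⟨hx, not_le.1 h⟩,
      indicator_of_notMem (fun h' => h h'.2), zero_add]

theorem ck_low_adm {V : ℝ → ℝ} (hm : Measurable V) {β R : ℝ} (hR : 0 < R) : CKAdm (ckLow V β R) R := by
  refine ⟨hm.indicator (measurableSet_Icc.inter (measurableSet_le hm.abs measurable_const)),
    ⟨R ^ (-β), fun x => ?_⟩, fun x hx => indicator_of_notMem (fun h => hx h.1) _⟩
  unfold ckLow
  by_cases h : x ∈ (Icc R (2 * R) ∩ {x | |V x| ≤ R ^ (-β)})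
  · rw [indicator_of_mem h]; exact h.2
  · rw [indicator_of_notMem h]; simp; positivity

theorem ck_high_meas {V : ℝ → ℝ} (hm : Measurable V) {β R : ℝ} : Measurable (ckHigh V β R) :=
  hm.indicator (measurableSet_Icc.inter (measurableSet_lt measurable_const hm.abs))

theorem ck_low_int {V : ℝ → ℝ} {p γ β R : ℝ} (hp : 1 ≤ p) (hp2 : p ≤ 2) (hγ : 0 < γ) (hm : Measurable V)
    (hLp : Integrable (fun x => |V x| ^ p * (1 + |x|) ^ (γ * p))) (hR : 1 ≤ R) :
    ∫ x, ckLow V β R x ^ 2 ≤ (∫ x, |V x| ^ p * (1 + |x|) ^ (γ * p)) * R ^ (-(β + (γ * p - β * (p - 1)))) := by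
  have hR0 : 0 < R := by linarith
  have hA := ck_low_adm hm (β := β) hR0
  rw [hA.sq_int]
  have h1 : ∫ x in Icc R (2 * R), ckLow V β R x ^ 2 ≤ ∫ x in Icc R (2 * R), (R ^ (-β)) ^ (2 - p) * |V x| ^ p := by
    refine setIntegral_mono_on hA.sq_integrable.integrableOn
      ((ck_Vp_int hp hγ hm hLp).integrableOn.const_mul _) measurableSet_Icc fun x hx => ?_
    unfold ckLow
    by_cases h : x ∈ (Icc R (2 * R) ∩ {x | |V x| ≤ R ^ (-β)})
    · rw [indicator_of_mem h]; exact ck_young2 hp2 hp h.2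
    · rw [indicator_of_notMem h]; simp; positivity
  refine h1.trans ?_
  rw [integral_const_mul]
  have h2 := mul_le_mul_of_nonneg_left (ck_D hp hγ hm hLp hR) (show 0 ≤ (R ^ (-β)) ^ (2 - p) by positivity)
  refine h2.trans (le_of_eq ?_)
  rw [← Real.rpow_mul hR0.le, mul_left_comm, ← Real.rpow_add hR0]
  congr 2; ring

theorem ck_high_int {V : ℝ → ℝ} {p γ β R : ℝ} (hp : 1 ≤ p) (hγ : 0 < γ) (hm : Measurable V)
    (hLp : Integrable (fun x => |V x| ^ p * (1 + |x|) ^ (γ * p))) (hR : 1 ≤ R) :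
    Integrable (ckHigh V β R) ∧
    ∫ x, |ckHigh V β R x| ≤ (∫ x, |V x| ^ p * (1 + |x|) ^ (γ * p)) * R ^ (-(γ * p - β * (p - 1))) := by
  have hR0 : 0 < R := by linarith
  have hz : ∀ x, x ∉ Icc R (2 * R) → ckHigh V β R x = 0 := fun x hx =>
    indicator_of_notMem (fun h => hx h.1) _
  have hb : ∀ x, |ckHigh V β R x| ≤ (R ^ (-β)) ^ (1 - p) * |V x| ^ p := by
    intro x
    unfold ckHigh
    by_cases h : x ∈ (Icc R (2 * R) ∩ {x | R ^ (-β) < |V x|})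
    · rw [indicator_of_mem h]; exact ck_young hp (by positivity) (le_of_lt h.2)
    · rw [indicator_of_notMem h]; simp; positivity
  have hVp := ck_Vp_int hp hγ hm hLp
  have hi : Integrable (ckHigh V β R) :=
    (hVp.const_mul _).mono' (ck_high_meas hm).aestronglyMeasurable (Eventually.of_forall hb)
  refine ⟨hi, ?_⟩
  have e : ∫ x, |ckHigh V β R x| = ∫ x in Icc R (2 * R), |ckHigh V β R x| := by
    rw [setIntegral_eq_integral_of_forall_compl_eq_zero]
    intro x hx
    rw [hz x hx]; simp
  rw [e]
  refine (setIntegral_mono hi.abs.integrableOn (hVp.integrableOn.const_mul _) hb).trans ?_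
  rw [integral_const_mul]
  have h2 := mul_le_mul_of_nonneg_left (ck_D hp hγ hm hLp hR) (show 0 ≤ (R ^ (-β)) ^ (1 - p) by positivity)
  refine h2.trans (le_of_eq ?_)
  rw [← Real.rpow_mul hR0.le, mul_left_comm, ← Real.rpow_add hR0]
  congr 2; ring

theorem ck_sum_le {g : ℝ → ℝ} (hg : Integrable g) (h0 : ∀ x, 0 ≤ g x) (c d : ℝ) (hd : 0 ≤ d) (N : ℕ) :
    ∑ i ∈ Finset.range N, ∫ x in (c + i * d)..(c + (i + 1) * d), g x ≤ ∫ x, g x := by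
  have h := intervalIntegral.sum_integral_adjacent_intervals (f := g) (μ := volume) (n := N)
    (a := fun i : ℕ => c + i * d) (fun i _ => hg.intervalIntegrable)
  have e : ∀ i ∈ Finset.range N, ∫ x in (c + i * d)..(c + (i + 1) * d), g x
      = ∫ x in (c + (i:ℕ) * d)..(c + ((i + 1 : ℕ):ℝ) * d), g x := by
    intro i _; push_cast; rfl
  rw [Finset.sum_congr rfl e]
  beta_reduce at h
  rw [h, intervalIntegral.integral_of_le (by simp; positivity)]
  exact setIntegral_le_integral hg (Eventually.of_forall h0)

theorem ck_sum_sq_le {g : ℝ → ℝ} (hg : Integrable g) (h0 : ∀ x, 0 ≤ g x) (c d : ℝ) (hd : 0 ≤ d) (N : ℕ) :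
    ∑ i ∈ Finset.range N, (∫ x in (c + i * d)..(c + (i + 1) * d), g x) ^ 2 ≤ (∫ x, g x) ^ 2 := by
  have h1 : ∀ i ∈ Finset.range N, 0 ≤ ∫ x in (c + i * d)..(c + (i + 1) * d), g x := fun i _ =>
    intervalIntegral.integral_nonneg (by nlinarith) fun x _ => h0 x
  refine (Finset.sum_sq_le_sq_sum_of_nonneg h1).trans ?_
  exact pow_le_pow_left₀ (Finset.sum_nonneg h1) (ck_sum_le hg h0 c d hd N) 2

noncomputable def ckF (V : ℝ → ℝ) (β : ℝ) (M j i : ℕ) : ℝ → ℝ :=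
  (Ioc (2 ^ M + i * 2 ^ j : ℝ) (2 ^ M + (i + 1) * 2 ^ j : ℝ)).indicator (ckLow V β (2 ^ M))

theorem ck_F_adm {V : ℝ → ℝ} (hm : Measurable V) (β : ℝ) (M j i : ℕ) : CKAdm (ckF V β M j i) (2 ^ M) := by
  obtain ⟨h1, ⟨B, hB⟩, h3⟩ := ck_low_adm hm (β := β) (R := 2 ^ M) (by positivity)
  refine ⟨h1.indicator measurableSet_Ioc, ⟨B, fun x => ?_⟩, fun x hx => ?_⟩
  · unfold ckF
    by_cases h : x ∈ Ioc (2 ^ M + i * 2 ^ j : ℝ) (2 ^ M + (i + 1) * 2 ^ j : ℝ)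
    · rw [indicator_of_mem h]; exact hB x
    · rw [indicator_of_notMem h]; simpa using (abs_nonneg _).trans (hB x)
  · unfold ckF
    simp [indicator, h3 x hx]

theorem ck_le_step (M j i : ℕ) : (2 ^ M + i * 2 ^ j : ℝ) ≤ 2 ^ M + (i + 1) * 2 ^ j := by
  have : (0:ℝ) ≤ 2 ^ j := by positivity
  nlinarith

theorem ck_F_sq {V : ℝ → ℝ} (β : ℝ) (M j i : ℕ) :
    ∫ x, ckF V β M j i x ^ 2 = ∫ x in (2 ^ M + i * 2 ^ j : ℝ)..(2 ^ M + (i + 1) * 2 ^ j : ℝ), ckLow V β (2 ^ M) x ^ 2 := by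
  rw [intervalIntegral.integral_of_le (ck_le_step M j i), ← integral_indicator measurableSet_Ioc]
  congr 1; ext x
  unfold ckF indicator
  split_ifs <;> simp

theorem ck_F_sum {V : ℝ → ℝ} (hm : Measurable V) (β : ℝ) (M j N : ℕ) :
    ∑ i ∈ Finset.range N, ∫ x, ckF V β M j i x ^ 2 ≤ ∫ x, ckLow V β (2 ^ M) x ^ 2 := by
  simp_rw [ck_F_sq]
  exact ck_sum_le (ck_low_adm hm (by positivity)).sq_integrable (fun x => sq_nonneg _) _ _ (by positivity) _

theorem ck_int_mulE {V g : ℝ → ℝ} (hV : LocallyIntegrable V) (hg : Integrable g) (k : ℝ) :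
    Integrable (fun x => (g x : ℂ) * ckE V k x) := by
  have hE : Measurable (fun x => ckE V k x) :=
    ck_E_meas hV (κ := fun _ : ℝ => k) (ξ := fun x : ℝ => x) measurable_const measurable_id
  refine hg.norm.mono' ((Complex.measurable_ofReal.comp_aemeasurable hg.aemeasurable).mul
    hE.aemeasurable).aestronglyMeasurable (Eventually.of_forall fun x => ?_)
  simp [ck_norm_ckE]

theorem ck_step_mem {M j i : ℕ} (hj : j ≤ M) (hi : i < 2 ^ (M - j)) {x : ℝ}
    (hx : x ∈ uIcc (2 ^ M + i * 2 ^ j : ℝ) (2 ^ M + (i + 1) * 2 ^ j : ℝ)) : x ∈ Icc ((2:ℝ) ^ M) (2 * 2 ^ M) := by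
  rw [uIcc_of_le (ck_le_step M j i)] at hx
  have h1 : ((i:ℝ) + 1) * 2 ^ j ≤ 2 ^ M := by
    have : ((i:ℝ) + 1) ≤ 2 ^ (M - j) := by exact_mod_cast hi
    calc ((i:ℝ) + 1) * 2 ^ j ≤ 2 ^ (M - j) * 2 ^ j := by gcongr
      _ = 2 ^ M := by rw [← pow_add]; congr 1; omega
  have h2 : (0:ℝ) ≤ i * 2 ^ j := by positivity
  exact ⟨by linarith [hx.1], by linarith [hx.2]⟩

theorem ck_split {V : ℝ → ℝ} (hV : LocallyIntegrable V) (hm : Measurable V) {β : ℝ} {M j i : ℕ}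
    (hH : Integrable (ckHigh V β (2 ^ M))) (hj : j ≤ M) (hi : i < 2 ^ (M - j)) (k : ℝ) :
    ‖∫ x in (2 ^ M + i * 2 ^ j : ℝ)..(2 ^ M + (i + 1) * 2 ^ j : ℝ), (V x : ℂ) * ckE V k x‖ ^ 2 ≤
      2 * ‖ckS V (ckF V β M j i) k‖ ^ 2 +
      2 * (∫ x in (2 ^ M + i * 2 ^ j : ℝ)..(2 ^ M + (i + 1) * 2 ^ j : ℝ), |ckHigh V β (2 ^ M) x|) ^ 2 := by
  have hL : Integrable (ckLow V β (2 ^ M)) := (ck_low_adm hm (by positivity)).integrable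
  have e : ∫ x in (2 ^ M + i * 2 ^ j : ℝ)..(2 ^ M + (i + 1) * 2 ^ j : ℝ), (V x : ℂ) * ckE V k x
      = ∫ x in (2 ^ M + i * 2 ^ j : ℝ)..(2 ^ M + (i + 1) * 2 ^ j : ℝ),
        ((ckLow V β (2 ^ M) x : ℂ) * ckE V k x + (ckHigh V β (2 ^ M) x : ℂ) * ckE V k x) := by
    refine intervalIntegral.integral_congr fun x hx => ?_
    have := ck_low_high (V := V) (β := β) (ck_step_mem hj hi hx)
    beta_reduce
    rw [← add_mul]
    congr 1
    exact_mod_cast this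
  have e2 : ckS V (ckF V β M j i) k = ∫ x in (2 ^ M + i * 2 ^ j : ℝ)..(2 ^ M + (i + 1) * 2 ^ j : ℝ),
        (ckLow V β (2 ^ M) x : ℂ) * ckE V k x := by
    rw [intervalIntegral.integral_of_le (ck_le_step M j i), ← integral_indicator measurableSet_Ioc]
    unfold ckS
    congr 1; ext x
    unfold ckF indicator
    split_ifs <;> simp
  rw [e, intervalIntegral.integral_add (ck_int_mulE hV hL k).intervalIntegrable
    (ck_int_mulE hV hH k).intervalIntegrable, ← e2]
  have h3 : ‖∫ x in (2 ^ M + i * 2 ^ j : ℝ)..(2 ^ M + (i + 1) * 2 ^ j : ℝ), (ckHigh V β (2 ^ M) x : ℂ) * ckE V k x‖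
      ≤ ∫ x in (2 ^ M + i * 2 ^ j : ℝ)..(2 ^ M + (i + 1) * 2 ^ j : ℝ), |ckHigh V β (2 ^ M) x| := by
    refine (intervalIntegral.norm_integral_le_integral_norm (ck_le_step M j i)).trans (le_of_eq ?_)
    congr 1; ext x
    simp [ck_norm_ckE]
  have h4 := norm_add_le (ckS V (ckF V β M j i) k)
    (∫ x in (2 ^ M + i * 2 ^ j : ℝ)..(2 ^ M + (i + 1) * 2 ^ j : ℝ), (ckHigh V β (2 ^ M) x : ℂ) * ckE V k x)
  have h5 := pow_le_pow_left₀ (norm_nonneg _) (h4.trans (add_le_add_right h3 _)) 2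
  refine h5.trans ?_
  generalize ‖ckS V (ckF V β M j i) k‖ = A
  generalize ∫ x in (2 ^ M + i * 2 ^ j : ℝ)..(2 ^ M + (i + 1) * 2 ^ j : ℝ), |ckHigh V β (2 ^ M) x| = B
  nlinarith [sq_nonneg (A - B)]

theorem ck_unitI {V : ℝ → ℝ} (hV : LocallyIntegrable V) (hm : Measurable V) {β : ℝ} {M i : ℕ}
    (hH : Integrable (ckHigh V β (2 ^ M))) (hi : i < 2 ^ M) :
    (∫ x in (2 ^ M + i : ℝ)..(2 ^ M + (i + 1) : ℝ), |V x|) ^ 2 ≤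
      2 * (∫ x, ckF V β M 0 i x ^ 2) +
      2 * (∫ x in (2 ^ M + i * 2 ^ 0 : ℝ)..(2 ^ M + (i + 1) * 2 ^ 0 : ℝ), |ckHigh V β (2 ^ M) x|) ^ 2 := by
  have hA := ck_low_adm hm (β := β) (R := 2 ^ M) (by positivity)
  have hL : Integrable (ckLow V β (2 ^ M)) := hA.integrable
  rw [ck_F_sq]
  have hst := ck_le_step M 0 i
  have e0 : ∫ x in (2 ^ M + i : ℝ)..(2 ^ M + (i + 1) : ℝ), |V x| =
     ∫ x in (2 ^ M + i * 2 ^ 0 : ℝ)..(2 ^ M + (i + 1) * 2 ^ 0 : ℝ), |V x| := by simp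
  rw [e0]
  have h1 : ∫ x in (2 ^ M + i * 2 ^ 0 : ℝ)..(2 ^ M + (i + 1) * 2 ^ 0 : ℝ), |V x| ≤
    (∫ x in (2 ^ M + i * 2 ^ 0 : ℝ)..(2 ^ M + (i + 1) * 2 ^ 0 : ℝ), |ckLow V β (2 ^ M) x|) +
    ∫ x in (2 ^ M + i * 2 ^ 0 : ℝ)..(2 ^ M + (i + 1) * 2 ^ 0 : ℝ), |ckHigh V β (2 ^ M) x| := by
    rw [← intervalIntegral.integral_add hL.abs.intervalIntegrable hH.abs.intervalIntegrable]
    refine intervalIntegral.integral_mono_on hst (ck_iiR hV _ _).abs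
      (hL.abs.intervalIntegrable.add hH.abs.intervalIntegrable) fun x hx => ?_
    rw [← uIcc_of_le hst] at hx
    rw [ck_low_high (V := V) (β := β) (ck_step_mem (Nat.zero_le M) (by simpa using hi) hx)]
    exact abs_add_le _ _
  have h2 := ck_cs hst (h := fun x => |ckLow V β (2 ^ M) x|) hL.abs.intervalIntegrable
    (by simpa [sq_abs] using hA.sq_integrable.intervalIntegrable)
  simp only [sq_abs] at h2
  have h3 : (2 ^ M + (i + 1) * 2 ^ 0 : ℝ) - (2 ^ M + i * 2 ^ 0) = 1 := by ring
  rw [h3, one_mul] at h2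
  have h0 : 0 ≤ ∫ x in (2 ^ M + i * 2 ^ 0 : ℝ)..(2 ^ M + (i + 1) * 2 ^ 0 : ℝ), |V x| :=
    intervalIntegral.integral_nonneg hst fun _ _ => abs_nonneg _
  have h5 := pow_le_pow_left₀ h0 h1 2
  refine h5.trans ?_
  refine le_trans ?_ (add_le_add_left (mul_le_mul_of_nonneg_left h2 zero_le_two) _)
  generalize ∫ x in (2 ^ M + i * 2 ^ 0 : ℝ)..(2 ^ M + (i + 1) * 2 ^ 0 : ℝ), |ckHigh V β (2 ^ M) x| = B
  generalize ∫ x in (2 ^ M + i * 2 ^ 0 : ℝ)..(2 ^ M + (i + 1) * 2 ^ 0 : ℝ), |ckLow V β (2 ^ M) x| = A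
  nlinarith [sq_nonneg (A - B)]

noncomputable def ckQ (V : ℝ → ℝ) (β : ℝ) (M j : ℕ) (k : ℝ) : ℝ :=
  ∑ i ∈ Finset.range (2 ^ (M - j)), ‖ckS V (ckF V β M j i) k‖ ^ 2

theorem ck_pow_comm (M : ℕ) (e : ℝ) : ((2:ℝ) ^ M) ^ e = ((2:ℝ) ^ e) ^ M := by
  rw [← Real.rpow_natCast, ← Real.rpow_natCast, ← Real.rpow_mul (by norm_num), ← Real.rpow_mul (by norm_num),
    mul_comm]

theorem ck_good {V : ℝ → ℝ} {p γ β ε k : ℝ} (hp : 1 ≤ p) (hp2 : p ≤ 2) (hγ : 0 < γ) (hm : Measurable V)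
    (hV : LocallyIntegrable V)
    (hLp : Integrable (fun x => |V x| ^ p * (1 + |x|) ^ (γ * p))) (hβ : 0 ≤ β) (hε : 0 < ε)
    (hεη : ε ≤ γ * p - β * (p - 1)) (hk : 0 < k) (M1 : ℕ)
    (hg : ∀ M : ℕ, M1 ≤ M → ∀ j ≤ M, ckQ V β M j k ≤ ((2:ℝ) ^ M) ^ (-ε)) :
    ∃ u, SchrodingerSolution V (k^2) u ∧ HasWKBAsymptotics V k u atTop := by
  set Λ := ∫ x, |V x| ^ p * (1 + |x|) ^ (γ * p) with hΛ
  have hΛ0 : 0 ≤ Λ := integral_nonneg fun x => by positivity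
  set η := γ * p - β * (p - 1) with hη
  have hR : ∀ M : ℕ, (1:ℝ) ≤ 2 ^ M := fun M => one_le_pow₀ (by norm_num)
  have hmono : ∀ (M : ℕ) (e : ℝ), ε ≤ e → ((2:ℝ) ^ M) ^ (-e) ≤ ((2:ℝ) ^ M) ^ (-ε) := fun M e he =>
    Real.rpow_le_rpow_of_exponent_le (hR M) (by linarith)
  have hle1 : ∀ M : ℕ, ((2:ℝ) ^ M) ^ (-ε) ≤ 1 := fun M =>
    Real.rpow_le_one_of_one_le_of_nonpos (hR M) (by linarith)
  have hHI := fun M : ℕ => ck_high_int (β := β) hp hγ hm hLp (hR M)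
  have hHsq : ∀ M j N : ℕ, ∑ i ∈ Finset.range N, (∫ x in (2 ^ M + i * 2 ^ j : ℝ)..(2 ^ M + (i + 1) * 2 ^ j : ℝ),
      |ckHigh V β (2 ^ M) x|) ^ 2 ≤ Λ ^ 2 * ((2:ℝ) ^ M) ^ (-ε) := by
    intro M j N
    refine (ck_sum_sq_le (hHI M).1.abs (fun x => abs_nonneg _) (2 ^ M) (2 ^ j) (by positivity) N).trans ?_
    refine (pow_le_pow_left₀ (integral_nonneg fun x => abs_nonneg _) (hHI M).2 2).trans ?_
    rw [mul_pow]
    refine mul_le_mul_of_nonneg_left ?_ (by positivity)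
    have h1 := hmono M η hεη
    have h2 := hle1 M
    have h3 : 0 ≤ ((2:ℝ) ^ M) ^ (-η) := by positivity
    nlinarith
  refine ck_ode hV hk (2 + 2 * Λ + 2 * Λ ^ 2) ((2:ℝ) ^ (-ε)) (by positivity) (by positivity)
    (Real.rpow_lt_one_of_one_lt_of_neg (by norm_num) (by linarith)) M1 ?_ ?_
  · intro M hM j hj
    rw [← ck_pow_comm]
    refine (Finset.sum_le_sum fun i hi => ck_split hV hm (hHI M).1 hj (Finset.mem_range.1 hi) k).trans ?_
    rw [Finset.sum_add_distrib, ← Finset.mul_sum, ← Finset.mul_sum]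
    have h1 := hg M hM j hj
    unfold ckQ at h1
    have h2 := hHsq M j (2 ^ (M - j))
    have h3 : 0 ≤ Λ * ((2:ℝ) ^ M) ^ (-ε) := by positivity
    linarith
  · intro M hM
    rw [← ck_pow_comm]
    refine (Finset.sum_le_sum fun i hi => ck_unitI hV hm (hHI M).1 (Finset.mem_range.1 hi)).trans ?_
    rw [Finset.sum_add_distrib, ← Finset.mul_sum, ← Finset.mul_sum]
    have h1 := (ck_F_sum hm β M 0 (2 ^ M)).trans (ck_low_int (β := β) hp hp2 hγ hm hLp (hR M))
    have h1' : Λ * ((2:ℝ) ^ M) ^ (-(β + η)) ≤ Λ * ((2:ℝ) ^ M) ^ (-ε) :=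
      mul_le_mul_of_nonneg_left (hmono M _ (by linarith)) hΛ0
    have h2 := hHsq M 0 (2 ^ M)
    have h3 : 0 ≤ ((2:ℝ) ^ M) ^ (-ε) := by positivity
    linarith

/-- bad cells -/
def ckBad (V : ℝ → ℝ) (a b β ε : ℝ) (M : ℕ) : Set ℕ :=
  {i | i < 2 ^ M ∧ ∃ k ∈ Icc (a + i * ((b - a) / 2 ^ M)) (a + (i + 1) * ((b - a) / 2 ^ M)),
    ∃ j ≤ M, ((2:ℝ) ^ M) ^ (-ε) < ckQ V β M j k}

theorem ck_count {V : ℝ → ℝ} {p γ β ε a b : ℝ} (hp : 1 ≤ p) (hp2 : p ≤ 2) (hγ : 0 < γ) (hm : Measurable V)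
    (hV : LocallyIntegrable V)
    (hLp : Integrable (fun x => |V x| ^ p * (1 + |x|) ^ (γ * p))) (hε : 0 < ε)
    (hεη : 4 * ε ≤ γ * p - β * (p - 1)) (ha : 0 < a) (hab : a < b) :
    ∃ C : ℝ, 0 ≤ C ∧ ∀ M : ℕ, ((ckBad V a b β ε M).ncard : ℝ) ≤ C * ((M:ℝ) + 1) * ((2:ℝ) ^ M) ^ (1 - β - 2 * ε) := by
  obtain ⟨C0, hW⟩ := ck_W_bd hp hV (ck_Vp_int hp hγ hm hLp) (h := a ^ 2 / 2) (by positivity)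
  obtain ⟨C, hC, hS⟩ := ck_sample hV ha hab hW hε
  set Λ := ∫ x, |V x| ^ p * (1 + |x|) ^ (γ * p) with hΛ
  have hΛ0 : 0 ≤ Λ := integral_nonneg fun x => by positivity
  set η := γ * p - β * (p - 1) with hη
  refine ⟨C * Λ, by positivity, fun M => ?_⟩
  have hR : (1:ℝ) ≤ 2 ^ M := one_le_pow₀ (by norm_num)
  have hR0 : (0:ℝ) < 2 ^ M := by positivity
  have hl : 0 < (b - a) / 2 ^ M := div_pos (by linarith) hR0
  set B := ckBad V a b β ε M with hB
  have hBfin : B.Finite := (Set.finite_Iio (2 ^ M)).subset fun i hi => hi.1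
  classical
  have hex : ∀ i : ℕ, ∃ k, k ∈ Icc (a + i * ((b - a) / 2 ^ M)) (a + (i + 1) * ((b - a) / 2 ^ M)) ∧
      (i ∈ B → ∃ j ≤ M, ((2:ℝ) ^ M) ^ (-ε) < ckQ V β M j k) := by
    intro i
    by_cases h : i ∈ B
    · obtain ⟨_, k, hk, hj⟩ := h
      exact ⟨k, hk, fun _ => hj⟩
    · exact ⟨a + i * ((b - a) / 2 ^ M), ⟨le_rfl, by nlinarith⟩, fun h' => absurd h' h⟩
  choose kk hkk hkB using hex
  have hQ0 : ∀ j k, 0 ≤ ckQ V β M j k := fun j k => Finset.sum_nonneg fun i _ => by positivity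
  -- upper bound
  have hup : ∀ j, ∑ i ∈ Finset.range (2 ^ M), ckQ V β M j (kk i) ≤
      C * 2 ^ M * ((2:ℝ) ^ M) ^ ε * (Λ * ((2:ℝ) ^ M) ^ (-(β + η))) := by
    intro j
    unfold ckQ
    rw [Finset.sum_comm]
    refine (Finset.sum_le_sum fun m _ => hS M _ (ck_F_adm hm β M j m) kk fun i _ => hkk i).trans ?_
    rw [← Finset.mul_sum]
    refine mul_le_mul_of_nonneg_left ?_ (by positivity)
    exact (ck_F_sum hm β M j _).trans (ck_low_int (β := β) hp hp2 hγ hm hLp hR)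
  have hlow : (B.ncard : ℝ) * ((2:ℝ) ^ M) ^ (-ε) ≤
      ∑ i ∈ Finset.range (2 ^ M), ∑ j ∈ Finset.range (M + 1), ckQ V β M j (kk i) := by
    rw [Set.ncard_eq_toFinset_card B hBfin, ← nsmul_eq_mul, ← Finset.sum_const]
    have hsub : hBfin.toFinset ⊆ Finset.range (2 ^ M) := by
      intro i hi
      rw [Set.Finite.mem_toFinset] at hi
      exact Finset.mem_range.2 hi.1
    refine le_trans (Finset.sum_le_sum fun i hi => ?_) (Finset.sum_le_sum_of_subset_of_nonneg hsub
      fun i _ _ => Finset.sum_nonneg fun j _ => hQ0 j (kk i))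
    rw [Set.Finite.mem_toFinset] at hi
    obtain ⟨j, hj, hjQ⟩ := hkB i hi
    exact hjQ.le.trans (Finset.single_le_sum (f := fun j => ckQ V β M j (kk i)) (fun j _ => hQ0 j (kk i))
      (Finset.mem_range.2 (by omega)))
  rw [Finset.sum_comm] at hlow
  have h1 := hlow.trans (Finset.sum_le_sum fun j _ => hup j)
  rw [Finset.sum_const, Finset.card_range, nsmul_eq_mul] at h1
  have h2 : (B.ncard : ℝ) = (B.ncard : ℝ) * ((2:ℝ) ^ M) ^ (-ε) * ((2:ℝ) ^ M) ^ ε := by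
    rw [mul_assoc, ← Real.rpow_add hR0]; simp
  rw [h2]
  refine (mul_le_mul_of_nonneg_right h1 (by positivity)).trans ?_
  have h3 : ((M + 1 : ℕ):ℝ) * (C * 2 ^ M * ((2:ℝ) ^ M) ^ ε * (Λ * ((2:ℝ) ^ M) ^ (-(β + η)))) * ((2:ℝ) ^ M) ^ ε
      = C * Λ * ((M:ℝ) + 1) * (((2:ℝ) ^ M) ^ (1:ℝ) * ((2:ℝ) ^ M) ^ ε * ((2:ℝ) ^ M) ^ (-(β + η)) * ((2:ℝ) ^ M) ^ ε) := by
    rw [Real.rpow_one]; push_cast; ring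
  rw [h3, ← Real.rpow_add hR0, ← Real.rpow_add hR0, ← Real.rpow_add hR0]
  refine mul_le_mul_of_nonneg_left ?_ (by positivity)
  exact Real.rpow_le_rpow_of_exponent_le hR (by linarith)

theorem ck_cell {a b k : ℝ} (hab : a < b) (hk : k ∈ Icc a b) (M : ℕ) :
    ∃ i : ℕ, i < 2 ^ M ∧ k ∈ Icc (a + i * ((b - a) / 2 ^ M)) (a + (i + 1) * ((b - a) / 2 ^ M)) := by
  have hR0 : (0:ℝ) < 2 ^ M := by positivity
  have hl : 0 < (b - a) / 2 ^ M := div_pos (by linarith) hR0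
  have e : (2:ℝ) ^ M * ((b - a) / 2 ^ M) = b - a := by field_simp
  set l := (b - a) / 2 ^ M
  rcases hk.2.eq_or_lt with rfl | hlt
  · refine ⟨2 ^ M - 1, by have : 0 < 2 ^ M := by positivity
                          omega, ?_⟩
    have h1 : ((2 ^ M - 1 : ℕ) : ℝ) = 2 ^ M - 1 := by
      rw [Nat.cast_sub Nat.one_le_two_pow]; simp
    rw [h1]
    constructor <;> nlinarith
  · have h0 : 0 ≤ (k - a) / l := div_nonneg (by linarith [hk.1]) hl.le
    have h1 := Nat.floor_le h0
    have h2 := Nat.lt_floor_add_one ((k - a) / l)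
    rw [le_div_iff₀ hl] at h1
    rw [div_lt_iff₀ hl] at h2
    refine ⟨⌊(k - a) / l⌋₊, ?_, by linarith, by linarith⟩
    have h3 : (⌊(k - a) / l⌋₊ : ℝ) < 2 ^ M := by
      by_contra h
      have := mul_le_mul_of_nonneg_right (not_lt.1 h) hl.le
      linarith
    exact_mod_cast h3

theorem ck_dim {V : ℝ → ℝ} {p γ β a b : ℝ} (hp : 1 ≤ p) (hp2 : p ≤ 2) (hγ : 0 < γ) (hm : Measurable V)
    (hV : LocallyIntegrable V)
    (hLp : Integrable (fun x => |V x| ^ p * (1 + |x|) ^ (γ * p))) (hβ : 0 ≤ β) (hβ1 : β < 1)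
    (hη : 0 < γ * p - β * (p - 1)) (ha : 0 < a) (hab : a < b) :
    dimH {k | k ∈ Icc a b ∧ ¬ ∃ u, SchrodingerSolution V (k^2) u ∧ HasWKBAsymptotics V k u atTop}
      ≤ ENNReal.ofReal (1 - β) := by
  set η := γ * p - β * (p - 1) with hηd
  set ε := η / 4 with hεd
  have hε : 0 < ε := by positivity
  obtain ⟨C, hC, hcnt⟩ := ck_count (ε := ε) (β := β) hp hp2 hγ hm hV hLp hε (by linarith) ha hab
  set S := {k | k ∈ Icc a b ∧ ¬ ∃ u, SchrodingerSolution V (k^2) u ∧ HasWKBAsymptotics V k u atTop} with hS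
  set d := 1 - β with hd
  have hd0 : 0 < d := by linarith
  let t : ℕ → ℕ × ℕ → Set ℝ := fun n q => {x | n ≤ q.1 ∧ q.2 ∈ ckBad V a b β ε q.1 ∧
    x ∈ Icc (a + q.2 * ((b - a) / 2 ^ q.1)) (a + (q.2 + 1) * ((b - a) / 2 ^ q.1))}
  have hdiam : ∀ n q, Metric.ediam (t n q) ≤ ENNReal.ofReal ((b - a) / 2 ^ q.1) := by
    intro n q
    refine (Metric.ediam_mono (t := Icc (a + q.2 * ((b - a) / 2 ^ q.1)) (a + (q.2 + 1) * ((b - a) / 2 ^ q.1)))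
      fun x hx => hx.2.2).trans ?_
    rw [Real.ediam_Icc]
    apply le_of_eq; congr 1; ring
  have hemp : ∀ n q, ¬ (n ≤ q.1 ∧ q.2 ∈ ckBad V a b β ε q.1) → t n q = ∅ := by
    intro n q h
    ext x
    simp only [t, mem_ofPred_eq, mem_empty_iff_false, iff_false]
    exact fun h' => h ⟨h'.1, h'.2.1⟩
  have key := Measure.hausdorffMeasure_le_liminf_tsum (X := ℝ) (ι := fun _ : ℕ => ℕ × ℕ) d S (l := atTop)
    (fun n : ℕ => ENNReal.ofReal ((b - a) / 2 ^ n)) ?_ t ?_ ?_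
  rotate_left
  · rw [← ENNReal.ofReal_zero]
    refine ENNReal.tendsto_ofReal ?_
    exact tendsto_const_nhds.div_atTop (tendsto_pow_atTop_atTop_of_one_lt (by norm_num))
  · refine Eventually.of_forall fun n q => ?_
    by_cases h : n ≤ q.1 ∧ q.2 ∈ ckBad V a b β ε q.1
    · refine (hdiam n q).trans (ENNReal.ofReal_le_ofReal ?_)
      have : (2:ℝ) ^ n ≤ 2 ^ q.1 := pow_le_pow_right₀ (by norm_num) h.1
      have hba : 0 ≤ b - a := by linarith
      gcongr
    · rw [hemp n q h]; simp
  · refine Eventually.of_forall fun n k hk => ?_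
    have h1 : ¬ ∀ M : ℕ, n ≤ M → ∀ j ≤ M, ckQ V β M j k ≤ ((2:ℝ) ^ M) ^ (-ε) := fun h =>
      hk.2 (ck_good hp hp2 hγ hm hV hLp hβ hε (by linarith) (by linarith [hk.1.1]) n h)
    push Not at h1
    obtain ⟨M, hM, j, hj, hQ⟩ := h1
    obtain ⟨i, hi, hki⟩ := ck_cell hab hk.1 M
    exact mem_iUnion.2 ⟨(M, i), hM, ⟨hi, k, hki, j, hj, hQ⟩, hki⟩
  have hR0 : ∀ M : ℕ, (0:ℝ) < 2 ^ M := fun M => by positivity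
  have hba : 0 < b - a := by linarith
  let T : ℕ → ℝ := fun M => C * (b - a) ^ d * (((M:ℝ) + 1) * ((2:ℝ) ^ (-(2 * ε))) ^ M)
  have hT : Summable T := by
    refine Summable.mul_left _ ?_
    have hr : ‖(2:ℝ) ^ (-(2 * ε))‖ < 1 := by
      rw [Real.norm_of_nonneg (by positivity)]
      exact Real.rpow_lt_one_of_one_lt_of_neg (by norm_num) (by linarith)
    have h1 := summable_pow_mul_geometric_of_norm_lt_one 1 hr
    have h2 := summable_geometric_of_norm_lt_one hr
    refine (h1.add h2).congr fun M => ?_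
    ring
  have hTsum : ∀ n, ∑' q, Metric.ediam (t n q) ^ d ≤ ∑' M, ENNReal.ofReal (T M) := by
    intro n
    rw [ENNReal.tsum_prod']
    refine ENNReal.tsum_le_tsum fun M => ?_
    have hBfin : (ckBad V a b β ε M).Finite := (Set.finite_Iio (2 ^ M)).subset fun i hi => hi.1
    rw [tsum_eq_sum (s := hBfin.toFinset)]
    · refine (Finset.sum_le_card_nsmul _ _ (ENNReal.ofReal ((b - a) / 2 ^ M) ^ d) fun i _ =>
        ENNReal.rpow_le_rpow (hdiam n (M, i)) hd0.le).trans ?_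
      rw [← Set.ncard_eq_toFinset_card _ hBfin, nsmul_eq_mul,
        ENNReal.ofReal_rpow_of_nonneg (by have := hR0 M; positivity) hd0.le, ← ENNReal.ofReal_natCast,
        ← ENNReal.ofReal_mul (by positivity)]
      refine ENNReal.ofReal_le_ofReal ?_
      refine (mul_le_mul_of_nonneg_right (hcnt M) (by have := hR0 M; positivity)).trans (le_of_eq ?_)
      simp only [T]
      rw [Real.div_rpow hba.le (hR0 M).le, ← ck_pow_comm]
      have : ((2:ℝ) ^ M) ^ (1 - β - 2 * ε) = ((2:ℝ) ^ M) ^ d * ((2:ℝ) ^ M) ^ (-(2 * ε)) := by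
        rw [← Real.rpow_add (hR0 M)]; rfl
      rw [this]
      have h5 : ((2:ℝ) ^ M) ^ d ≠ 0 := by positivity
      field_simp
    · intro i hi
      rw [hemp n (M, i) (fun h => hi (hBfin.mem_toFinset.2 h.2))]
      simp [hd0]
  have hfin : Measure.hausdorffMeasure d S ≠ ⊤ := by
    refine ne_top_of_le_ne_top hT.tsum_ofReal_ne_top (key.trans ?_)
    refine (liminf_le_liminf (Eventually.of_forall hTsum)).trans ?_
    simp
  have := dimH_le_of_hausdorffMeasure_ne_top (d := ⟨d, hd0.le⟩) (s := S) hfin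
  refine this.trans (le_of_eq ?_)
  rw [ENNReal.ofReal, Real.toNNReal_of_nonneg hd0.le]
  rfl

theorem ck_refl {V : ℝ → ℝ} {k : ℝ} {u : ℝ → ℂ} (h1 : SchrodingerSolution (fun x => V (-x)) (k ^ 2) u)
    (h2 : HasWKBAsymptotics (fun x => V (-x)) k u atTop) :
    ∃ v, SchrodingerSolution V (k ^ 2) v ∧ HasWKBAsymptotics V k v atBot := by
  refine ⟨fun x => (starRingEnd ℂ) (u (-x)), ?_, ?_⟩
  · obtain ⟨hd, hu⟩ := h1
    have hder : ∀ x, HasDerivAt (fun x => (starRingEnd ℂ) (u (-x))) (-(starRingEnd ℂ) (deriv u (-x))) x := by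
      intro x
      have h3 : HasDerivAt (fun x => u (-x)) (-(deriv u (-x))) x := by
        have := (hd (-x)).hasDerivAt.scomp x (hasDerivAt_neg x)
        simpa [Function.comp_def] using this
      have h4 := h3.star
      simpa [Function.comp_def] using h4
    refine ⟨fun x => (hder x).differentiableAt, fun x => ?_⟩
    rw [(hder x).deriv, (hder 0).deriv, hu (-x)]
    have e1 : ∫ y in (0:ℝ)..x, ((V y : ℂ) - ((k ^ 2 : ℝ) : ℂ)) * (starRingEnd ℂ) (u (-y))
        = ∫ y in (-x)..(-0), (starRingEnd ℂ) (((V (-y) : ℂ) - ((k ^ 2 : ℝ) : ℂ)) * u y) := by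
      rw [← intervalIntegral.integral_comp_neg]
      refine intervalIntegral.integral_congr fun y _ => ?_
      simp
    rw [e1, neg_zero, intervalIntegral.integral_symm 0 (-x), map_add]
    have e2 : ∫ y in (0:ℝ)..(-x), (starRingEnd ℂ) (((V (-y) : ℂ) - ((k ^ 2 : ℝ) : ℂ)) * u y) =
       (starRingEnd ℂ) (∫ y in (0:ℝ)..(-x), (((V (-y) : ℂ) - ((k ^ 2 : ℝ) : ℂ)) * u y)) := by
      rw [intervalIntegral, intervalIntegral, integral_conj, integral_conj, map_sub]
    rw [e2]
    ring
  · unfold HasWKBAsymptotics at *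
    have h3 := (Complex.continuous_conj.tendsto 1).comp (h2.comp tendsto_neg_atBot_atTop)
    rw [map_one] at h3
    refine h3.congr fun x => ?_
    have e : ∫ y in (0:ℝ)..(-x), V (-y) = - ∫ y in (0:ℝ)..x, V y := by
      rw [intervalIntegral.integral_comp_neg, neg_neg, neg_zero, intervalIntegral.integral_symm]
    simp only [Function.comp_apply, map_mul, ← Complex.exp_conj]
    rw [e]
    congr 2
    rw [map_neg, map_mul, Complex.conj_I, Complex.conj_ofReal]
    push_cast
    ring

theorem ck_half {V : ℝ → ℝ} {p γ : ℝ} (hp1 : 1 < p) (hp2 : p < 2) (hγ : 0 < γ)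
    (hγp : γ * (p / (p - 1)) ≤ 1) (hm : Measurable V) (hV : LocallyIntegrable V)
    (hLp : Integrable (fun x => |V x| ^ p * (1 + |x|) ^ (γ * p))) :
    dimH {k : ℝ | 0 < k ∧ ¬ ∃ u, SchrodingerSolution V (k^2) u ∧ HasWKBAsymptotics V k u atTop}
      ≤ ENNReal.ofReal (1 - γ * (p / (p - 1))) := by
  have hpm : 0 < p - 1 := by linarith
  set q := γ * (p / (p - 1)) with hq
  have hq0 : 0 < q := by positivity
  have hqe : q * (p - 1) = γ * p := by rw [hq]; field_simp
  have h1 : ∀ β, 0 ≤ β → β < q →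
      dimH {k : ℝ | 0 < k ∧ ¬ ∃ u, SchrodingerSolution V (k^2) u ∧ HasWKBAsymptotics V k u atTop}
      ≤ ENNReal.ofReal (1 - β) := by
    intro β hβ hβq
    refine (dimH_mono (t := ⋃ n : ℕ, {k | k ∈ Icc (1 / ((n:ℝ) + 1)) ((n:ℝ) + 2) ∧
      ¬ ∃ u, SchrodingerSolution V (k^2) u ∧ HasWKBAsymptotics V k u atTop}) ?_).trans ?_
    · rintro k ⟨hk, hnot⟩
      obtain ⟨n, hn⟩ := exists_nat_gt (max k (1 / k))
      have hn1 := (le_max_left _ _).trans_lt hn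
      have hn2 := (le_max_right _ _).trans_lt hn
      refine mem_iUnion.2 ⟨n, ⟨?_, by linarith⟩, hnot⟩
      rw [div_le_iff₀ (by positivity)]
      rw [div_lt_iff₀ hk] at hn2
      nlinarith
    · rw [dimH_iUnion]
      refine iSup_le fun n => ?_
      refine ck_dim hp1.le hp2.le hγ hm hV hLp hβ (by linarith) ?_ (by positivity) ?_
      · nlinarith
      · have : 1 / ((n:ℝ) + 1) ≤ 1 := by
          rw [div_le_iff₀ (by positivity)]; linarith [(n.cast_nonneg : (0:ℝ) ≤ n)]
        linarith [(n.cast_nonneg : (0:ℝ) ≤ n)]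
  have hlim : Tendsto (fun β : ℝ => ENNReal.ofReal (1 - β)) (nhdsWithin q (Iio q)) (nhds (ENNReal.ofReal (1 - q))) := by
    refine ENNReal.tendsto_ofReal ?_
    exact ((continuous_const.sub continuous_id).tendsto q).mono_left nhdsWithin_le_nhds
  refine ge_of_tendsto hlim ?_
  filter_upwards [Ioo_mem_nhdsLT hq0] with β hβ
  exact h1 β hβ.1.le hβ.2

theorem ck_loc_neg {V : ℝ → ℝ} (hV : LocallyIntegrable V) : LocallyIntegrable (fun x => V (-x)) := by
  intro x
  obtain ⟨U, hU, h⟩ := hV (-x)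
  refine ⟨Neg.neg ⁻¹' U, continuous_neg.continuousAt.preimage_mem_nhds hU, ?_⟩
  exact ((Measure.measurePreserving_neg volume).integrableOn_comp_preimage
    (MeasurableEquiv.neg ℝ).measurableEmbedding).2 h

/-- **Christ–Kiselev Hausdorff dimension bound.** If `∫ |V|ᵖ (1+|x|)^{γp} dx < ∞`
with `1 ≤ p < 2`, `γ > 0`, `γ p' ≤ 1` (`p' = p/(p-1)` the Hölder conjugate), then the
set of momenta `k > 0` at which the WKB asymptotics fail has Hausdorff dimension at
most `1 - γ p'`. -/
theorem christ_kiselev_dimension_bound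
    (p γ : ℝ) (hp1 : 1 ≤ p) (hp2 : p < 2) (hγ : 0 < γ)
    (hγp : γ * (p / (p - 1)) ≤ 1)
    (V : ℝ → ℝ) (hmeas : Measurable V)
    (hloc : LocallyIntegrable V)
    (hLp : Integrable (fun x => |V x| ^ p * (1 + |x|) ^ (γ * p))) :
    dimH {k : ℝ | 0 < k ∧
        ¬ ∃ up um : ℝ → ℂ,
          SchrodingerSolution V (k ^ 2) up ∧
          SchrodingerSolution V (k ^ 2) um ∧
          HasWKBAsymptotics V k up atTop ∧
          HasWKBAsymptotics V k um atBot}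
      ≤ ENNReal.ofReal (1 - γ * (p / (p - 1))) := by
  rcases hp1.eq_or_lt with rfl | hp
  · refine (dimH_mono (subset_univ _)).trans ?_
    rw [Real.dimH_univ]
    simp
  have hA := ck_half hp hp2 hγ hγp hmeas hloc hLp
  have hB := ck_half (V := fun x => V (-x)) hp hp2 hγ hγp (hmeas.comp measurable_neg) (ck_loc_neg hloc)
    (by simpa using hLp.comp_neg)
  refine (dimH_mono (t := {k : ℝ | 0 < k ∧ ¬ ∃ u, SchrodingerSolution V (k^2) u ∧ HasWKBAsymptotics V k u atTop} ∪
    {k : ℝ | 0 < k ∧ ¬ ∃ u, SchrodingerSolution (fun x => V (-x)) (k^2) u ∧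
      HasWKBAsymptotics (fun x => V (-x)) k u atTop}) ?_).trans ?_
  · rintro k ⟨hk, hnot⟩
    by_contra h
    have h1 : ∃ u, SchrodingerSolution V (k^2) u ∧ HasWKBAsymptotics V k u atTop := by
      by_contra h'
      exact h (Or.inl ⟨hk, h'⟩)
    have h2 : ∃ u, SchrodingerSolution (fun x => V (-x)) (k^2) u ∧
        HasWKBAsymptotics (fun x => V (-x)) k u atTop := by
      by_contra h'
      exact h (Or.inr ⟨hk, h'⟩)
    obtain ⟨u, hu1, hu2⟩ := h1
    obtain ⟨w, hw1, hw2⟩ := h2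
    obtain ⟨v, hv1, hv2⟩ := ck_refl hw1 hw2
    exact hnot ⟨u, v, hu1, hv1, hu2, hv2⟩
  · rw [dimH_union]
    exact max_le hA hB
end

section
/- There exist a continuous potential V : [0,∞) → ℝ and a nonzero twice continuously differentiable function u : [0,∞) → ℝ such that: u(0) = 0; −u''(x) + V(x)u(x) = u(x) for all x ≥ 0; ∫₀^∞ |u(x)|² dx < ∞; and V has Wigner–von Neumann asymptotics: sup_{x ≥ 1} x²·|V(x) − 8·sin(2x)/x| < ∞. -/
open Real Set MeasureTheory

namespace WvN

noncomputable def g (y : ℝ) : ℝ := 2 * y - sin (2 * y)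
noncomputable def D (y : ℝ) : ℝ := 1 + g y ^ 2
noncomputable def U (y : ℝ) : ℝ := sin y / D y
noncomputable def U1 (y : ℝ) : ℝ := cos y / D y - 8 * g y * sin y ^ 3 / D y ^ 2
noncomputable def Q (y : ℝ) : ℝ := -16 * g y * sin (2 * y) / D y - 32 * sin y ^ 4 / D y
  + 128 * g y ^ 2 * sin y ^ 4 / D y ^ 2
noncomputable def th (x : ℝ) : ℝ := x + arctan x
noncomputable def th1 (x : ℝ) : ℝ := (2 + x ^ 2) / (1 + x ^ 2)
noncomputable def p (x : ℝ) : ℝ := √((1 + x ^ 2) / (2 + x ^ 2))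
noncomputable def p1 (x : ℝ) : ℝ := x / ((2 + x ^ 2) ^ 2 * p x)
noncomputable def K (x : ℝ) : ℝ := 1 / ((2 + x ^ 2) * (1 + x ^ 2)) - 4 * x ^ 2 / ((2 + x ^ 2) ^ 2 * (1 + x ^ 2))
  - x ^ 2 / ((2 + x ^ 2) ^ 2 * (1 + x ^ 2) ^ 2)
noncomputable def V (x : ℝ) : ℝ := 1 + K x + th1 x ^ 2 * (Q (th x) - 1)
noncomputable def u (x : ℝ) : ℝ := p x * U (th x)
noncomputable def u1 (x : ℝ) : ℝ := p1 x * U (th x) + U1 (th x) / p x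

lemma D_pos (y : ℝ) : 0 < D y := by unfold D; positivity

lemma g_deriv (y : ℝ) : HasDerivAt g (4 * sin y ^ 2) y := by
  have h := ((hasDerivAt_id y).const_mul 2).sub (((hasDerivAt_id y).const_mul 2).sin)
  refine h.congr_deriv ?_
  simp only [id, cos_two_mul]
  nlinarith [sin_sq_add_cos_sq y]

lemma D_deriv (y : ℝ) : HasDerivAt D (8 * g y * sin y ^ 2) y := by
  have h := ((g_deriv y).pow 2).const_add 1
  refine h.congr_deriv ?_
  push_cast; ring

lemma U_deriv (y : ℝ) : HasDerivAt U (U1 y) y := by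
  have h := (hasDerivAt_sin y).div (D_deriv y) (D_pos y).ne'
  refine h.congr_deriv ?_
  have := (D_pos y).ne'
  unfold U1; field_simp

lemma U1_deriv (y : ℝ) : HasDerivAt U1 ((Q y - 1) * U y) y := by
  have h0 := (D_pos y).ne'
  have h := ((hasDerivAt_cos y).div (D_deriv y) h0).sub
    ((((g_deriv y).const_mul 8).mul ((hasDerivAt_sin y).pow 3)).div ((D_deriv y).pow 2)
      (pow_ne_zero 2 h0))
  refine h.congr_deriv ?_
  simp only [Pi.pow_apply, Pi.mul_apply]
  unfold Q U
  rw [sin_two_mul]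
  push_cast
  field_simp
  ring

lemma th_deriv (x : ℝ) : HasDerivAt th (th1 x) x := by
  have h := (hasDerivAt_id x).add (hasDerivAt_arctan x)
  refine h.congr_deriv ?_
  unfold th1; field_simp; ring

lemma p_pos (x : ℝ) : 0 < p x := by unfold p; positivity

lemma p_sq (x : ℝ) : p x ^ 2 = (1 + x ^ 2) / (2 + x ^ 2) := by
  unfold p; rw [sq_sqrt]; positivity

lemma q_deriv (x : ℝ) (c : ℝ) : HasDerivAt (fun x : ℝ => c + x ^ 2) (2 * x) x := by
  have h := ((hasDerivAt_id x).pow 2).const_add c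
  refine h.congr_deriv ?_
  simp

lemma p_deriv (x : ℝ) : HasDerivAt p (p1 x) x := by
  have hm : (2 + x ^ 2 : ℝ) ≠ 0 := by positivity
  have h := ((q_deriv x 1).div (q_deriv x 2) hm).sqrt (by
    simp only [Pi.div_apply]; positivity)
  refine h.congr_deriv ?_
  simp only [Pi.div_apply]
  have hp := (p_pos x).ne'
  change _ / (2 * p x) = _
  unfold p1
  field_simp
  ring

lemma p1_deriv (x : ℝ) : HasDerivAt p1 (K x * p x) x := by
  have hm : (2 + x ^ 2 : ℝ) ≠ 0 := by positivity
  have hn : (1 + x ^ 2 : ℝ) ≠ 0 := by positivity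
  have hp := (p_pos x).ne'
  have h := (hasDerivAt_id x).div (((q_deriv x 2).pow 2).mul (p_deriv x))
    (mul_ne_zero (pow_ne_zero 2 hm) hp)
  refine h.congr_deriv ?_
  simp only [Pi.pow_apply, Pi.mul_apply, id]
  have e1 : (1 : ℝ) / p x = p x * ((2 + x ^ 2) / (1 + x ^ 2)) := by
    have := p_sq x
    field_simp at this ⊢
    linarith
  have e : K x * p x = (K x * p x ^ 2) * (1 / p x) := by field_simp
  have e3 : ((1 * ((2 + x ^ 2) ^ 2 * p x) - x * ((2:ℕ) * (2 + x ^ 2) ^ (2 - 1) * (2 * x) * p x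
      + (2 + x ^ 2) ^ 2 * p1 x)) / ((2 + x ^ 2) ^ 2 * p x) ^ 2)
      = (1 / (2 + x ^ 2) ^ 2 - 4 * x ^ 2 / (2 + x ^ 2) ^ 3
        - x ^ 2 / ((2 + x ^ 2) ^ 4 * p x ^ 2)) * (1 / p x) := by
    unfold p1
    push_cast
    field_simp
    ring
  rw [e, e3, p_sq]
  congr 1
  unfold K
  field_simp

lemma u_deriv (x : ℝ) : HasDerivAt u (u1 x) x := by
  have h := (p_deriv x).mul ((U_deriv (th x)).comp x (th_deriv x))
  refine h.congr_deriv ?_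
  simp only [Function.comp]
  have hp := (p_pos x).ne'
  have e1 : p x * th1 x = 1 / p x := by
    have := p_sq x
    unfold th1
    field_simp at this ⊢
    linarith
  unfold u1
  linear_combination U1 (th x) * e1

lemma u1_deriv (x : ℝ) : HasDerivAt u1 ((V x - 1) * u x) x := by
  have hp := (p_pos x).ne'
  have h := ((p1_deriv x).mul ((U_deriv (th x)).comp x (th_deriv x))).add
    (((U1_deriv (th x)).comp x (th_deriv x)).div (p_deriv x) hp)
  refine h.congr_deriv ?_
  simp only [Function.comp]
  have e1 : th1 x = 1 / p x ^ 2 := by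
    rw [p_sq]; unfold th1
    field_simp
  unfold V u
  rw [e1]
  field_simp
  ring

lemma V_cont : Continuous V := by
  have hg : Continuous g := by unfold g; fun_prop
  have hD : Continuous D := by unfold D; fun_prop
  have hQ : Continuous Q := by
    unfold Q
    have h0 := fun y => (D_pos y).ne'
    fun_prop (disch := first | exact h0 | (intro y; exact pow_ne_zero 2 (h0 y)))
  have ht : Continuous th := by unfold th; fun_prop
  have ht1 : Continuous th1 := by
    unfold th1
    fun_prop (disch := (intro x; positivity))
  have hK : Continuous K := by
    unfold K
    fun_prop (disch := (intro x; positivity))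
  unfold V
  fun_prop

lemma g_ge {y : ℝ} (hy : 1 ≤ y) : y ≤ g y := by
  unfold g; linarith [sin_le_one (2 * y)]

lemma th_ge {x : ℝ} (hx : 0 ≤ x) : x ≤ th x := by
  unfold th; linarith [arctan_nonneg.2 hx]

lemma u_sq_le {x : ℝ} (hx : 0 ≤ x) : u x ^ 2 ≤ 2 * (1 + x ^ 2)⁻¹ := by
  have hD := D_pos (th x)
  have h1 : p x ^ 2 ≤ 1 := by
    rw [p_sq, div_le_one (by positivity)]; linarith
  have h2 : (1 + x ^ 2) / 2 ≤ D (th x) := by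
    unfold D
    rcases le_total x 1 with h | h
    · nlinarith [sq_nonneg (g (th x))]
    · have a := th_ge hx
      have b := g_ge (h.trans a)
      nlinarith
  have hD1 : 1 ≤ D (th x) := by unfold D; nlinarith [sq_nonneg (g (th x))]
  have h3 : U (th x) ^ 2 ≤ (D (th x))⁻¹ := by
    unfold U
    rw [div_pow, inv_eq_one_div, div_le_div_iff₀ (by positivity) hD]
    have := sin_sq_le_one (th x)
    nlinarith
  have h4 : (D (th x))⁻¹ ≤ ((1 + x ^ 2) / 2)⁻¹ := inv_anti₀ (by positivity) h2
  have h5 : ((1 + x ^ 2) / 2)⁻¹ = 2 * (1 + x ^ 2)⁻¹ := by rw [inv_div, div_eq_mul_inv]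
  unfold u
  rw [mul_pow]
  nlinarith [sq_nonneg (U (th x))]

lemma Q_bound {y : ℝ} (hy : 1 ≤ y) : |Q y + 8 * sin (2 * y) / y| ≤ 176 / y ^ 2 := by
  have hg := g_ge hy
  have hD := D_pos y
  have hy0 : 0 < y := by linarith
  have hDy : y ^ 2 ≤ D y := by unfold D; nlinarith
  have hgD : g y ^ 2 ≤ D y := by unfold D; linarith
  have s4 : sin y ^ 4 ≤ 1 := by
    have := sin_sq_le_one y
    have := sq_nonneg (sin y)
    nlinarith
  have s40 : 0 ≤ sin y ^ 4 := by positivity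
  have e : Q y + 8 * sin (2 * y) / y = -8 * sin (2 * y) * ((g y * sin (2 * y) - 1) / (y * D y))
     - 32 * sin y ^ 4 / D y + 128 * (g y ^ 2 / D y) * sin y ^ 4 / D y := by
    have : sin (2 * y) = 2 * y - g y := by unfold g; ring
    unfold Q
    rw [this]
    field_simp
    unfold D
    ring
  have iD : 1 / D y ≤ 1 / y ^ 2 := one_div_le_one_div_of_le (by positivity) hDy
  have b1 : |(g y * sin (2 * y) - 1) / (y * D y)| ≤ 2 / y ^ 2 := by
    rw [abs_div, abs_of_pos (by positivity : 0 < y * D y), div_le_div_iff₀ (by positivity) (by positivity)]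
    have : |g y * sin (2 * y) - 1| ≤ g y + 1 := by
      have h1 := abs_sin_le_one (2 * y)
      calc _ ≤ |g y * sin (2 * y)| + |1| := abs_sub _ _
        _ ≤ g y + 1 := by
          rw [abs_mul, abs_one, abs_of_nonneg (by linarith : 0 ≤ g y)]
          nlinarith
    have h2 : y * (g y + 1) ≤ 2 * D y := by unfold D; nlinarith
    calc _ ≤ (g y + 1) * y ^ 2 := by gcongr
      _ = y * (y * (g y + 1)) := by ring
      _ ≤ y * (2 * D y) := by gcongr
      _ = _ := by ring
  have b2 : |32 * sin y ^ 4 / D y| ≤ 32 * (1 / y ^ 2) := by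
    rw [abs_of_nonneg (by positivity)]
    calc _ = 32 * sin y ^ 4 * (1 / D y) := by ring
      _ ≤ 32 * 1 * (1 / y ^ 2) := by gcongr
      _ = _ := by ring
  have b3 : |128 * (g y ^ 2 / D y) * sin y ^ 4 / D y| ≤ 128 * (1 / y ^ 2) := by
    rw [abs_of_nonneg (by positivity)]
    have : g y ^ 2 / D y ≤ 1 := (div_le_one hD).2 hgD
    calc _ = 128 * (g y ^ 2 / D y) * sin y ^ 4 * (1 / D y) := by ring
      _ ≤ 128 * 1 * 1 * (1 / y ^ 2) := by gcongr
      _ = _ := by ring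
  have b4 : |-8 * sin (2 * y) * ((g y * sin (2 * y) - 1) / (y * D y))| ≤ 8 * 1 * (2 / y ^ 2) := by
    rw [abs_mul, abs_mul]
    have h1 := abs_sin_le_one (2 * y)
    have : |(-8 : ℝ)| = 8 := by norm_num
    rw [this]
    gcongr
  rw [e]
  calc _ ≤ 8 * 1 * (2 / y ^ 2) + 32 * (1 / y ^ 2) + 128 * (1 / y ^ 2) :=
        (abs_add_le _ _).trans (add_le_add ((abs_sub _ _).trans (add_le_add b4 b2)) b3)
    _ = _ := by ring

lemma sin_bound {x : ℝ} (hx : 1 ≤ x) : |sin (2 * th x) / th x + sin (2 * x) / x| ≤ 4 / x ^ 2 := by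
  have hx0 : 0 < x := by linarith
  have ht := th_ge hx0.le
  have ht0 : 0 < th x := by linarith
  have e0 : sin (2 * th x) = - sin (2 * x - 2 * arctan x⁻¹) := by
    rw [arctan_inv_of_pos hx0]
    have : 2 * x - 2 * (π / 2 - arctan x) = 2 * th x - π := by unfold th; ring
    rw [this, sin_sub_pi]; ring
  have d1 : arctan x⁻¹ ≤ x⁻¹ := by
    have h := Real.le_tan (arctan_nonneg.2 (by positivity : 0 ≤ x⁻¹)) (arctan_lt_pi_div_two _)
    rwa [tan_arctan] at h
  have d0 : 0 ≤ arctan x⁻¹ := arctan_nonneg.2 (by positivity)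
  have e : sin (2 * th x) / th x + sin (2 * x) / x =
      (sin (2 * x) - sin (2 * x - 2 * arctan x⁻¹)) / x - sin (2 * th x) * ((th x - x) / (th x * x)) := by
    have : sin (2 * x - 2 * arctan x⁻¹) = - sin (2 * th x) := by rw [e0]; ring
    rw [this]; field_simp; ring
  have b1 : |sin (2 * x) - sin (2 * x - 2 * arctan x⁻¹)| ≤ 2 * x⁻¹ := by
    have h := abs_sin_sub_sin_le (2 * x) (2 * x - 2 * arctan x⁻¹)
    refine h.trans ?_
    rw [sub_sub_cancel, abs_of_nonneg (by positivity)]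
    linarith
  have b2 : |(sin (2 * x) - sin (2 * x - 2 * arctan x⁻¹)) / x| ≤ 2 / x ^ 2 := by
    rw [abs_div, abs_of_pos hx0]
    calc _ ≤ 2 * x⁻¹ / x := by gcongr
      _ = _ := by field_simp
  have b3 : |sin (2 * th x) * ((th x - x) / (th x * x))| ≤ 2 / x ^ 2 := by
    have h2 : 0 ≤ th x - x := by linarith
    have h3 : th x - x ≤ 2 := by
      unfold th; linarith [arctan_lt_pi_div_two x, pi_le_four]
    rw [abs_mul, abs_of_nonneg (by positivity : 0 ≤ (th x - x) / (th x * x))]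
    calc _ ≤ 1 * (2 / (x * x)) := by
          gcongr
          exact abs_sin_le_one _
      _ = _ := by ring
  rw [e]
  calc _ ≤ 2 / x ^ 2 + 2 / x ^ 2 := (abs_sub _ _).trans (add_le_add b2 b3)
    _ = _ := by ring

lemma K_bound {x : ℝ} (hx : 1 ≤ x) : |K x| ≤ 6 / x ^ 2 := by
  have hx0 : 0 < x := by linarith
  have a1 : 1 / ((2 + x ^ 2) * (1 + x ^ 2)) ≤ 1 / x ^ 2 := by
    gcongr; nlinarith [sq_nonneg x]
  have a2 : 4 * x ^ 2 / ((2 + x ^ 2) ^ 2 * (1 + x ^ 2)) ≤ 4 / x ^ 2 := by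
    rw [div_le_div_iff₀ (by positivity) (by positivity)]
    have : 0 ≤ x ^ 2 := by positivity
    have : 0 ≤ x ^ 6 := by positivity
    nlinarith
  have a3 : x ^ 2 / ((2 + x ^ 2) ^ 2 * (1 + x ^ 2) ^ 2) ≤ 1 / x ^ 2 := by
    rw [div_le_div_iff₀ (by positivity) (by positivity)]
    have : 0 ≤ x ^ 2 := by positivity
    have : 0 ≤ x ^ 6 := by positivity
    have : 0 ≤ x ^ 8 := by positivity
    nlinarith
  have c1 : 0 ≤ 1 / ((2 + x ^ 2) * (1 + x ^ 2)) := by positivity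
  have c2 : 0 ≤ 4 * x ^ 2 / ((2 + x ^ 2) ^ 2 * (1 + x ^ 2)) := by positivity
  have c3 : 0 ≤ x ^ 2 / ((2 + x ^ 2) ^ 2 * (1 + x ^ 2) ^ 2) := by positivity
  have e : 6 / x ^ 2 = 1 / x ^ 2 + 4 / x ^ 2 + 1 / x ^ 2 := by ring
  unfold K
  rw [abs_le, e]
  constructor <;> linarith

lemma V_bound {x : ℝ} (hx : 1 ≤ x) : |V x - 8 * sin (2 * x) / x| ≤ 1000 / x ^ 2 := by
  have hx0 : 0 < x := by linarith
  have ht := th_ge hx0.le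
  have ht1 : 1 ≤ th x := by linarith
  have ht0 : 0 < th x := by linarith
  have q1 : |Q (th x) + 8 * sin (2 * th x) / th x| ≤ 176 / x ^ 2 :=
    (Q_bound ht1).trans (by gcongr)
  have q2 : |Q (th x)| ≤ 184 := by
    have h1 : |8 * sin (2 * th x) / th x| ≤ 8 := by
      rw [abs_div, abs_mul, abs_of_pos ht0, div_le_iff₀ ht0]
      have : |(8 : ℝ)| = 8 := by norm_num
      rw [this]
      nlinarith [abs_sin_le_one (2 * th x)]
    have h2 : 176 / th x ^ 2 ≤ 176 := div_le_self (by norm_num) (one_le_pow₀ ht1)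
    have h3 := (Q_bound ht1).trans h2
    rw [abs_le] at *
    constructor <;> linarith
  have t1 : |th1 x ^ 2 - 1| ≤ 3 / x ^ 2 := by
    have e : th1 x ^ 2 - 1 = (3 + 2 * x ^ 2) / (1 + x ^ 2) ^ 2 := by
      unfold th1; field_simp; ring
    rw [e, abs_of_nonneg (by positivity), div_le_div_iff₀ (by positivity) (by positivity)]
    have : 0 ≤ x ^ 4 := by positivity
    nlinarith
  have t2 : |(th1 x ^ 2 - 1) * (Q (th x) - 1)| ≤ 3 / x ^ 2 * 185 := by
    rw [abs_mul]
    have : |Q (th x) - 1| ≤ 185 := by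
      rw [abs_le] at *
      constructor <;> linarith
    gcongr
  have k := K_bound hx
  have s := sin_bound hx
  have e : V x - 8 * sin (2 * x) / x = K x + (th1 x ^ 2 - 1) * (Q (th x) - 1)
      + (Q (th x) + 8 * sin (2 * th x) / th x) - 8 * (sin (2 * th x) / th x + sin (2 * x) / x) := by
    unfold V; ring
  have e2 : 1000 / x ^ 2 = 1000 * (1 / x ^ 2) := by ring
  have e3 : 6 / x ^ 2 = 6 * (1 / x ^ 2) := by ring
  have e4 : 3 / x ^ 2 * 185 = 555 * (1 / x ^ 2) := by ring
  have e5 : 176 / x ^ 2 = 176 * (1 / x ^ 2) := by ring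
  have e6 : 4 / x ^ 2 = 4 * (1 / x ^ 2) := by ring
  have : 0 < 1 / x ^ 2 := by positivity
  rw [e3] at k
  rw [e4] at t2
  rw [e5] at q1
  rw [e6] at s
  rw [e, e2]
  rw [abs_le] at k t2 q1 s ⊢
  constructor <;> linarith

end WvN

/-- **Wigner–von Neumann example.** There are a continuous potential `V` on `[0,∞)`
with `V(x) = 8 sin(2x)/x + O(x⁻²)` and a nonzero square-integrable twice continuously
differentiable solution `u` of `-u'' + V u = u` with `u(0) = 0`; i.e. `E = 1` is an
imbedded eigenvalue of the Dirichlet operator. -/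
theorem wigner_von_neumann_example :
    ∃ (V u u' u'' : ℝ → ℝ),
      ContinuousOn V (Ici (0 : ℝ)) ∧
      (∀ x ∈ Ici (0 : ℝ), HasDerivAt u (u' x) x) ∧
      (∀ x ∈ Ici (0 : ℝ), HasDerivAt u' (u'' x) x) ∧
      ContinuousOn u'' (Ici (0 : ℝ)) ∧
      (∀ x ∈ Ici (0 : ℝ), -u'' x + V x * u x = u x) ∧
      u 0 = 0 ∧ (∃ x ∈ Ici (0 : ℝ), u x ≠ 0) ∧
      IntegrableOn (fun x => u x ^ 2) (Ici (0 : ℝ)) ∧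
      (∃ C : ℝ, ∀ x ≥ (1 : ℝ),
        x ^ 2 * |V x - 8 * Real.sin (2 * x) / x| ≤ C) := by
  have hu : Continuous WvN.u :=
    continuous_iff_continuousAt.2 fun x => (WvN.u_deriv x).continuousAt
  refine ⟨WvN.V, WvN.u, WvN.u1, fun x => (WvN.V x - 1) * WvN.u x, WvN.V_cont.continuousOn,
    fun x _ => WvN.u_deriv x, fun x _ => WvN.u1_deriv x, ?_, ?_, ?_, ?_, ?_, 1000, ?_⟩
  · exact ((WvN.V_cont.sub continuous_const).mul hu).continuousOn
  · intro x _; ring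
  · simp [WvN.u, WvN.U, WvN.th]
  · refine ⟨1, by simp, ?_⟩
    have hs : 0 < sin (WvN.th 1) := by
      unfold WvN.th
      rw [arctan_one]
      apply sin_pos_of_pos_of_lt_pi
      · positivity
      · linarith [pi_gt_three]
    exact (mul_pos (WvN.p_pos 1) (div_pos hs (WvN.D_pos _))).ne'
  · refine Integrable.mono' ((integrable_inv_one_add_sq.const_mul 2).integrableOn)
      (hu.pow 2).aestronglyMeasurable ?_
    refine (ae_restrict_iff' measurableSet_Ici).2 (Filter.Eventually.of_forall fun x hx => ?_)
    rw [norm_of_nonneg (sq_nonneg _)]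
    exact WvN.u_sq_le hx
  · intro x hx
    have h := WvN.V_bound hx
    rwa [le_div_iff₀ (by positivity), mul_comm] at h
end
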